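/- Let P₁, …, Pₙ ∈ ℤ[x] be non-constant. Then the natural density of S(P₁) ∩ … ∩ S(Pₙ) within the primes is at least 1/(deg(P₁)·deg(P₂)⋯deg(Pₙ)). -/

import Mathlib

section
open MeasureTheory Filter Topology Set

namespace DLB

/-- The Fejer kernel (unnormalised). -/
noncomputable def fejer (u : ℝ) : ℝ := 2 * ∫ y in (0:ℝ)..1, (1 - y) * Real.cos (y * u)

lemma fejer_continuous : Continuous fejer := by
  unfold fejer
  refine continuous_const.mul ?_
  apply intervalIntegral.continuous_parametric_intervalIntegral_of_continuous'
  fun_prop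

lemma fejer_eq {u : ℝ} (hu : u ≠ 0) : fejer u = 2 * (1 - Real.cos u) / u ^ 2 := by
  unfold fejer
  have : ∀ y ∈ uIcc (0:ℝ) 1, HasDerivAt
      (fun y : ℝ => (1 - y) * (Real.sin (y * u) / u) - Real.cos (y * u) / u ^ 2)
      ((1 - y) * Real.cos (y * u)) y := by
    intro y _
    have h1 : HasDerivAt (fun y : ℝ => y * u) u y := by
      simpa using (hasDerivAt_id y).mul_const u
    have h2 : HasDerivAt (fun y : ℝ => 1 - y) (-1) y := by
      simpa using (hasDerivAt_id y).const_sub 1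
    have h3 := (h2.mul ((h1.sin).div_const u)).sub ((h1.cos).div_const (u ^ 2))
    refine h3.congr_deriv ?_
    field_simp
    ring
  rw [intervalIntegral.integral_eq_sub_of_hasDerivAt this]
  · simp
    field_simp
    ring
  · apply Continuous.intervalIntegrable; fun_prop

lemma fejer_zero : fejer 0 = 1 := by
  unfold fejer
  simp
  rw [intervalIntegral.integral_sub (by simp) (by simp)]
  simp
  norm_num

lemma fejer_nonneg (u : ℝ) : 0 ≤ fejer u := by
  by_cases hu : u = 0
  · rw [hu, fejer_zero]; norm_num
  · rw [fejer_eq hu]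
    have := Real.cos_le_one u
    have : 0 ≤ 1 - Real.cos u := by linarith
    positivity

lemma fejer_le (u : ℝ) : fejer u ≤ 5 * (1 + u ^ 2)⁻¹ := by
  by_cases hu : u = 0
  · rw [hu, fejer_zero]; norm_num
  · rw [fejer_eq hu, ← div_eq_mul_inv, div_le_div_iff₀ (by positivity) (by positivity)]
    have h1 := Real.one_sub_sq_div_two_le_cos (x := u)
    have h2 := Real.neg_one_le_cos u
    nlinarith [sq_nonneg u]

lemma fejer_integrable : Integrable fejer := by
  refine (integrable_inv_one_add_sq.const_mul 5).mono' fejer_continuous.aestronglyMeasurable ?_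
  filter_upwards with u
  rw [Real.norm_of_nonneg (fejer_nonneg u)]
  exact fejer_le u

lemma fejer_integral_pos : 0 < ∫ u, fejer u := by
  rw [integral_pos_iff_support_of_nonneg fejer_nonneg fejer_integrable]
  refine (fejer_continuous.isOpen_support).measure_pos _ ⟨0, ?_⟩
  simp [fejer_zero]

lemma fejer_le_five (u : ℝ) : fejer u ≤ 5 := by
  refine (fejer_le u).trans ?_
  have : (1 + u ^ 2)⁻¹ ≤ 1 := inv_le_one_of_one_le₀ (by nlinarith [sq_nonneg u])
  linarith

lemma fejer_comp_integrable {l : ℝ} (hl : 0 < l) (T : ℝ) :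
    Integrable (fun t => fejer (l * (T - t))) := by
  have := (fejer_integrable.comp_mul_left' hl.ne').comp_sub_left T
  simpa using this

/-- Fourier-side expression of the smoothed error. -/
lemma smoothed_eq (f : ℝ → ℝ) (hfm : Measurable f) (M : ℝ)
    (hfM : ∀ t, |f t - 1| ≤ M) (g : ℂ → ℂ) (l : ℝ) (hl : 0 < l)
    (hg : ∀ z : ℂ, 0 < z.re → |z.im| ≤ l →
      ∫ t in Ioi (0:ℝ), ((f t - 1 : ℝ) : ℂ) * Complex.exp (-z * t) = g z)
    (T e : ℝ) (he : 0 < e) :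
    ∫ t in Ioi (0:ℝ), (f t - 1) * Real.exp (-e * t) * fejer (l * (T - t)) =
      2 * ∫ y in (0:ℝ)..1, (1 - y) *
        (Complex.exp (Complex.I * (l * y * T)) * g (e + Complex.I * (l * y))).re := by
  have hM : 0 ≤ M := (abs_nonneg _).trans (hfM 0)
  have hexp : IntegrableOn (fun t : ℝ => Real.exp (-e * t)) (Ioi 0) := by
    simpa using exp_neg_integrableOn_Ioi 0 he
  -- the double integrand
  have hintg : Integrable (Function.uncurry fun (t y : ℝ) =>
      (f t - 1) * Real.exp (-e * t) * ((1 - y) * Real.cos (y * (l * (T - t)))))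
      ((volume.restrict (Ioi (0:ℝ))).prod (volume.restrict (Ioc (0:ℝ) 1))) := by
    have h1 : Integrable (fun p : ℝ × ℝ => (M * Real.exp (-e * p.1)) * (1:ℝ))
      ((volume.restrict (Ioi (0:ℝ))).prod (volume.restrict (Ioc (0:ℝ) 1))) :=
      Integrable.mul_prod (f := fun t : ℝ => M * Real.exp (-e * t)) (g := fun _ => (1:ℝ))
        (hexp.const_mul M) (integrable_const _)
    refine h1.mono' ?_ ?_
    · apply Measurable.aestronglyMeasurable
      unfold Function.uncurry
      fun_prop
    · have : ∀ᵐ p : ℝ × ℝ ∂((volume.restrict (Ioi (0:ℝ))).prod (volume.restrict (Ioc (0:ℝ) 1))),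
          p ∈ (Ioi (0:ℝ)) ×ˢ (Ioc (0:ℝ) 1) := by
        rw [Measure.prod_restrict]
        exact ae_restrict_mem (measurableSet_Ioi.prod measurableSet_Ioc)
      filter_upwards [this] with p hp
      obtain ⟨hp1, hp2⟩ := hp
      simp only [Function.uncurry, mul_one, norm_mul, Real.norm_eq_abs, Real.abs_exp]
      have a1 : |1 - p.2| ≤ 1 := by rw [abs_le]; constructor <;> linarith [hp2.1, hp2.2]
      have a2 := Real.abs_cos_le_one (p.2 * (l * (T - p.1)))
      have a3 := hfM p.1
      have : |1 - p.2| * |Real.cos (p.2 * (l * (T - p.1)))| ≤ 1 := by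
        calc _ ≤ (1:ℝ) * 1 := by gcongr
          _ = 1 := one_mul _
      calc _ ≤ M * Real.exp (-e * p.1) * 1 := by gcongr
        _ = _ := mul_one _
  have h1 : ∀ t : ℝ, (f t - 1) * Real.exp (-e * t) * fejer (l * (T - t)) =
      2 * ∫ y in Ioc (0:ℝ) 1,
        (f t - 1) * Real.exp (-e * t) * ((1 - y) * Real.cos (y * (l * (T - t)))) := by
    intro t
    rw [fejer, intervalIntegral.integral_of_le zero_le_one, integral_const_mul]
    ring
  simp_rw [h1]
  rw [integral_const_mul, integral_integral_swap hintg,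
    intervalIntegral.integral_of_le zero_le_one]
  congr 1
  refine setIntegral_congr_fun measurableSet_Ioc ?_
  intro y hy
  have hz := hg (e + Complex.I * (l * y)) (by simp [he]) (by
    simp only [Complex.add_im, Complex.ofReal_im, Complex.mul_im, Complex.I_re, Complex.I_im,
      Complex.mul_re, Complex.ofReal_re]
    simp only [zero_mul, mul_zero, sub_zero, one_mul, zero_add]
    rw [abs_of_nonneg (by nlinarith [hy.1, hy.2])]
    nlinarith [hy.1, hy.2])
  have hinz : IntegrableOn (fun t : ℝ => Complex.exp (Complex.I * (l * y * T)) * (((f t - 1 : ℝ) : ℂ) *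
      Complex.exp (-(e + Complex.I * (l * y)) * t))) (Ioi 0) := by
    refine (hexp.const_mul M).mono' ?_ ?_
    · apply Measurable.aestronglyMeasurable
      fun_prop
    · filter_upwards with t
      have q1 : ‖Complex.exp (Complex.I * (l * y * T))‖ = 1 := by
        rw [Complex.norm_exp]; simp
      have q2 : ‖Complex.exp (-(e + Complex.I * (l * y)) * t)‖ = Real.exp (-e * t) := by
        rw [Complex.norm_exp]; simp
      rw [norm_mul, norm_mul, q1, q2, one_mul, Complex.norm_real]
      gcongr
      exact hfM t
  have hre := integral_re hinz
  simp only [RCLike.re_to_complex] at hre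
  simp only
  rw [← hz, ← integral_const_mul, ← hre, ← integral_const_mul]
  refine setIntegral_congr_fun measurableSet_Ioi ?_
  intro t _
  simp only
  have : Complex.exp (Complex.I * (l * y * T)) * (((f t - 1 : ℝ) : ℂ) *
      Complex.exp (-(e + Complex.I * (l * y)) * t)) = (((f t - 1) * Real.exp (-e * t) : ℝ) : ℂ) *
      Complex.exp ((y * (l * (T - t)) : ℝ) * Complex.I) := by
    push_cast
    rw [mul_left_comm, ← Complex.exp_add, mul_assoc (_ - _), ← Complex.exp_add]
    congr 2
    ring
  rw [this, Complex.re_ofReal_mul, Complex.exp_ofReal_mul_I_re]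
  ring

lemma smoothed_eq_zero (f : ℝ → ℝ) (hfm : Measurable f) (M : ℝ)
    (hfM : ∀ t, |f t - 1| ≤ M) (g : ℂ → ℂ) (l : ℝ) (hl : 0 < l)
    (hgc : ContinuousOn g {z | 0 ≤ z.re ∧ |z.im| ≤ l})
    (hg : ∀ z : ℂ, 0 < z.re → |z.im| ≤ l →
      ∫ t in Ioi (0:ℝ), ((f t - 1 : ℝ) : ℂ) * Complex.exp (-z * t) = g z)
    (T : ℝ) :
    ∫ t in Ioi (0:ℝ), (f t - 1) * fejer (l * (T - t)) =
      2 * ∫ y in (0:ℝ)..1, (1 - y) *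
        (Complex.exp (Complex.I * (l * y * T)) * g (Complex.I * (l * y))).re := by
  have hM : 0 ≤ M := (abs_nonneg _).trans (hfM 0)
  have hmem : ∀ e ∈ Icc (0:ℝ) 1, ∀ y ∈ Icc (0:ℝ) 1,
      ((e : ℂ) + Complex.I * (l * y)) ∈ {z : ℂ | 0 ≤ z.re ∧ |z.im| ≤ l} := by
    intro e he y hy
    constructor
    · simp [he.1]
    · simp only [Complex.add_im, Complex.ofReal_im, Complex.mul_im, Complex.I_re, Complex.I_im,
        Complex.mul_re, Complex.ofReal_re]
      simp only [zero_mul, mul_zero, sub_zero, one_mul, zero_add]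
      rw [abs_of_nonneg (by nlinarith [hy.1, hy.2])]
      nlinarith [hy.1, hy.2]
  have hco : ContinuousOn (fun p : ℝ × ℝ => g ((p.1 : ℂ) + Complex.I * (l * p.2)))
      (Icc (0:ℝ) 1 ×ˢ Icc (0:ℝ) 1) := by
    refine hgc.comp (Continuous.continuousOn (by fun_prop)) ?_
    intro p hp
    exact hmem p.1 hp.1 p.2 hp.2
  obtain ⟨B, hB⟩ := (isCompact_Icc.prod isCompact_Icc).exists_bound_of_continuousOn hco
  have hl1 : Tendsto (fun e : ℝ => ∫ t in Ioi (0:ℝ),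
      (f t - 1) * Real.exp (-e * t) * fejer (l * (T - t))) (𝓝[>] 0)
      (𝓝 (∫ t in Ioi (0:ℝ), (f t - 1) * fejer (l * (T - t)))) := by
    apply tendsto_integral_filter_of_dominated_convergence (fun t => M * fejer (l * (T - t)))
    · filter_upwards with e
      have := fejer_continuous.measurable
      apply Measurable.aestronglyMeasurable
      fun_prop
    · filter_upwards [self_mem_nhdsWithin] with e he
      filter_upwards [ae_restrict_mem measurableSet_Ioi] with t ht
      rw [norm_mul, norm_mul, Real.norm_of_nonneg (fejer_nonneg _), Real.norm_eq_abs,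
        Real.norm_of_nonneg (Real.exp_nonneg _)]
      have : Real.exp (-e * t) ≤ 1 := by
        rw [Real.exp_le_one_iff]
        have := mul_pos (mem_Ioi.mp he) (mem_Ioi.mp ht)
        linarith
      have h2 := fejer_nonneg (l * (T - t))
      have := hfM t
      calc _ ≤ M * 1 * fejer (l * (T - t)) := by gcongr
        _ = _ := by ring
    · exact ((fejer_comp_integrable hl T).const_mul M).integrableOn
    · filter_upwards with t
      have : Tendsto (fun e : ℝ => (f t - 1) * Real.exp (-e * t) * fejer (l * (T - t))) (𝓝 0)
        (𝓝 ((f t - 1) * Real.exp (-0 * t) * fejer (l * (T - t)))) := by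
        apply Continuous.tendsto
        fun_prop
      simp only [neg_zero, zero_mul, Real.exp_zero, mul_one] at this
      exact this.mono_left nhdsWithin_le_nhds
  have hl2 : Tendsto (fun e : ℝ => ∫ y in Ioc (0:ℝ) 1, (1 - y) *
        (Complex.exp (Complex.I * (l * y * T)) * g (e + Complex.I * (l * y))).re) (𝓝[>] 0)
      (𝓝 (∫ y in Ioc (0:ℝ) 1, (1 - y) *
        (Complex.exp (Complex.I * (l * y * T)) * g (Complex.I * (l * y))).re)) := by
    have hev : ∀ᶠ e : ℝ in 𝓝[>] 0, e ∈ Icc (0:ℝ) 1 := by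
      filter_upwards [Ioc_mem_nhdsGT (zero_lt_one' ℝ)] with e he
      exact ⟨he.1.le, he.2⟩
    apply tendsto_integral_filter_of_dominated_convergence (fun y => B)
    · filter_upwards [hev] with e he
      apply ContinuousOn.aestronglyMeasurable _ measurableSet_Ioc
      refine ContinuousOn.mul (by fun_prop) ?_
      refine Complex.continuous_re.comp_continuousOn ?_
      refine ContinuousOn.mul (by fun_prop) ?_
      refine hgc.comp (Continuous.continuousOn (by fun_prop)) ?_
      intro y hy
      exact hmem e he y ⟨hy.1.le, hy.2⟩
    · filter_upwards [hev] with e he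
      filter_upwards [ae_restrict_mem measurableSet_Ioc] with y hy
      have q1 : ‖Complex.exp (Complex.I * (l * y * T))‖ = 1 := by
        rw [Complex.norm_exp]; simp
      have q2 := hB (e, y) ⟨he, hy.1.le, hy.2⟩
      have a1 : ‖1 - y‖ ≤ 1 := by
        rw [Real.norm_eq_abs, abs_le]; constructor <;> linarith [hy.1, hy.2]
      rw [norm_mul]
      have q3 := Complex.abs_re_le_norm
        (Complex.exp (Complex.I * (l * y * T)) * g (e + Complex.I * (l * y)))
      rw [norm_mul, q1, one_mul] at q3
      calc _ ≤ 1 * B := by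
            gcongr
            exact q3.trans q2
        _ = B := one_mul _
    · exact integrable_const _
    · filter_upwards [ae_restrict_mem measurableSet_Ioc] with y hy
      refine Tendsto.const_mul _ ?_
      refine (Complex.continuous_re.tendsto _).comp ?_
      refine Tendsto.const_mul _ ?_
      have h0 := hgc _ (hmem 0 ⟨le_rfl, zero_le_one⟩ y ⟨hy.1.le, hy.2⟩)
      have : Tendsto (fun e : ℝ => (e : ℂ) + Complex.I * (l * y)) (𝓝[>] 0)
          (𝓝[{z | 0 ≤ z.re ∧ |z.im| ≤ l}] (((0:ℝ) : ℂ) + Complex.I * (l * y))) := by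
        apply tendsto_nhdsWithin_of_tendsto_nhds_of_eventually_within
        · refine Tendsto.mono_left (Continuous.tendsto ?_ 0) nhdsWithin_le_nhds
          fun_prop
        · filter_upwards [hev] with e he
          exact hmem e he y ⟨hy.1.le, hy.2⟩
      have := h0.tendsto.comp this
      simpa [Function.comp_def] using this
  have hl3 := hl2.const_mul 2
  rw [intervalIntegral.integral_of_le zero_le_one]
  refine tendsto_nhds_unique (hl1.congr' ?_) hl3
  filter_upwards [self_mem_nhdsWithin] with e he
  rw [smoothed_eq f hfm M hfM g l hl hg T e he, intervalIntegral.integral_of_le zero_le_one]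

/-- Riemann-Lebesgue step. -/
lemma smoothed_tendsto_zero (f : ℝ → ℝ) (hfm : Measurable f) (M : ℝ)
    (hfM : ∀ t, |f t - 1| ≤ M) (g : ℂ → ℂ) (l : ℝ) (hl : 0 < l)
    (hgc : ContinuousOn g {z | 0 ≤ z.re ∧ |z.im| ≤ l})
    (hg : ∀ z : ℂ, 0 < z.re → |z.im| ≤ l →
      ∫ t in Ioi (0:ℝ), ((f t - 1 : ℝ) : ℂ) * Complex.exp (-z * t) = g z) :
    Tendsto (fun T : ℝ => ∫ t in Ioi (0:ℝ), (f t - 1) * fejer (l * (T - t))) atTop (𝓝 0) := by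
  let q : ℝ → ℂ := (Ioc (0:ℝ) 1).indicator (fun y => ((1 - y : ℝ) : ℂ) * g (Complex.I * (l * y)))
  have hqc : ContinuousOn (fun y : ℝ => ((1 - y : ℝ) : ℂ) * g (Complex.I * (l * y))) (Icc 0 1) := by
    refine ContinuousOn.mul (by fun_prop) ?_
    refine hgc.comp (Continuous.continuousOn (by fun_prop)) ?_
    intro y hy
    constructor
    · simp
    · simp only [Complex.mul_im, Complex.I_re, Complex.I_im,
        Complex.mul_re, Complex.ofReal_re, Complex.ofReal_im]
      simp only [zero_mul, mul_zero, sub_zero, one_mul, zero_add]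
      rw [abs_of_nonneg (by nlinarith [hy.1, hy.2])]
      nlinarith [hy.1, hy.2]
  have hqi : IntegrableOn (fun y : ℝ => ((1 - y : ℝ) : ℂ) * g (Complex.I * (l * y))) (Ioc 0 1) :=
    (hqc.integrableOn_Icc).mono_set Ioc_subset_Icc_self
  have hRL := Real.tendsto_integral_exp_smul_cocompact q
  have h2 : Tendsto (fun T : ℝ => -(l * T / (2 * Real.pi))) atTop (cocompact ℝ) := by
    refine Tendsto.mono_right ?_ atBot_le_cocompact
    refine tendsto_neg_atTop_atBot.comp ?_
    refine Tendsto.atTop_div_const (by positivity) ?_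
    exact tendsto_id.const_mul_atTop hl
  have h3 := (Complex.continuous_re.tendsto _).comp (hRL.comp h2)
  have h4 := h3.const_mul 2
  simp only [Complex.zero_re, mul_zero] at h4
  refine h4.congr ?_
  intro T
  rw [smoothed_eq_zero f hfm M hfM g l hl hgc hg T, intervalIntegral.integral_of_le zero_le_one]
  simp only [Function.comp_apply]
  congr 1
  have h5 : ∀ y : ℝ, Real.fourierChar (-(y * -(l * T / (2 * Real.pi)))) • q y =
      (Ioc (0:ℝ) 1).indicator (fun y : ℝ => Complex.exp (Complex.I * (l * y * T)) *
        (((1 - y : ℝ) : ℂ) * g (Complex.I * (l * y)))) y := by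
    intro y
    by_cases hy : y ∈ Ioc (0:ℝ) 1
    · simp only [q, indicator_of_mem hy, Circle.smul_def, Real.fourierChar_apply, smul_eq_mul]
      congr 2
      push_cast
      field_simp
    · simp only [q, indicator_of_notMem hy, smul_zero]
  simp_rw [h5]
  rw [integral_indicator measurableSet_Ioc]
  have hintg : IntegrableOn (fun y : ℝ => Complex.exp (Complex.I * (l * y * T)) *
        (((1 - y : ℝ) : ℂ) * g (Complex.I * (l * y)))) (Ioc 0 1) := by
    have : ContinuousOn (fun y : ℝ => Complex.exp (Complex.I * (l * y * T)) *
        (((1 - y : ℝ) : ℂ) * g (Complex.I * (l * y)))) (Icc 0 1) :=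
      ContinuousOn.mul (by fun_prop) hqc
    exact (this.integrableOn_Icc).mono_set Ioc_subset_Icc_self
  have := integral_re hintg
  simp only [RCLike.re_to_complex] at this
  rw [← this]
  refine setIntegral_congr_fun measurableSet_Ioc ?_
  intro y _
  simp only
  rw [mul_left_comm, Complex.re_ofReal_mul]

/-- A Wiener-Ikehara type Tauberian theorem. -/
theorem tauberian (f : ℝ → ℝ) (hfm : Measurable f) (M : ℝ) (hf0 : ∀ t, 0 ≤ f t)
    (hfM : ∀ t, f t ≤ M) (hfneg : ∀ t < 0, f t = 0)
    (hmono : ∀ t t', t ≤ t' → f t ≤ f t' * Real.exp (t' - t))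
    (hext : ∀ l : ℝ, 0 < l → ∃ g : ℂ → ℂ, ContinuousOn g {z | 0 ≤ z.re ∧ |z.im| ≤ l} ∧
      ∀ z : ℂ, 0 < z.re → |z.im| ≤ l →
        ∫ t in Ioi (0:ℝ), ((f t - 1 : ℝ) : ℂ) * Complex.exp (-z * t) = g z) :
    Tendsto f atTop (𝓝 1) := by
  have hM0 : 0 ≤ M := (hf0 0).trans (hfM 0)
  have hM : ∀ t, |f t - 1| ≤ M + 1 := fun t => by
    rw [abs_le]; constructor <;> linarith [hf0 t, hfM t]
  set c := ∫ u, fejer u with hc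
  have hcpos : 0 < c := fejer_integral_pos
  have hfint : ∀ l : ℝ, 0 < l → ∀ T, Integrable (fun t => f t * fejer (l * (T - t))) := by
    intro l hl T
    refine ((fejer_comp_integrable hl T).const_mul M).mono' ?_ ?_
    · have := fejer_continuous.measurable
      apply Measurable.aestronglyMeasurable
      fun_prop
    · filter_upwards with t
      rw [norm_mul, Real.norm_of_nonneg (fejer_nonneg _), Real.norm_of_nonneg (hf0 t)]
      exact mul_le_mul_of_nonneg_right (hfM t) (fejer_nonneg _)
  have hfull : ∀ l : ℝ, 0 < l → ∀ T, ∫ t, fejer (l * (T - t)) = c / l := by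
    intro l hl T
    rw [integral_sub_left_eq_self (fun t => fejer (l * t)) volume T,
      Measure.integral_comp_mul_left, abs_of_pos (inv_pos.mpr hl), smul_eq_mul, ← hc]
    field_simp
  -- smoothed means converge
  have hS : ∀ l : ℝ, 0 < l →
      Tendsto (fun T => l / c * ∫ t, f t * fejer (l * (T - t))) atTop (𝓝 1) := by
    intro l hl
    obtain ⟨g, hgc, hg⟩ := hext l hl
    have h1 := smoothed_tendsto_zero f hfm (M + 1) hM g l hl hgc hg
    have h2 : Tendsto (fun T : ℝ => ∫ t in Ioi (0:ℝ), fejer (l * (T - t))) atTop (𝓝 (c / l)) := by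
      have h3 : ∀ T : ℝ, ∫ t in Ioi (0:ℝ), fejer (l * (T - t)) = ∫ t in Iio T, fejer (l * t) := by
        intro T
        rw [← integral_indicator measurableSet_Ioi, ← integral_indicator measurableSet_Iio,
          ← integral_sub_left_eq_self _ volume T]
        congr 1
        ext t
        simp only [indicator, mem_Ioi, mem_Iio, sub_pos, sub_sub_cancel]
      simp_rw [h3]
      have hi : Integrable (fun t => fejer (l * t)) := fejer_integrable.comp_mul_left' hl.ne'
      have h4 := (aecover_Iio (μ := volume) (l := (atTop : Filter ℝ)) tendsto_id).integral_tendsto_of_countably_generated hi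
      have := hfull l hl 0
      rw [← this, integral_sub_left_eq_self (fun t => fejer (l * t)) volume 0]
      exact h4
    have h5 : ∀ T, ∫ t, f t * fejer (l * (T - t)) =
        (∫ t in Ioi (0:ℝ), (f t - 1) * fejer (l * (T - t))) +
          ∫ t in Ioi (0:ℝ), fejer (l * (T - t)) := by
      intro T
      have h6 : ∫ t, f t * fejer (l * (T - t)) =
          ∫ t in Ioi (0:ℝ), f t * fejer (l * (T - t)) := by
        rw [← integral_Ici_eq_integral_Ioi, setIntegral_eq_integral_of_forall_compl_eq_zero]
        intro t ht
        rw [hfneg t (by simpa using ht), zero_mul]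
      rw [h6, ← integral_add]
      · congr 1
        ext t
        ring
      · have : (fun t => (f t - 1) * fejer (l * (T - t))) =
          fun t => f t * fejer (l * (T - t)) - fejer (l * (T - t)) := by ext t; ring
        rw [this]
        exact ((hfint l hl T).sub (fejer_comp_integrable hl T)).integrableOn
      · exact (fejer_comp_integrable hl T).integrableOn
    simp_rw [h5]
    have h7 := (h1.add h2).const_mul (l / c)
    convert h7 using 2
    field_simp
    simp
  -- truncated mass
  let m : ℝ → ℝ := fun R => ∫ u in Icc (-R) R, fejer u
  have hm_lim : Tendsto m atTop (𝓝 c) :=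
    (aecover_Icc (μ := volume) (l := (atTop : Filter ℝ)) tendsto_neg_atTop_atBot
      tendsto_id).integral_tendsto_of_countably_generated fejer_integrable
  have hm_le : ∀ R, m R ≤ c := fun R =>
    setIntegral_le_integral fejer_integrable (Eventually.of_forall fejer_nonneg)
  have hwin : ∀ d : ℝ, 0 < d → ∀ l : ℝ, 0 < l → ∀ T : ℝ,
      ∫ t in Icc (T - d) (T + d), fejer (l * (T - t)) = m (l * d) / l := by
    intro d hd l hl T
    have e1 : ∫ t in Icc (T - d) (T + d), fejer (l * (T - t)) =
        ∫ t in Icc (-d) d, fejer (l * t) := by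
      rw [← integral_indicator measurableSet_Icc, ← integral_indicator measurableSet_Icc,
          ← integral_sub_left_eq_self _ volume T]
      congr 1
      ext t
      simp only [indicator, mem_Icc, sub_sub_cancel]
      refine if_congr ?_ rfl rfl
      constructor <;> rintro ⟨a, b⟩ <;> constructor <;> linarith
    have e2 : ∫ t in Icc (-d) d, fejer (l * t) = l⁻¹ * m (l * d) := by
      simp only [m]
      rw [← integral_indicator measurableSet_Icc, ← integral_indicator measurableSet_Icc]
      have := Measure.integral_comp_mul_left ((Icc (-(l * d)) (l * d)).indicator fejer) l
      rw [abs_of_pos (inv_pos.mpr hl), smul_eq_mul] at this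
      rw [← this]
      congr 1
      ext t
      simp only [indicator, mem_Icc]
      refine if_congr ?_ rfl rfl
      constructor <;> rintro ⟨a, b⟩ <;> constructor <;> nlinarith
    rw [e1, e2]
    field_simp
  have hup : ∀ d : ℝ, 0 < d → ∀ l : ℝ, 0 < l → ∀ T : ℝ,
      f T * Real.exp (-(2 * d)) * (m (l * d) / c) ≤
        l / c * ∫ t, f t * fejer (l * (T + d - t)) := by
    intro d hd l hl T
    have e1 : f T * Real.exp (-(2 * d)) * (m (l * d) / l) ≤
        ∫ t, f t * fejer (l * (T + d - t)) := by
      rw [← hwin d hd l hl (T + d), ← integral_const_mul]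
      refine (setIntegral_mono_on ?_ ?_ measurableSet_Icc ?_).trans
        (setIntegral_le_integral (s := Icc (T + d - d) (T + d + d)) (hfint l hl (T + d)) ?_)
      · exact ((fejer_comp_integrable hl (T + d)).const_mul _).integrableOn
      · exact (hfint l hl (T + d)).integrableOn
      · intro t ht
        refine mul_le_mul_of_nonneg_right ?_ (fejer_nonneg _)
        have h1 := hmono T t (by linarith [ht.1])
        have h2 : Real.exp (t - T) ≤ Real.exp (2 * d) := Real.exp_le_exp.mpr (by linarith [ht.2])
        rw [Real.exp_neg, ← div_eq_mul_inv, div_le_iff₀ (Real.exp_pos _)]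
        exact h1.trans (mul_le_mul_of_nonneg_left h2 (hf0 t))
      · filter_upwards with t
        exact mul_nonneg (hf0 t) (fejer_nonneg _)
    calc _ = l / c * (f T * Real.exp (-(2 * d)) * (m (l * d) / l)) := by field_simp
      _ ≤ _ := by gcongr
  have hlow : ∀ d : ℝ, 0 < d → ∀ l : ℝ, 0 < l → ∀ T : ℝ,
      l / c * ∫ t, f t * fejer (l * (T - d - t)) ≤
        f T * Real.exp (2 * d) + M * (1 - m (l * d) / c) := by
    intro d hd l hl T
    have e1 : ∫ t, f t * fejer (l * (T - d - t)) ≤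
        f T * Real.exp (2 * d) * (c / l) + M * (c / l - m (l * d) / l) := by
      rw [← integral_add_compl (s := Icc (T - d - d) (T - d + d)) measurableSet_Icc
        (hfint l hl (T - d))]
      refine add_le_add ?_ ?_
      · rw [← hfull l hl (T - d), ← integral_const_mul]
        refine (setIntegral_mono_on (hfint l hl (T - d)).integrableOn
          ((fejer_comp_integrable hl (T - d)).const_mul (f T * Real.exp (2 * d))).integrableOn
          measurableSet_Icc ?_).trans
          (setIntegral_le_integral ((fejer_comp_integrable hl (T - d)).const_mul _) ?_)
        · intro t ht
          refine mul_le_mul_of_nonneg_right ?_ (fejer_nonneg _)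
          have h1 := hmono t T (by linarith [ht.2])
          have h2 : Real.exp (T - t) ≤ Real.exp (2 * d) := Real.exp_le_exp.mpr (by linarith [ht.1])
          exact h1.trans (mul_le_mul_of_nonneg_left h2 (hf0 T))
        · filter_upwards with t
          have := hf0 T
          have := fejer_nonneg (l * (T - d - t))
          simp only [Pi.zero_apply]
          positivity
      · have h3 : ∫ t in (Icc (T - d - d) (T - d + d))ᶜ, fejer (l * (T - d - t)) =
            c / l - m (l * d) / l := by
          rw [← hwin d hd l hl (T - d), ← hfull l hl (T - d),
            ← integral_add_compl (s := Icc (T - d - d) (T - d + d)) measurableSet_Icc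
              (fejer_comp_integrable hl (T - d))]
          ring
        rw [← h3, ← integral_const_mul]
        refine setIntegral_mono_on (hfint l hl (T - d)).integrableOn
          ((fejer_comp_integrable hl (T - d)).const_mul M).integrableOn
          measurableSet_Icc.compl ?_
        intro t _
        exact mul_le_mul_of_nonneg_right (hfM t) (fejer_nonneg _)
    calc _ ≤ l / c * (f T * Real.exp (2 * d) * (c / l) + M * (c / l - m (l * d) / l)) := by gcongr
      _ = _ := by field_simp
  have hmc : Tendsto (fun R => m R / c) atTop (𝓝 1) := by
    have := hm_lim.div_const c
    rwa [div_self hcpos.ne'] at this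
  rw [tendsto_order]
  constructor
  · intro a ha
    -- choose d, then R
    have h1 : Tendsto (fun d : ℝ => a * Real.exp (2 * d)) (𝓝[>] 0) (𝓝 a) := by
      have : Tendsto (fun d : ℝ => a * Real.exp (2 * d)) (𝓝 0) (𝓝 (a * Real.exp (2 * 0))) :=
        Continuous.tendsto (by fun_prop) _
      simp only [mul_zero, Real.exp_zero, mul_one] at this
      exact this.mono_left nhdsWithin_le_nhds
    obtain ⟨d, hd1, hd⟩ := ((h1.eventually_lt_const ha).and self_mem_nhdsWithin).exists
    have hd : 0 < d := hd
    have h2 : Tendsto (fun R => 1 - M * (1 - m R / c)) atTop (𝓝 1) := by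
      have := (hmc.const_sub 1).const_mul M |>.const_sub 1
      simpa using this
    obtain ⟨R, hR1, hR⟩ := ((h2.eventually_const_lt hd1).and (eventually_gt_atTop 0)).exists
    have hl : 0 < R / d := by positivity
    have h3 := (hS (R / d) hl).comp (tendsto_atTop_add_const_right atTop (-d) tendsto_id)
    have h4 := h3.eventually_const_lt (show a * Real.exp (2 * d) + M * (1 - m R / c) < 1 by linarith)
    filter_upwards [h4] with T hT
    have h5 := hlow d hd (R / d) hl T
    rw [div_mul_cancel₀ R hd.ne'] at h5
    simp only [Function.comp_apply, id, ← sub_eq_add_neg] at hT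
    have h6 := hT.trans_le h5
    have h7 : a * Real.exp (2 * d) < f T * Real.exp (2 * d) := by linarith
    exact lt_of_mul_lt_mul_right h7 (Real.exp_nonneg _)
  · intro a ha
    have h1 : Tendsto (fun d : ℝ => a * Real.exp (-(2 * d))) (𝓝[>] 0) (𝓝 a) := by
      have : Tendsto (fun d : ℝ => a * Real.exp (-(2 * d))) (𝓝 0) (𝓝 (a * Real.exp (-(2 * 0)))) :=
        Continuous.tendsto (by fun_prop) _
      simp only [mul_zero, neg_zero, Real.exp_zero, mul_one] at this
      exact this.mono_left nhdsWithin_le_nhds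
    obtain ⟨d, hd1, hd⟩ := ((h1.eventually_const_lt ha).and self_mem_nhdsWithin).exists
    have hd : 0 < d := hd
    have h2 : Tendsto (fun R => a * Real.exp (-(2 * d)) * (m R / c)) atTop
        (𝓝 (a * Real.exp (-(2 * d)))) := by
      have := hmc.const_mul (a * Real.exp (-(2 * d)))
      simpa using this
    obtain ⟨R, ⟨hR1, hR⟩, hR2⟩ := (((h2.eventually_const_lt hd1).and (eventually_gt_atTop 0)).and
      (hmc.eventually_const_lt zero_lt_one)).exists
    have hl : 0 < R / d := by positivity
    have h3 := (hS (R / d) hl).comp (tendsto_atTop_add_const_right atTop d tendsto_id)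
    have h4 := h3.eventually_lt_const hR1
    filter_upwards [h4] with T hT
    have h5 := hup d hd (R / d) hl T
    rw [div_mul_cancel₀ R hd.ne'] at h5
    simp only [Function.comp_apply, id] at hT
    have h6 := h5.trans_lt hT
    have h7 : 0 < Real.exp (-(2 * d)) * (m R / c) := mul_pos (Real.exp_pos _) hR2
    rw [mul_assoc, mul_assoc] at h6
    exact lt_of_mul_lt_mul_right h6 h7.le

end DLB
end

section
open MeasureTheory Filter Topology Set

namespace DLB

/-- Riemann sums of a Lipschitz compactly supported function over a lattice, with error term. -/
theorem lattice_sum {E : Type*} [NormedAddCommGroup E] [NormedSpace ℝ E] [FiniteDimensional ℝ E]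
    [MeasurableSpace E] [BorelSpace E] {ι : Type*} [Finite ι] (b : Module.Basis ι ℝ E)
    (F : E → ℝ) (K : NNReal) (hF : LipschitzWith K F) (R : ℝ)
    (hR : ∀ x, R < ‖x‖ → F x = 0) :
    ∃ c C : ℝ, ∀ e : ℝ, 0 < e → e ≤ 1 →
      |e ^ (Module.finrank ℝ E) * (∑' v : Submodule.span ℤ (Set.range b), F (e • (v : E))) - c|
        ≤ C * e := by
  classical
  let μ : Measure E := Measure.addHaar
  set D := ZSpan.fundamentalDomain b with hD
  set n := Module.finrank ℝ E with hn
  have hDm : MeasurableSet D := ZSpan.fundamentalDomain_measurableSet b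
  have hDfin : μ D ≠ ⊤ := (ZSpan.fundamentalDomain_isBounded b).measure_lt_top.ne
  have hDpos : μ D ≠ 0 := ZSpan.measure_fundamentalDomain_ne_zero b
  have hDr : 0 < μ.real D := ENNReal.toReal_pos hDpos hDfin
  obtain ⟨r, hr⟩ := (ZSpan.fundamentalDomain_isBounded b).exists_norm_le
  set r' := max r 0 with hr'
  have hr0 : 0 ≤ r' := le_max_right _ _
  have hrD : ∀ y ∈ D, ‖y‖ ≤ r' := fun y hy => (hr y hy).trans (le_max_left _ _)
  set R' := max R 0 + r' with hR'
  have hFc : Continuous F := hF.continuous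
  let χ : E → ℝ := (Metric.closedBall (0 : E) R').indicator (fun _ => K * r')
  have hχint : Integrable χ μ := by
    refine IntegrableOn.integrable_indicator ?_ Metric.isClosed_closedBall.measurableSet
    exact integrableOn_const (isCompact_closedBall _ _).measure_lt_top.ne
  have hFint : Integrable F μ := by
    refine hFc.integrable_of_hasCompactSupport ?_
    refine HasCompactSupport.of_support_subset_isCompact (isCompact_closedBall (0:E) R) ?_
    intro x hx
    rw [mem_closedBall_zero_iff]
    by_contra h
    exact hx (hR x (not_le.mp h))
  refine ⟨(∫ x, F x ∂μ) / μ.real D, (∫ x, χ x ∂μ) / μ.real D, ?_⟩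
  intro e he he1
  set L := Submodule.span ℤ (Set.range b)
  have hfd : IsAddFundamentalDomain L D μ := ZSpan.isAddFundamentalDomain b μ
  haveI : VAddInvariantMeasure L E μ := inferInstanceAs <| VAddInvariantMeasure L.toAddSubgroup E μ
  haveI : MeasurableConstVAdd L E := inferInstanceAs <| MeasurableConstVAdd L.toAddSubgroup E
  -- finite set of relevant lattice points
  have hfin : {v : L | ‖e • (v : E)‖ ≤ R' + r'}.Finite := by
    have := ZSpan.setFinite_inter b (Metric.isBounded_closedBall (x := (0:E)) (r := (R' + r') / e))
    refine Set.Finite.of_finite_image (f := fun v : L => (v : E)) (this.subset ?_)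
      Subtype.val_injective.injOn
    rintro _ ⟨v, hv, rfl⟩
    refine ⟨?_, v.2⟩
    rw [mem_closedBall_zero_iff, le_div_iff₀ he]
    have hv : ‖e • (v : E)‖ ≤ R' + r' := hv
    rw [norm_smul, Real.norm_of_nonneg he.le] at hv
    linarith
  set s := hfin.toFinset with hs
  have hout : ∀ v ∉ s, ∀ y, ‖y‖ ≤ r' → R' < ‖e • ((v : E) + y)‖ := by
    intro v hv y hy
    have hv : R' + r' < ‖e • (v : E)‖ := by simpa [s] using hv
    have h1 : ‖e • y‖ ≤ r' := by
      rw [norm_smul, Real.norm_of_nonneg he.le]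
      nlinarith [norm_nonneg y]
    have h2 : ‖e • (v : E)‖ ≤ ‖e • ((v : E) + y)‖ + ‖e • y‖ := by
      have : e • (v : E) = e • ((v : E) + y) - e • y := by rw [smul_add]; abel
      rw [this]; exact norm_sub_le _ _
    linarith
  have hRR : R ≤ R' := by rw [hR']; linarith [le_max_left R 0]
  -- general unfolding
  have hunf : ∀ G : E → ℝ, Integrable G μ → (∀ x, R' < ‖x‖ → G x = 0) →
      ∫ x, G x ∂μ = e ^ n * ∑ v ∈ s, ∫ y in D, G (e • ((v : E) + y)) ∂μ := by
    intro G hG hGR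
    have h1 : ∫ x, G x ∂μ = e ^ n * ∫ x, G (e • x) ∂μ := by
      rw [Measure.integral_comp_smul, smul_eq_mul, ← hn, abs_of_pos (by positivity),
        mul_inv_cancel_left₀ (by positivity)]
    rw [h1]
    congr 1
    rw [hfd.integral_eq_tsum'' (fun x => G (e • x)) (hG.comp_smul he.ne'), tsum_eq_sum (s := s)]
    · rfl
    · intro v hv
      refine setIntegral_eq_zero_of_forall_eq_zero ?_
      intro y hy
      exact hGR _ (hout v hv y (hrD y hy))
  have hsum : ∑' v : L, F (e • (v : E)) = ∑ v ∈ s, F (e • (v : E)) := by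
    refine tsum_eq_sum ?_
    intro v hv
    have := hout v hv 0 (by simpa using hr0)
    rw [add_zero] at this
    exact hR _ (hRR.trans_lt this)
  have hI := hunf F hFint (fun x hx => hR x (hRR.trans_lt hx))
  have hJ := hunf χ hχint (fun x hx => by
    refine indicator_of_notMem ?_ _
    rw [mem_closedBall_zero_iff]; exact not_le.mpr hx)
  have hkey : ∀ v : L, |μ.real D * F (e • (v : E)) - ∫ y in D, F (e • ((v : E) + y)) ∂μ| ≤
      e * ∫ y in D, χ (e • ((v : E) + y)) ∂μ := by
    intro v
    have hFi : IntegrableOn (fun y => F (e • ((v : E) + y))) D μ :=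
      ((hFint.comp_smul he.ne').comp_add_left (v : E)).integrableOn
    have hχi : IntegrableOn (fun y => χ (e • ((v : E) + y))) D μ :=
      ((hχint.comp_smul he.ne').comp_add_left (v : E)).integrableOn
    have h1 : μ.real D * F (e • (v : E)) = ∫ y in D, F (e • (v : E)) ∂μ := by
      rw [setIntegral_const, smul_eq_mul]
    have hci : IntegrableOn (fun _ : E => F (e • (v : E))) D μ := integrableOn_const hDfin
    rw [h1, ← integral_sub hci hFi, ← integral_const_mul, ← Real.norm_eq_abs]
    refine norm_integral_le_of_norm_le (hχi.const_mul e) ?_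
    filter_upwards [ae_restrict_mem hDm] with y hy
    have hy' := hrD y hy
    have hd : ‖e • (v : E) - e • ((v : E) + y)‖ ≤ e * r' := by
      have : e • (v : E) - e • ((v : E) + y) = -(e • y) := by rw [smul_add]; abel
      rw [this, norm_neg, norm_smul, Real.norm_of_nonneg he.le]
      gcongr
    have her : e * r' ≤ r' := by nlinarith
    by_cases hin : ‖e • ((v : E) + y)‖ ≤ R'
    · have : χ (e • ((v : E) + y)) = K * r' :=
        indicator_of_mem (by rw [mem_closedBall_zero_iff]; exact hin) _
      rw [this]
      refine (hF.norm_sub_le _ _).trans ?_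
      calc (K : ℝ) * ‖e • (v : E) - e • ((v : E) + y)‖ ≤ K * (e * r') := by gcongr
        _ = _ := by ring
    · have h0 : χ (e • ((v : E) + y)) = 0 :=
        indicator_of_notMem (by rw [mem_closedBall_zero_iff]; exact hin) _
      have h2 : F (e • ((v : E) + y)) = 0 := hR _ (hRR.trans_lt (not_le.mp hin))
      have h3 : F (e • (v : E)) = 0 := by
        refine hR _ ?_
        have h5 : ‖e • ((v : E) + y)‖ ≤ ‖e • (v : E)‖ + ‖e • (v : E) - e • ((v : E) + y)‖ := by
          have := norm_sub_norm_le (e • ((v : E) + y)) (e • (v : E))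
          rw [norm_sub_rev] at this
          linarith
        have : R' < ‖e • ((v : E) + y)‖ := not_le.mp hin
        rw [hR'] at this
        linarith [le_max_left R 0]
      rw [h0, h2, h3]; simp
  rw [hsum, hI]
  have e1 : e ^ n * ∑ v ∈ s, F (e • (v : E)) -
      e ^ n * (∑ v ∈ s, ∫ y in D, F (e • ((v : E) + y)) ∂μ) / μ.real D =
      e ^ n / μ.real D * ∑ v ∈ s, (μ.real D * F (e • (v : E)) -
        ∫ y in D, F (e • ((v : E) + y)) ∂μ) := by
    rw [Finset.sum_sub_distrib, ← Finset.mul_sum]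
    field_simp
  rw [e1, abs_mul, abs_of_pos (by positivity), hJ]
  calc _ ≤ e ^ n / μ.real D * ∑ v ∈ s, e * ∫ y in D, χ (e • ((v : E) + y)) ∂μ := by
        gcongr
        exact (Finset.abs_sum_le_sum_abs _ _).trans (Finset.sum_le_sum fun v _ => hkey v)
    _ = _ := by
        rw [← Finset.mul_sum]
        field_simp

end DLB
end

section
open MeasureTheory Filter Topology Set

namespace DLB

/-- A smooth bump with integer translates summing to one. -/
noncomputable def bmp (x : ℝ) : ℝ := Real.smoothTransition (x + 1) - Real.smoothTransition x

lemma bmp_contDiff : ContDiff ℝ 1 bmp := by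
  unfold bmp
  have h := Real.smoothTransition.contDiff (n := 1)
  exact (h.comp (contDiff_id.add contDiff_const)).sub h

lemma bmp_eq_zero {x : ℝ} (hx : 1 ≤ |x|) : bmp x = 0 := by
  unfold bmp
  rcases le_abs.mp hx with h | h
  · rw [Real.smoothTransition.one_of_one_le h, Real.smoothTransition.one_of_one_le (by linarith),
      sub_self]
  · rw [Real.smoothTransition.zero_of_nonpos (by linarith),
      Real.smoothTransition.zero_of_nonpos (by linarith), sub_self]

lemma bmp_sum (x : ℝ) : ∑ k ∈ ({-⌊x⌋ - 1, -⌊x⌋} : Finset ℤ), bmp (k + x) = 1 := by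
  rw [Finset.sum_pair (by omega)]
  have h1 := Int.floor_le x
  have h2 := Int.lt_floor_add_one x
  unfold bmp
  push_cast
  rw [Real.smoothTransition.zero_of_nonpos (x := (-(⌊x⌋:ℝ) - 1 + x)) (by linarith),
    Real.smoothTransition.one_of_one_le (x := -(⌊x⌋:ℝ) + x + 1) (by linarith)]
  ring_nf

lemma bmp_out (x : ℝ) (k : ℤ) (hk : k ∉ ({-⌊x⌋ - 1, -⌊x⌋} : Finset ℤ)) : bmp (k + x) = 0 := by
  apply bmp_eq_zero
  simp only [Finset.mem_insert, Finset.mem_singleton, not_or] at hk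
  have h1 := Int.floor_le x
  have h2 := Int.lt_floor_add_one x
  have : k ≤ -⌊x⌋ - 2 ∨ 1 - ⌊x⌋ ≤ k := by omega
  rcases this with h | h
  · have : (k : ℝ) ≤ -⌊x⌋ - 2 := by exact_mod_cast h
    rw [le_abs]; right; linarith
  · have : (1 : ℝ) - ⌊x⌋ ≤ k := by exact_mod_cast h
    rw [le_abs]; left; linarith

lemma bmp_hasSum {r : ℕ} (x : Fin r → ℝ) :
    HasSum (fun k : Fin r → ℤ => ∏ i, bmp (k i + x i)) 1 := by
  have h : HasSum (fun k : Fin r → ℤ => ∏ i, bmp (k i + x i)) _ := hasSum_sum_of_ne_finset_zero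
    (s := Fintype.piFinset fun i => ({-⌊x i⌋ - 1, -⌊x i⌋} : Finset ℤ)) (by
      intro k hk
      rw [Fintype.mem_piFinset, not_forall] at hk
      obtain ⟨i, hi⟩ := hk
      exact Finset.prod_eq_zero (Finset.mem_univ i) (bmp_out _ _ hi))
  rw [← Finset.prod_univ_sum (fun i => ({-⌊x i⌋ - 1, -⌊x i⌋} : Finset ℤ))
    (fun i k => bmp (k + x i))] at h
  simpa only [bmp_sum, Finset.prod_const_one] using h

open NumberField NumberField.mixedEmbedding NumberField.mixedEmbedding.fundamentalCone
  NumberField.Units NumberField.InfinitePlace NumberField.Units.dirichletUnitTheorem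

variable (K : Type*) [Field K] [NumberField K]

open scoped Classical in
/-- the real basis of log space -/
noncomputable def ulb : Module.Basis (Fin (rank K)) ℝ (logSpace K) :=
  (basisUnitLattice K).ofZLatticeBasis ℝ (unitLattice K)

/-- smooth weight, a partition of unity for the action of the units. -/
noncomputable def wt (x : mixedSpace K) : ℝ := ∏ i, bmp ((ulb K).repr (logMap x) i)

/-- the weight cut off in norm -/
noncomputable def cut (h : ℝ → ℝ) (x : mixedSpace K) : ℝ := h (mixedEmbedding.norm x) * wt K x

/-- units as pairs -/
noncomputable def unitsEquiv : torsion K × (Fin (rank K) → ℤ) ≃ (𝓞 K)ˣ :=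
  Equiv.ofBijective (fun z => z.1 * ∏ i, (fundSystem K i) ^ (z.2 i)) (by
    rw [Function.bijective_iff_existsUnique]
    intro u
    obtain ⟨z, hz, hz'⟩ := exist_unique_eq_mul_prod K u
    exact ⟨z, hz.symm, fun y hy => hz' y hy.symm⟩)

lemma repr_logMap_smul (z : torsion K × (Fin (rank K) → ℤ)) (x : mixedSpace K)
    (hx : mixedEmbedding.norm x ≠ 0) (i : Fin (rank K)) :
    (ulb K).repr (logMap (unitsEquiv K z • x)) i = z.2 i + (ulb K).repr (logMap x) i := by
  rw [logMap_unit_smul _ hx, map_add, Finsupp.add_apply]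
  congr 1
  have h1 : logEmbedding K (Additive.ofMul (unitsEquiv K z)) = ∑ i, (z.2 i : ℝ) • ulb K i := by
    have : unitsEquiv K z = z.1 * ∏ i, (fundSystem K i) ^ (z.2 i) := rfl
    rw [this, ofMul_mul, map_add]
    have h0 : logEmbedding K (Additive.ofMul (z.1 : (𝓞 K)ˣ)) = 0 :=
      logEmbedding_eq_zero_iff.mpr z.1.2
    rw [h0, zero_add, ofMul_prod, map_sum]
    refine Finset.sum_congr rfl fun i _ => ?_
    rw [ofMul_zpow, map_zsmul, logEmbedding_fundSystem, ulb, Module.Basis.ofZLatticeBasis_apply]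
    ext w
    simp
  rw [h1]
  simp [Finsupp.single_apply]

lemma cut_hasSum (h : ℝ → ℝ) (x : mixedSpace K) (hx : mixedEmbedding.norm x ≠ 0) :
    HasSum (fun u : (𝓞 K)ˣ => cut K h (u • x)) (torsionOrder K * h (mixedEmbedding.norm x)) := by
  rw [← (unitsEquiv K).hasSum_iff]
  have h1 : ((fun u : (𝓞 K)ˣ => cut K h (u • x)) ∘ (unitsEquiv K)) = fun z =>
      (h (mixedEmbedding.norm x)) * ∏ i, bmp (z.2 i + (ulb K).repr (logMap x) i) := by
    ext z
    simp only [Function.comp_apply, cut, wt, norm_unit_smul, repr_logMap_smul K z x hx]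
  rw [h1, mul_comm (torsionOrder K : ℝ)]
  refine HasSum.mul_left _ ?_
  have h2 := bmp_hasSum fun i => (ulb K).repr (logMap x) i
  have : Fintype (torsion K) := Fintype.ofFinite _
  have h3 : HasSum (fun z : torsion K × (Fin (rank K) → ℤ) =>
      ∏ i, bmp (z.2 i + (ulb K).repr (logMap x) i)) _ := hasSum_sum_of_ne_finset_zero
    (s := Finset.univ ×ˢ Fintype.piFinset fun i =>
      ({-⌊(ulb K).repr (logMap x) i⌋ - 1, -⌊(ulb K).repr (logMap x) i⌋} : Finset ℤ)) (by
      intro k hk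
      rw [Finset.mem_product, Fintype.mem_piFinset] at hk
      simp only [Finset.mem_univ, true_and, not_forall] at hk
      obtain ⟨i, hi⟩ := hk
      exact Finset.prod_eq_zero (Finset.mem_univ i) (bmp_out _ _ hi))
  rw [Finset.sum_product] at h3
  simp only [← Finset.prod_univ_sum (fun i => ({-⌊(ulb K).repr (logMap x) i⌋ - 1,
    -⌊(ulb K).repr (logMap x) i⌋} : Finset ℤ))
    (fun i k => bmp (k + (ulb K).repr (logMap x) i)), bmp_sum] at h3
  simpa [torsionOrder, Nat.card_eq_fintype_card] using h3

end DLB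
end

section
open MeasureTheory Filter Topology Set

namespace DLB

open NumberField NumberField.mixedEmbedding NumberField.mixedEmbedding.fundamentalCone
  NumberField.Units NumberField.InfinitePlace NumberField.Units.dirichletUnitTheorem

open scoped Classical

variable (K : Type*) [Field K] [NumberField K]

lemma nap_contDiffAt (w : InfinitePlace K) (x : mixedSpace K) (hx : normAtPlace w x ≠ 0) :
    ContDiffAt ℝ 1 (fun y : mixedSpace K => normAtPlace w y) x := by
  rcases w.isReal_or_isComplex with hw | hw
  · simp only [normAtPlace_apply_of_isReal hw] at hx ⊢
    have h0 : x.1 ⟨w, hw⟩ ≠ 0 := fun h => hx (by rw [h, _root_.norm_zero])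
    have h1 : ContDiffAt ℝ 1 (fun y : mixedSpace K => y.1 ⟨w, hw⟩) x := by fun_prop
    exact h1.norm ℝ h0
  · simp only [normAtPlace_apply_of_isComplex hw] at hx ⊢
    have h0 : x.2 ⟨w, hw⟩ ≠ 0 := fun h => hx (by rw [h, _root_.norm_zero])
    have h1 : ContDiffAt ℝ 1 (fun y : mixedSpace K => y.2 ⟨w, hw⟩) x := by fun_prop
    exact h1.norm ℝ h0

lemma norm_contDiffAt (x : mixedSpace K) (hx : mixedEmbedding.norm x ≠ 0) :
    ContDiffAt ℝ 1 (fun y : mixedSpace K => mixedEmbedding.norm y) x := by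
  simp only [mixedEmbedding.norm_apply]
  refine contDiffAt_prod fun w _ => ContDiffAt.pow ?_ _
  exact nap_contDiffAt K w x (mixedEmbedding.norm_ne_zero_iff.mp hx w)

lemma logMap_contDiffAt (x : mixedSpace K) (hx : mixedEmbedding.norm x ≠ 0) :
    ContDiffAt ℝ 1 (fun y : mixedSpace K => logMap y) x := by
  rw [contDiffAt_pi]
  intro w
  simp only [logMap_apply]
  refine contDiffAt_const.mul (ContDiffAt.sub ?_ (ContDiffAt.mul ?_ contDiffAt_const))
  · exact (nap_contDiffAt K w x (mixedEmbedding.norm_ne_zero_iff.mp hx w)).log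
      (mixedEmbedding.norm_ne_zero_iff.mp hx w)
  · exact (norm_contDiffAt K x hx).log hx

lemma wt_contDiffAt (x : mixedSpace K) (hx : mixedEmbedding.norm x ≠ 0) :
    ContDiffAt ℝ 1 (wt K) x := by
  unfold wt
  refine contDiffAt_prod fun i _ => ?_
  refine bmp_contDiff.contDiffAt.comp x ?_
  have h1 : ContDiff ℝ 1 ((ulb K).coord i) := by
    exact (LinearMap.toContinuousLinearMap ((ulb K).coord i)).contDiff
  exact h1.contDiffAt.comp x (logMap_contDiffAt K x hx)

lemma cut_contDiff (h : ℝ → ℝ) (hh : ContDiff ℝ 1 h) (a : ℝ) (ha : 0 < a)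
    (hs : ∀ y, h y ≠ 0 → a ≤ y) : ContDiff ℝ 1 (cut K h) := by
  rw [contDiff_iff_contDiffAt]
  intro x
  by_cases hx : mixedEmbedding.norm x = 0
  · have h1 : ∀ᶠ y in 𝓝 x, mixedEmbedding.norm y < a :=
      (mixedEmbedding.continuous_norm K).continuousAt.eventually_lt_const (by rw [hx]; exact ha)
    have h2 : cut K h =ᶠ[𝓝 x] fun _ => 0 := by
      filter_upwards [h1] with y hy
      have : h (mixedEmbedding.norm y) = 0 := by
        by_contra h3
        exact absurd (hs _ h3) (not_le.mpr hy)
      simp [cut, this]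
    exact contDiffAt_const.congr_of_eventuallyEq h2
  · unfold cut
    exact (hh.contDiffAt.comp x (norm_contDiffAt K x hx)).mul (wt_contDiffAt K x hx)

lemma fin_aux {ι : Type*} [Fintype ι] (m l : ι → ℝ) (M : ℝ) (hM : 0 ≤ M) (hm : ∀ w, 1 ≤ m w)
    (w₁ : ι) (hw : ∀ w, w ≠ w₁ → |l w| ≤ M) (hs : ∑ w, m w * l w ≤ M) :
    l w₁ ≤ M + (∑ w, m w) * M := by
  have hm0 : ∀ w, 0 ≤ m w := fun w => zero_le_one.trans (hm w)
  rw [← Finset.add_sum_erase _ _ (Finset.mem_univ w₁)] at hs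
  have h6 : |∑ w ∈ Finset.univ.erase w₁, m w * l w| ≤ (∑ w, m w) * M := by
    refine (Finset.abs_sum_le_sum_abs _ _).trans ?_
    rw [Finset.sum_mul]
    refine (Finset.sum_le_sum (g := fun w => m w * M) fun w hw' => ?_).trans
      (Finset.sum_le_sum_of_subset_of_nonneg (Finset.subset_univ _) fun w _ _ =>
        mul_nonneg (hm0 w) hM)
    rw [abs_mul, abs_of_nonneg (hm0 w)]
    exact mul_le_mul_of_nonneg_left (hw w (Finset.ne_of_mem_erase hw')) (hm0 w)
  have h7 : m w₁ * l w₁ ≤ M + (∑ w, m w) * M := by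
    have := (abs_le.mp h6).1
    linarith
  by_cases h8 : 0 ≤ l w₁
  · exact (le_mul_of_one_le_left h8 (hm _)).trans h7
  · push Not at h8
    have : 0 ≤ (∑ w, m w) * M := mul_nonneg (Finset.sum_nonneg fun w _ => hm0 w) hM
    linarith

lemma cut_support (h : ℝ → ℝ) (a b : ℝ) (ha : 0 < a)
    (hs : ∀ y, h y ≠ 0 → a ≤ y ∧ y ≤ b) :
    ∃ R : ℝ, 0 < R ∧ ∀ x, R < ‖x‖ → cut K h x = 0 := by
  set C0 : ℝ := ∑ i, ‖ulb K i‖ with hC0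
  set M : ℝ := C0 + |Real.log a| + |Real.log b| with hM
  have hC0p : 0 ≤ C0 := Finset.sum_nonneg fun i _ => norm_nonneg _
  have hMp : 0 ≤ M := by positivity
  set D : ℝ := ∑ w : InfinitePlace K, (mult w : ℝ) with hD
  have hDp : 0 ≤ D := Finset.sum_nonneg fun i _ => by positivity
  refine ⟨Real.exp (M + D * M), Real.exp_pos _, fun x hx => ?_⟩
  by_contra hne
  have hne1 : h (mixedEmbedding.norm x) ≠ 0 := fun h0 => hne (by simp [cut, h0])
  have hne2 : wt K x ≠ 0 := fun h0 => hne (by simp [cut, h0])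
  obtain ⟨h1, h2⟩ := hs _ hne1
  have hpos : 0 < mixedEmbedding.norm x := ha.trans_le h1
  have hlog : |Real.log (mixedEmbedding.norm x)| ≤ |Real.log a| + |Real.log b| := by
    have l1 := Real.log_le_log ha h1
    have l2 := Real.log_le_log hpos h2
    rw [abs_le]
    constructor <;>
    linarith [neg_abs_le (Real.log a), le_abs_self (Real.log b), abs_nonneg (Real.log a),
      abs_nonneg (Real.log b)]
  have hc : ∀ i, |(ulb K).repr (logMap x) i| ≤ 1 := by
    intro i
    by_contra hi
    push Not at hi
    exact (Finset.prod_ne_zero_iff.mp hne2 i (Finset.mem_univ i)) (bmp_eq_zero hi.le)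
  have hl : ‖logMap x‖ ≤ C0 := by
    rw [← (ulb K).sum_repr (logMap x)]
    refine (norm_sum_le _ _).trans (Finset.sum_le_sum fun i _ => ?_)
    rw [_root_.norm_smul]
    exact mul_le_of_le_one_left (norm_nonneg _) (by simpa using hc i)
  have hn0 : ∀ w, normAtPlace w x ≠ 0 := mixedEmbedding.norm_ne_zero_iff.mp hpos.ne'
  have hm1 : ∀ w : InfinitePlace K, (1 : ℝ) ≤ mult w := fun w => by
    exact_mod_cast Nat.one_le_iff_ne_zero.mpr mult_pos.ne'
  have hd1 : (1 : ℝ) ≤ Module.finrank ℚ K := by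
    exact_mod_cast Nat.one_le_iff_ne_zero.mpr Module.finrank_pos.ne'
  have hw : ∀ w : InfinitePlace K, w ≠ w₀ → |Real.log (normAtPlace w x)| ≤ M := by
    intro w hw
    have h3 := (norm_le_pi_norm (logMap x) ⟨w, hw⟩).trans hl
    rw [logMap_apply, norm_mul, Real.norm_eq_abs, Real.norm_eq_abs, abs_of_nonneg (by positivity)]
      at h3
    have h4 : |Real.log (normAtPlace w x) -
        Real.log (mixedEmbedding.norm x) * (Module.finrank ℚ K : ℝ)⁻¹| ≤ C0 :=
      (le_mul_of_one_le_left (abs_nonneg _) (hm1 w)).trans h3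
    have h5 : |Real.log (mixedEmbedding.norm x) * (Module.finrank ℚ K : ℝ)⁻¹| ≤
        |Real.log a| + |Real.log b| := by
      rw [abs_mul, abs_of_nonneg (a := (Module.finrank ℚ K : ℝ)⁻¹) (by positivity)]
      exact (mul_le_of_le_one_right (abs_nonneg _) (inv_le_one_of_one_le₀ hd1)).trans hlog
    calc _ = |(Real.log (normAtPlace w x) - Real.log (mixedEmbedding.norm x) *
          (Module.finrank ℚ K : ℝ)⁻¹) + Real.log (mixedEmbedding.norm x) *
          (Module.finrank ℚ K : ℝ)⁻¹| := by ring_nf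
      _ ≤ _ := abs_add_le _ _
      _ ≤ M := by rw [hM]; linarith
  have hsum : Real.log (mixedEmbedding.norm x) = ∑ w, mult w * Real.log (normAtPlace w x) := by
    rw [mixedEmbedding.norm_apply, Real.log_prod (fun w _ => pow_ne_zero _ (hn0 w))]
    simp
  have hw0 : Real.log (normAtPlace (w₀ : InfinitePlace K) x) ≤ M + D * M := by
    refine fin_aux (fun w : InfinitePlace K => (mult w : ℝ))
      (fun w => Real.log (normAtPlace w x)) M hMp hm1 _ hw ?_
    rw [← hsum]
    exact (le_abs_self _).trans (hlog.trans (by rw [hM]; linarith))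
  refine absurd hx (not_lt.mpr ?_)
  rw [norm_eq_sup'_normAtPlace]
  refine Finset.sup'_le _ _ fun w _ => ?_
  rw [← Real.log_le_iff_le_exp ((normAtPlace_nonneg w x).lt_of_ne' (hn0 w))]
  by_cases hww : w = w₀
  · rw [hww]; exact hw0
  · have := (abs_le.mp (hw w hww)).2
    nlinarith [mul_nonneg hDp hMp]

lemma cut_lipschitz (h : ℝ → ℝ) (hh : ContDiff ℝ 1 h) (a b : ℝ) (ha : 0 < a)
    (hs : ∀ y, h y ≠ 0 → a ≤ y ∧ y ≤ b) :
    ∃ C, LipschitzWith C (cut K h) := by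
  obtain ⟨R, hR, h1⟩ := cut_support K h a b ha hs
  refine (cut_contDiff K h hh a ha fun y hy => (hs y hy).1).lipschitzWith_of_hasCompactSupport ?_ one_ne_zero
  refine HasCompactSupport.intro (isCompact_closedBall (0 : mixedSpace K) R) fun x hx => h1 x ?_
  simpa using hx

end DLB
end

section
open MeasureTheory Filter Topology Set

namespace DLB

open NumberField NumberField.mixedEmbedding NumberField.mixedEmbedding.fundamentalCone
  NumberField.Units NumberField.InfinitePlace NumberField.Units.dirichletUnitTheorem
open scoped nonZeroDivisors

open scoped Classical

variable (K : Type*) [Field K] [NumberField K]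


lemma gen_exists (C : ClassGroup (𝓞 K)) (J : (Ideal (𝓞 K))⁰)
    (hJ : ClassGroup.mk0 J = C⁻¹) (I : {I : (Ideal (𝓞 K))⁰ // ClassGroup.mk0 I = C}) :
      ∃ g : 𝓞 K, g ≠ 0 ∧ Ideal.span {g} = (J : Ideal (𝓞 K)) * (I.1 : Ideal (𝓞 K)) := by
  have h1 : ClassGroup.mk0 (J * I.1) = 1 := by rw [map_mul, hJ, I.2, inv_mul_cancel]
  have h2 := (ClassGroup.mk0_eq_one_iff (J * I.1).2).mp h1
  obtain ⟨g, hg⟩ := (Submodule.isPrincipal_iff _).mp h2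
  refine ⟨g, ?_, hg.symm⟩
  rintro rfl
  have := nonZeroDivisors.coe_ne_zero (J * I.1)
  exact this (by rw [hg]; simp)

lemma param_ideal (C : ClassGroup (𝓞 K)) (J : (Ideal (𝓞 K))⁰)
    (hJ : ClassGroup.mk0 J = C⁻¹) :
    ∃ g : {I : (Ideal (𝓞 K))⁰ // ClassGroup.mk0 I = C} → 𝓞 K,
      (∀ I, g I ≠ 0 ∧ Ideal.span {g I} = (J : Ideal (𝓞 K)) * (I.1 : Ideal (𝓞 K))) ∧
      Function.Injective (fun z : {I : (Ideal (𝓞 K))⁰ // ClassGroup.mk0 I = C} × (𝓞 K)ˣ =>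
        (z.2 * g z.1 : 𝓞 K)) ∧
      ∀ y ∈ (J : Ideal (𝓞 K)), y ≠ 0 → ∃ z : {I : (Ideal (𝓞 K))⁰ // ClassGroup.mk0 I = C} ×
        (𝓞 K)ˣ, (z.2 * g z.1 : 𝓞 K) = y := by
  choose g hg0 hg using gen_exists K C J hJ
  refine ⟨g, fun I => ⟨hg0 I, hg I⟩, ?_, ?_⟩
  · rintro ⟨I, u⟩ ⟨I', u'⟩ hz
    have h1 : u * g I = u' * g I' := hz
    have h2 : I = I' := by
      have h3 : Ideal.span {g I} = Ideal.span {g I'} := by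
        rw [← Ideal.span_singleton_mul_left_unit u.isUnit, h1,
          Ideal.span_singleton_mul_left_unit u'.isUnit]
      rw [hg, hg] at h3
      have := mul_left_cancel₀ (nonZeroDivisors.coe_ne_zero J) h3
      exact Subtype.ext (Subtype.ext this)
    subst h2
    have h4 : u = u' := Units.ext (mul_right_cancel₀ (hg0 I) h1)
    rw [h4]
  · intro y hy hy0
    have hd : (J : Ideal (𝓞 K)) ∣ Ideal.span {y} := by
      rw [Ideal.dvd_span_singleton]; exact hy
    obtain ⟨I, hI⟩ := hd
    have hIn : I ≠ 0 := by
      rintro rfl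
      rw [mul_zero] at hI
      exact hy0 (Ideal.span_singleton_eq_bot.mp hI)
    let I0 : (Ideal (𝓞 K))⁰ := ⟨I, mem_nonZeroDivisors_of_ne_zero hIn⟩
    have hIC : ClassGroup.mk0 I0 = C := by
      have h1 : ClassGroup.mk0 (J * I0) = 1 := by
        refine (ClassGroup.mk0_eq_one_iff (J * I0).2).mpr ?_
        refine (Submodule.isPrincipal_iff _).mpr ⟨y, ?_⟩
        exact hI.symm
      rw [map_mul, hJ, inv_mul_eq_one] at h1
      exact h1.symm
    have has : Associated (g ⟨I0, hIC⟩) y := by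
      rw [← Ideal.span_singleton_eq_span_singleton, hg, hI]
    obtain ⟨u, hu⟩ := has
    refine ⟨(⟨I0, hIC⟩, u), ?_⟩
    rw [← hu, mul_comm]

lemma norm_emb (z : 𝓞 K) : mixedEmbedding.norm (mixedEmbedding K (z : K)) =
    (Ideal.absNorm (Ideal.span {z}) : ℝ) := by
  rw [norm_eq_norm, Ideal.absNorm_span_singleton, ← Algebra.coe_norm_int, Nat.cast_natAbs]
  simp

lemma lat_hasSum {ι : Type*} [Finite ι] (B : Module.Basis ι ℝ (mixedSpace K))
    {X Y : Type*} (φ : X × Y → mixedSpace K) (hφ : Function.Injective φ)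
    (hφB : ∀ z, φ z ∈ Submodule.span ℤ (Set.range B)) (F : mixedSpace K → ℝ) (R : ℝ)
    (hR : ∀ x, R < ‖x‖ → F x = 0) (e : ℝ) (he : 0 < e)
    (hF0 : ∀ v ∈ Submodule.span ℤ (Set.range B), v ∉ Set.range φ → F (e • v) = 0)
    (G : X → ℝ) (hG : ∀ x, HasSum (fun y => F (e • φ (x, y))) (G x)) :
    HasSum G (∑' v : Submodule.span ℤ (Set.range B), F (e • (v : mixedSpace K))) := by
  have hsumm : Summable (fun v : Submodule.span ℤ (Set.range B) => F (e • (v : mixedSpace K))) := by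
    have hfin := ZSpan.setFinite_inter B (Metric.isBounded_closedBall (x := 0) (r := R / e))
    refine summable_of_hasFiniteSupport ?_
    refine (hfin.preimage (Subtype.val_injective.injOn)).subset fun v hv => ?_
    refine ⟨?_, v.2⟩
    by_contra hvR
    refine hv (hR _ ?_)
    simp only [Metric.mem_closedBall, dist_zero_right, not_le] at hvR
    rw [_root_.norm_smul, Real.norm_of_nonneg he.le, mul_comm]
    rwa [div_lt_iff₀ he] at hvR
  let ψ : X × Y → Submodule.span ℤ (Set.range B) := fun z => ⟨φ z, hφB z⟩
  have hψ : Function.Injective ψ := fun z z' h => hφ (congrArg Subtype.val h)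
  have hS := (hψ.hasSum_iff (f := fun v : Submodule.span ℤ (Set.range B) =>
      F (e • (v : mixedSpace K))) (fun v hv => hF0 v v.2 (by
    rintro ⟨z, hz⟩
    exact hv ⟨z, Subtype.ext hz⟩))).mpr hsumm.hasSum
  exact hS.prod_fiberwise hG

lemma mem_lat (J : (Ideal (𝓞 K))⁰) (x : mixedSpace K) :
    x ∈ Submodule.span ℤ (Set.range (fractionalIdealLatticeBasis K (FractionalIdeal.mk0 K J))) ↔
      ∃ y ∈ (J : Ideal (𝓞 K)), mixedEmbedding K (y : K) = x := by
  rw [mem_span_fractionalIdealLatticeBasis, FractionalIdeal.coe_mk0]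
  constructor
  · rintro ⟨_, hx, rfl⟩
    obtain ⟨y, hy, rfl⟩ := (FractionalIdeal.mem_coeIdeal _).mp (SetLike.mem_coe.mp hx)
    exact ⟨y, hy, rfl⟩
  · rintro ⟨y, hy, rfl⟩
    exact ⟨_, SetLike.mem_coe.mpr ((FractionalIdeal.mem_coeIdeal _).mpr ⟨y, hy, rfl⟩), rfl⟩

lemma class_sum_eq (h : ℝ → ℝ) (a b : ℝ) (ha : 0 < a)
    (hs : ∀ y, h y ≠ 0 → a ≤ y ∧ y ≤ b) (C : ClassGroup (𝓞 K)) (J : (Ideal (𝓞 K))⁰)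
    (hJ : ClassGroup.mk0 J = C⁻¹) (e : ℝ) (he : 0 < e) :
    HasSum (fun I : {I : (Ideal (𝓞 K))⁰ // ClassGroup.mk0 I = C} =>
      torsionOrder K * h (e ^ Module.finrank ℚ K * (Ideal.absNorm (J : Ideal (𝓞 K)) *
        Ideal.absNorm (I.1 : Ideal (𝓞 K)))))
      (∑' v : Submodule.span ℤ (Set.range (fractionalIdealLatticeBasis K
        (FractionalIdeal.mk0 K J))), cut K h (e • (v : mixedSpace K))) := by
  obtain ⟨g, hg, hginj, hgsurj⟩ := param_ideal K C J hJ
  obtain ⟨R, hR, hR1⟩ := cut_support K h a b ha hs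
  have hh0 : h 0 = 0 := by
    by_contra h0
    exact absurd (hs 0 h0).1 (not_le.mpr ha)
  refine lat_hasSum K _ (fun z : {I : (Ideal (𝓞 K))⁰ // ClassGroup.mk0 I = C} × (𝓞 K)ˣ =>
    mixedEmbedding K ((z.2 * g z.1 : 𝓞 K) : K)) ?_ ?_ _ R hR1 e he ?_ _ ?_
  · exact (mixedEmbedding_injective K).comp (RingOfIntegers.coe_injective.comp hginj)
  · intro z
    rw [mem_lat]
    refine ⟨_, ?_, rfl⟩
    refine Ideal.mul_mem_left _ _ ?_
    have h1 : g z.1 ∈ Ideal.span {g z.1} := Ideal.mem_span_singleton_self _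
    rw [(hg z.1).2] at h1
    have h2 : (J : Ideal (𝓞 K)) * (z.1.1 : Ideal (𝓞 K)) ≤ J := Ideal.mul_le_left
    exact h2 h1
  · intro v hv hv'
    obtain ⟨y, hy, hxv⟩ := (mem_lat K J v).mp hv
    by_cases hy0 : y = 0
    · rw [← hxv, hy0]
      simp only [map_zero, smul_zero, cut, hh0, zero_mul]
    · obtain ⟨z, hz⟩ := hgsurj y hy hy0
      refine absurd ⟨z, ?_⟩ hv'
      rw [← hxv, ← hz]
  · intro I
    have hx : mixedEmbedding.norm (e • mixedEmbedding K (g I : K)) =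
        e ^ Module.finrank ℚ K * (Ideal.absNorm (J : Ideal (𝓞 K)) *
          Ideal.absNorm (I.1 : Ideal (𝓞 K))) := by
      rw [mixedEmbedding.norm_smul, norm_emb, (hg I).2, map_mul, abs_of_pos he]
      push_cast
      rfl
    have := cut_hasSum K h (e • mixedEmbedding K (g I : K)) (by
      rw [mixedEmbedding.norm_smul, norm_emb]
      refine mul_ne_zero (by positivity) ?_
      rw [Nat.cast_ne_zero, Ideal.absNorm_ne_zero_iff_mem_nonZeroDivisors]
      exact mem_nonZeroDivisors_of_ne_zero (by simpa using (hg I).1))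
    rw [hx] at this
    convert this using 3 with u
    rw [unitSMul_smul, mul_smul_comm, ← map_mul]
    simp

lemma class_sum (h : ℝ → ℝ) (hh : ContDiff ℝ 1 h) (a b : ℝ) (ha : 0 < a)
    (hs : ∀ y, h y ≠ 0 → a ≤ y ∧ y ≤ b) (C : ClassGroup (𝓞 K)) :
    ∃ c B : ℝ, ∀ t : ℝ, 0 < t → t ≤ 1 → ∃ S : ℝ,
      HasSum (fun I : {I : (Ideal (𝓞 K))⁰ // ClassGroup.mk0 I = C} =>
        h (Ideal.absNorm (I.1 : Ideal (𝓞 K)) * t)) S ∧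
      |S - c / t| ≤ B * t ^ (-1 + (1 : ℝ) / Module.finrank ℚ K) := by
  obtain ⟨J, hJ⟩ := ClassGroup.mk0_surjective (C⁻¹)
  obtain ⟨L, hL⟩ := cut_lipschitz K h hh a b ha hs
  obtain ⟨R, hR, hR1⟩ := cut_support K h a b ha hs
  obtain ⟨c, B, hcB⟩ := lattice_sum (fractionalIdealLatticeBasis K (FractionalIdeal.mk0 K J))
    (cut K h) L hL R hR1
  rw [mixedEmbedding.finrank] at hcB
  have hNJ : 0 < Ideal.absNorm (J : Ideal (𝓞 K)) :=
    Nat.pos_of_ne_zero (Ideal.absNorm_ne_zero_of_nonZeroDivisors J)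
  have hNJ' : (1 : ℝ) ≤ Ideal.absNorm (J : Ideal (𝓞 K)) := by exact_mod_cast hNJ
  set N : ℝ := ((Ideal.absNorm (J : Ideal (𝓞 K)) : ℕ) : ℝ) with hN
  have hd : 0 < Module.finrank ℚ K := Module.finrank_pos
  set d := Module.finrank ℚ K with hdd
  have hd' : (0 : ℝ) < d := by exact_mod_cast hd
  have hw : (0 : ℝ) < torsionOrder K := by exact_mod_cast torsionOrder_pos K
  set w : ℝ := ((torsionOrder K : ℕ) : ℝ) with hw'
  refine ⟨c * N / w, |B| * N / w, fun t ht ht1 => ?_⟩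
  set e : ℝ := (t / N) ^ ((1 : ℝ) / d) with he
  have htN : 0 < t / N := by positivity
  have hepos : 0 < e := Real.rpow_pos_of_pos htN _
  have hed : e ^ d = t / N := by
    rw [he, ← Real.rpow_natCast, ← Real.rpow_mul htN.le, one_div, inv_mul_cancel₀ hd'.ne',
      Real.rpow_one]
  have he1 : e ≤ 1 := Real.rpow_le_one htN.le (by
    rw [div_le_one (by positivity)]; linarith) (by positivity)
  have het : e ≤ t ^ ((1 : ℝ) / d) := Real.rpow_le_rpow htN.le
    (div_le_self ht.le hNJ') (by positivity)
  have h1 := class_sum_eq K h a b ha hs C J hJ e hepos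
  have h2 := hcB e hepos he1
  set S0 := ∑' v : Submodule.span ℤ (Set.range (fractionalIdealLatticeBasis K
        (FractionalIdeal.mk0 K J))), cut K h (e • (v : mixedSpace K)) with hS0
  rw [← hdd, hed, ← hN] at h1
  rw [hed] at h2
  refine ⟨S0 / w, ?_, ?_⟩
  · have h3 := h1.div_const w
    have h5 : (fun I : {I : (Ideal (𝓞 K))⁰ // ClassGroup.mk0 I = C} =>
        h (Ideal.absNorm (I.1 : Ideal (𝓞 K)) * t)) = fun I => (torsionOrder K : ℝ) *
        h (t / N * (N * (Ideal.absNorm (I.1 : Ideal (𝓞 K))))) / w := by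
      ext I
      rw [mul_div_cancel_left₀ _ hw.ne']
      congr 1
      field_simp
    rw [h5]
    exact h3
  · have h4 : S0 / w - c * N / w / t = (N / (w * t)) * (t / N * S0 - c) := by
      have : N ≠ 0 := by positivity
      field_simp
    rw [h4, abs_mul, abs_of_nonneg (by positivity)]
    calc _ ≤ N / (w * t) * (|B| * t ^ ((1 : ℝ) / d)) := by
          refine mul_le_mul_of_nonneg_left (h2.trans ?_) (by positivity)
          exact mul_le_mul (le_abs_self B) het hepos.le (abs_nonneg _)
      _ = _ := by
          rw [Real.rpow_add ht, Real.rpow_neg_one]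
          field_simp

/-- number of ideals of given norm -/
noncomputable def rK (n : ℕ) : ℕ := Nat.card {I : Ideal (𝓞 K) // Ideal.absNorm I = n}

theorem smooth_count (h : ℝ → ℝ) (hh : ContDiff ℝ 1 h) (a b : ℝ) (ha : 0 < a)
    (hs : ∀ y, h y ≠ 0 → a ≤ y ∧ y ≤ b) :
    ∃ c B : ℝ, ∀ t : ℝ, 0 < t → t ≤ 1 →
      |(∑' n : ℕ, (rK K n : ℝ) * h (n * t)) - c / t| ≤
        B * t ^ (-1 + (1 : ℝ) / Module.finrank ℚ K) := by
  choose c B hcB using class_sum K h hh a b ha hs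
  have hh0 : h 0 = 0 := by
    by_contra h0
    exact absurd (hs 0 h0).1 (not_le.mpr ha)
  refine ⟨∑ C, c C, ∑ C, B C, fun t ht ht1 => ?_⟩
  choose S hS hS2 using fun C => hcB C t ht ht1
  have h1 : HasSum (fun I : (Ideal (𝓞 K))⁰ => h (Ideal.absNorm (I : Ideal (𝓞 K)) * t))
      (∑ C, S C) := by
    rw [← (Equiv.sigmaFiberEquiv (fun I : (Ideal (𝓞 K))⁰ => ClassGroup.mk0 I)).hasSum_iff]
    refine HasSum.sigma_of_hasSum (hasSum_fintype _) hS ?_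
    refine summable_of_hasFiniteSupport ?_
    have hfin : {I : Ideal (𝓞 K) | Ideal.absNorm I ≤ b / t}.Finite := by
      refine (Ideal.finite_setOfPred_absNorm_le (S := 𝓞 K) (⌊b / t⌋₊)).subset fun I hI => ?_
      exact Nat.le_floor hI
    refine (hfin.preimage (f := fun x => ((Equiv.sigmaFiberEquiv
      (fun I : (Ideal (𝓞 K))⁰ => ClassGroup.mk0 I)) x : Ideal (𝓞 K))) ?_).subset ?_
    · exact ((Subtype.val_injective).comp (Equiv.injective _)).injOn
    · intro x hx
      have := (hs _ hx).2
      simp only [mem_preimage, mem_ofPred_eq]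
      rwa [le_div_iff₀ ht]
  have h2 : HasSum (fun I : Ideal (𝓞 K) => h (Ideal.absNorm I * t)) (∑ C, S C) := by
    refine (Function.Injective.hasSum_iff (g := fun I : (Ideal (𝓞 K))⁰ => (I : Ideal (𝓞 K)))
      Subtype.val_injective ?_).mp h1
    intro I hI
    have : I = ⊥ := by
      by_contra hI0
      exact hI ⟨⟨I, mem_nonZeroDivisors_of_ne_zero hI0⟩, rfl⟩
    simp [this, hh0]
  have h3 : HasSum (fun n : ℕ => (rK K n : ℝ) * h (n * t)) (∑ C, S C) := by
    rw [← (Equiv.sigmaFiberEquiv (fun I : (Ideal (𝓞 K)) => Ideal.absNorm I)).hasSum_iff] at h2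
    refine h2.sigma fun n => ?_
    by_cases hn : n = 0
    · subst hn
      convert hasSum_zero with I
      · simp only [Function.comp_apply, Equiv.sigmaFiberEquiv_apply, I.2]
        simp [hh0]
      · simp [hh0]
    · have : Fintype {I : Ideal (𝓞 K) // Ideal.absNorm I = n} :=
        @Fintype.ofFinite _ ((Ideal.finite_setOfPred_absNorm_eq n).to_subtype)
      have h5 : (fun c : {I : Ideal (𝓞 K) // Ideal.absNorm I = n} => ((fun I : Ideal (𝓞 K) => h (Ideal.absNorm I * t)) ∘
          (Equiv.sigmaFiberEquiv fun I : (Ideal (𝓞 K)) => Ideal.absNorm I)) ⟨n, c⟩) =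
          fun _ => h (n * t) := by
        ext I
        simp only [Function.comp_apply, Equiv.sigmaFiberEquiv_apply, I.2]
      rw [h5]
      convert hasSum_fintype (fun _ : {I : Ideal (𝓞 K) // Ideal.absNorm I = n} => h (n * t)) using 1
      simp [rK, Nat.card_eq_fintype_card]
  rw [h3.tsum_eq, Finset.sum_div, ← Finset.sum_sub_distrib, Finset.sum_mul]
  exact (Finset.abs_sum_le_sum_abs _ _).trans (Finset.sum_le_sum fun C _ => hS2 C)

end DLB
end

section
open MeasureTheory Filter Topology Set

namespace DLB

section
variable (h : ℝ → ℝ) (hh : Continuous h) (a b : ℝ) (ha : 0 < a)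
    (hs : ∀ y, h y ≠ 0 → a ≤ y ∧ y ≤ b)

include ha hs in
lemma h_zero_bot (c : ℝ) : (fun t => (h t : ℂ)) =O[𝓝[>] 0] fun t : ℝ => t ^ c := by
  refine Asymptotics.IsBigO.congr' (Asymptotics.isBigO_zero _ _) ?_ EventuallyEq.rfl
  filter_upwards [Ioo_mem_nhdsGT ha] with t ht
  by_contra h0
  have : h t ≠ 0 := fun h1 => h0 (by simp [h1])
  exact absurd (hs t this).1 (not_le.mpr ht.2)

include hs in
lemma h_zero_top (c : ℝ) : (fun t => (h t : ℂ)) =O[atTop] fun t : ℝ => t ^ c := by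
  refine Asymptotics.IsBigO.congr' (Asymptotics.isBigO_zero _ _) ?_ EventuallyEq.rfl
  filter_upwards [eventually_gt_atTop b] with t ht
  by_contra h0
  have : h t ≠ 0 := fun h1 => h0 (by simp [h1])
  exact absurd (hs t this).2 (not_le.mpr ht)

include hh in
lemma h_locInt : LocallyIntegrableOn (fun t => (h t : ℂ)) (Ioi 0) :=
  (Complex.continuous_ofReal.comp hh).locallyIntegrable.locallyIntegrableOn _

include hh ha hs in
lemma h_conv (s : ℂ) : MellinConvergent (fun t => (h t : ℂ)) s :=
  mellinConvergent_of_isBigO_rpow (h_locInt h hh) (h_zero_top h a b hs (-(s.re + 1))) (by linarith)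
    (h_zero_bot h a b ha hs (-(s.re - 1))) (by linarith)

include hh ha hs in
lemma h_diff : Differentiable ℂ (mellin (fun t => (h t : ℂ))) := fun s =>
  mellin_differentiableAt_of_isBigO_rpow (h_locInt h hh) (h_zero_top h a b hs (-(s.re + 1)))
    (by linarith) (h_zero_bot h a b ha hs (-(s.re - 1))) (by linarith)

include hh ha hs in
lemma mellin_sum (r : ℕ → ℝ) (hr : ∀ n, 0 ≤ r n) (s : ℂ)
    (hsum : LSeriesSummable (fun n => (r n : ℂ)) s) :
    mellin (fun t => ((∑' n : ℕ, r n * h (n * t) : ℝ) : ℂ)) s =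
      LSeries (fun n => (r n : ℂ)) s * mellin (fun t => (h t : ℂ)) s := by
  have hh0 : h 0 = 0 := by
    by_contra h0
    exact absurd (hs 0 h0).1 (not_le.mpr ha)
  set F : ℕ → ℝ → ℂ := fun n t => (t : ℂ) ^ (s - 1) • ((r n : ℂ) * (h (n * t) : ℂ)) with hF
  have hF0 : F 0 = 0 := by
    ext t; simp [hF, hh0]
  have hconv : ∀ n : ℕ, n ≠ 0 → MellinConvergent (fun t : ℝ => (h (n * t) : ℂ)) s := by
    intro n hn
    have hn' : (0 : ℝ) < n := by exact_mod_cast Nat.pos_of_ne_zero hn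
    exact (MellinConvergent.comp_mul_left (f := fun t => (h t : ℂ)) hn').mpr (h_conv h hh a b ha hs s)
  have hintg : ∀ n, IntegrableOn (F n) (Ioi 0) := by
    intro n
    rcases eq_or_ne n 0 with rfl | hn
    · rw [hF0]; exact integrableOn_zero
    · have := (hconv n hn).const_smul (r n : ℂ)
      exact this
  have hval : ∀ n, ∫ t in Ioi (0:ℝ), F n t = LSeries.term (fun n => (r n : ℂ)) s n *
      mellin (fun t => (h t : ℂ)) s := by
    intro n
    rcases eq_or_ne n 0 with rfl | hn
    · simp [hF0]
    · have hn' : (0 : ℝ) < n := by exact_mod_cast Nat.pos_of_ne_zero hn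
      have h1 := mellin_const_smul (fun t : ℝ => (h (n * t) : ℂ)) s (r n : ℂ)
      have h2 := mellin_comp_mul_left (fun t : ℝ => (h t : ℂ)) s hn'
      have h3 : ∫ t in Ioi (0:ℝ), F n t = mellin (fun t : ℝ => (r n : ℂ) • (h (n * t) : ℂ)) s := rfl
      rw [h3, h1, h2, LSeries.term_of_ne_zero hn, smul_eq_mul, smul_eq_mul]
      rw [Complex.cpow_neg, div_eq_mul_inv]
      push_cast
      ring
  set G : ℝ → ℝ := fun u => u ^ (s.re - 1) * |h u| with hG
  have hnorm : ∀ n, ∫ t in Ioi (0:ℝ), ‖F n t‖ = ‖LSeries.term (fun n => (r n : ℂ)) s n‖ *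
      ∫ u in Ioi (0:ℝ), G u := by
    intro n
    rcases eq_or_ne n 0 with rfl | hn
    · simp [hF0]
    · have hn' : (0 : ℝ) < n := by exact_mod_cast Nat.pos_of_ne_zero hn
      have h1 : ∫ t in Ioi (0:ℝ), ‖F n t‖ = ∫ t in Ioi (0:ℝ),
          (r n * (n : ℝ) ^ (1 - s.re)) * G (n * t) := by
        refine setIntegral_congr_fun measurableSet_Ioi fun t ht => ?_
        have ht' : (0 : ℝ) < t := ht
        simp only [hF, hG, norm_smul, norm_mul, Complex.norm_real, Real.norm_eq_abs,
          abs_of_nonneg (hr n), Complex.norm_cpow_eq_rpow_re_of_pos ht', Complex.sub_re,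
          Complex.one_re]
        rw [Real.mul_rpow hn'.le ht'.le]
        have : (n : ℝ) ^ (1 - s.re) * (n : ℝ) ^ (s.re - 1) = 1 := by
          rw [← Real.rpow_add hn']; simp
        linear_combination (-(t ^ (s.re - 1) * (r n * |h (n * t)|))) * this
      rw [h1, integral_const_mul, integral_comp_mul_left_Ioi G 0 hn', mul_zero,
        LSeries.term_of_ne_zero hn, norm_div, Complex.norm_natCast_cpow_of_pos
        (Nat.pos_of_ne_zero hn), Complex.norm_real, Real.norm_eq_abs, abs_of_nonneg (hr n),
        Real.rpow_sub hn', Real.rpow_one, smul_eq_mul]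
      field_simp
  have hS := hasSum_integral_of_summable_integral_norm hintg (by
    simp only [hnorm]
    exact hsum.norm.mul_right _)
  simp only [hval] at hS
  have hS2 := (hsum.hasSum.mul_right (mellin (fun t => (h t : ℂ)) s)).unique hS
  rw [LSeries, hS2, mellin]
  refine setIntegral_congr_fun measurableSet_Ioi fun t ht => ?_
  simp only [hF, smul_eq_mul, Complex.ofReal_tsum, Complex.ofReal_mul, tsum_mul_left]

include hh hs in
lemma sum_locInt (r : ℕ → ℝ) :
    ContinuousOn (fun t : ℝ => (∑' n : ℕ, r n * h (n * t))) (Ioi 0) := by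
  intro t ht
  refine ContinuousAt.continuousWithinAt ?_
  have ht' : (0 : ℝ) < t := ht
  obtain ⟨N, hN⟩ := exists_nat_gt (b / (t / 2))
  have h1 : (fun t : ℝ => (∑' n : ℕ, r n * h (n * t))) =ᶠ[𝓝 t]
      fun t => ∑ n ∈ Finset.range N, r n * h (n * t) := by
    filter_upwards [lt_mem_nhds (show t / 2 < t by linarith)] with u hu
    refine tsum_eq_sum fun n hn => ?_
    have hn' : (N : ℝ) ≤ n := by exact_mod_cast (by simpa using hn : N ≤ n)
    have : h (n * u) = 0 := by
      by_contra h0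
      have h2 := (hs _ h0).2
      have h3 : b < N * (t / 2) := by rwa [div_lt_iff₀ (by linarith)] at hN
      have h4 : (N : ℝ) * (t / 2) ≤ n * u := by gcongr
      linarith
    rw [this, mul_zero]
  refine ContinuousAt.congr ?_ h1.symm
  fun_prop

include hh ha hs in
lemma mellin_cont (r : ℕ → ℝ) (hr : ∀ n, 0 ≤ r n)
    (hsum : ∀ s : ℂ, 1 < s.re → LSeriesSummable (fun n => (r n : ℂ)) s) (δ : ℝ) (hδ : 0 < δ)
    (c B : ℝ) (hcB : ∀ t : ℝ, 0 < t → t ≤ 1 →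
      |(∑' n : ℕ, r n * h (n * t)) - c / t| ≤ B * t ^ (-1 + δ)) :
    ∃ Z : ℂ → ℂ, (∀ s : ℂ, 1 - δ < s.re → DifferentiableAt ℂ Z s) ∧
      ∀ s : ℂ, 1 < s.re → Z s = (s - 1) * LSeries (fun n => (r n : ℂ)) s *
        mellin (fun t => (h t : ℂ)) s := by
  set f : ℝ → ℂ := fun t => ((∑' n : ℕ, r n * h (n * t) : ℝ) : ℂ) with hf
  have hfl : LocallyIntegrableOn f (Ioi 0) :=
    ContinuousOn.locallyIntegrableOn
      (Complex.continuous_ofReal.comp_continuousOn (sum_locInt h hh a b hs r)) measurableSet_Ioi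
  set q : ℝ → ℂ := indicator (Ioc 0 1) (fun t => (t : ℂ) ^ (-1 : ℂ)) with hq
  have hql : LocallyIntegrableOn q (Ioi 0) := by
    have hc : ContinuousOn (fun t : ℝ => (t : ℂ) ^ (-1 : ℂ)) (Ioi 0) := by
      intro t ht
      refine ContinuousAt.continuousWithinAt ?_
      exact Complex.continuousAt_ofReal_cpow_const _ _ (Or.inr (ne_of_gt ht))
    have h1 := hc.locallyIntegrableOn measurableSet_Ioi (μ := volume)
    intro x hx
    obtain ⟨U, hU, hUi⟩ := h1 x hx
    exact ⟨U, hU, hUi.indicator measurableSet_Ioc⟩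
  set g : ℝ → ℂ := fun t => f t - (c : ℂ) • q t with hg
  have hgl : LocallyIntegrableOn g (Ioi 0) := hfl.sub (hql.smul (c : ℂ))
  have hgtop : ∀ e : ℝ, g =O[atTop] fun t : ℝ => t ^ e := by
    intro e
    refine Asymptotics.IsBigO.congr' (Asymptotics.isBigO_zero _ _) ?_ EventuallyEq.rfl
    filter_upwards [eventually_gt_atTop b, eventually_gt_atTop 1] with t htb ht1
    have h1 : f t = 0 := by
      simp only [hf]
      rw [Complex.ofReal_eq_zero]
      have : ∀ n : ℕ, r n * h (n * t) = 0 := by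
        intro n
        rw [mul_eq_zero]; right
        by_contra h0
        have h2 := hs _ h0
        rcases Nat.eq_zero_or_pos n with rfl | hn
        · simp at h2; linarith
        · have : (1 : ℝ) ≤ n := by exact_mod_cast hn
          nlinarith
      simp [this]
    have h2 : q t = 0 := by
      rw [hq, indicator_of_notMem]
      simp [ht1]
    simp [hg, h1, h2]
  have hgbot : g =O[𝓝[>] 0] fun t : ℝ => t ^ (-(1 - δ)) := by
    refine Asymptotics.IsBigO.of_bound B ?_
    filter_upwards [Ioc_mem_nhdsGT (zero_lt_one' ℝ)] with t ht
    have h1 := hcB t ht.1 ht.2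
    have h2 : g t = (((∑' n : ℕ, r n * h (n * t)) - c / t : ℝ) : ℂ) := by
      simp only [hg, hf, hq, indicator_of_mem ht, Complex.cpow_neg_one, smul_eq_mul]
      push_cast
      rw [div_eq_mul_inv]
    rw [h2, Complex.norm_real, Real.norm_eq_abs, Real.norm_of_nonneg (Real.rpow_nonneg ht.1.le _)]
    convert h1 using 2
    ring_nf
  refine ⟨fun s => (s - 1) * mellin g s + c, fun s hs' => ?_, fun s hs' => ?_⟩
  · have := mellin_differentiableAt_of_isBigO_rpow hgl (hgtop (-(s.re + 1))) (by linarith)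
      hgbot hs'
    fun_prop
  · rw [mul_assoc, ← mellin_sum h hh a b ha hs r hr s (hsum s hs')]
    have hgc := mellinConvergent_of_isBigO_rpow hgl (hgtop (-(s.re + 1))) (by linarith)
      hgbot (by linarith : 1 - δ < s.re)
    have hqm := hasMellin_cpow_Ioc (-1) (s := s) (by simp; linarith)
    have hqc := hasMellin_const_smul hqm.1 (c : ℂ)
    have h3 := hasMellin_add hgc hqc.1
    have h4 : (fun t => g t + (c : ℂ) • q t) = f := by ext t; simp [hg]
    have h5 := h3.2
    change mellin (fun t => g t + (c : ℂ) • q t) s = _ at h5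
    rw [h4, hqc.2, hqm.2] at h5
    change _ = (s - 1) * mellin f s
    rw [h5]
    have : s - 1 ≠ 0 := fun h0 => by
      have : s = 1 := sub_eq_zero.mp h0
      rw [this] at hs'; simp at hs'
    rw [← sub_eq_add_neg, smul_eq_mul]
    field_simp
end

lemma mellin_bump_ne (T : ℝ) (hT : 0 < T) : ∃ (h : ℝ → ℝ) (a b : ℝ), ContDiff ℝ 1 h ∧ 0 < a ∧
    (∀ y, h y ≠ 0 → a ≤ y ∧ y ≤ b) ∧
    ∀ s : ℂ, |s.im| ≤ T → mellin (fun t => (h t : ℂ)) s ≠ 0 := by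
  set ε : ℝ := 1 / (2 * (T + 1)) with hε
  have hε0 : 0 < ε := by positivity
  have hε1 : ε ≤ 1 / 2 := by
    rw [hε]; gcongr; linarith
  let f : ContDiffBump (1 : ℝ) := ⟨ε / 2, ε, by positivity, by linarith⟩
  have hsup : ∀ y, f y ≠ 0 → |y - 1| < ε := by
    intro y hy
    have : y ∈ Function.support f := hy
    rw [f.support_eq, Metric.mem_ball, Real.dist_eq] at this
    exact this
  have hsup2 : ∀ y, f y ≠ 0 → 1 - ε ≤ y ∧ y ≤ 1 + ε := fun y hy => by
    have := abs_lt.mp (hsup y hy)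
    constructor <;> linarith
  refine ⟨f, 1 - ε, 1 + ε, f.contDiff, by linarith, hsup2, fun s hs h0 => ?_⟩
  have hc := h_conv f f.continuous (1 - ε) (1 + ε) (by linarith) hsup2 s
  have hcos : ∀ y, f y ≠ 0 → 0 < Real.cos (s.im * Real.log y) := by
    intro y hy
    have h1 := abs_lt.mp (hsup y hy)
    have hy0 : 0 < y := by linarith
    have h2 : |Real.log y| ≤ 2 * ε := by
      rw [abs_le]
      constructor
      · have := Real.one_sub_inv_le_log_of_pos hy0
        have h3 : y⁻¹ ≤ 1 + 2 * ε := by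
          rw [inv_le_iff_one_le_mul₀ hy0]
          nlinarith
        linarith
      · have := Real.log_le_sub_one_of_pos hy0
        linarith
    have h3 : |s.im * Real.log y| ≤ 1 := by
      rw [abs_mul]
      calc _ ≤ T * (2 * ε) := by gcongr
        _ = T / (T + 1) := by rw [hε]; field_simp
        _ ≤ 1 := by rw [div_le_one (by linarith)]; linarith
    have h4 := abs_le.mp h3
    apply Real.cos_pos_of_mem_Ioo
    constructor <;> linarith [Real.pi_gt_three]
  have hpt : ∀ t : ℝ, 0 < t → ((t : ℂ) ^ (s - 1) • (f t : ℂ)).re =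
      t ^ (s.re - 1) * Real.cos (s.im * Real.log t) * f t := by
    intro t ht
    have ht0 : (t : ℂ) ≠ 0 := by exact_mod_cast ht.ne'
    rw [Complex.cpow_def_of_ne_zero ht0, ← Complex.ofReal_log ht.le, smul_eq_mul,
      Complex.re_mul_ofReal, Complex.exp_re, Real.rpow_def_of_pos ht]
    simp [mul_comm]
  have hre : (mellin (fun t => (f t : ℂ)) s).re =
      ∫ t in Ioi (0:ℝ), t ^ (s.re - 1) * Real.cos (s.im * Real.log t) * f t := by
    have h1 := Complex.reCLM.integral_comp_comm hc
    rw [mellin]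
    simp only [Complex.reCLM_apply] at h1
    rw [← h1]
    exact setIntegral_congr_fun measurableSet_Ioi fun t ht => hpt t ht
  have hintg : IntegrableOn (fun t : ℝ => t ^ (s.re - 1) * Real.cos (s.im * Real.log t) * f t)
      (Ioi 0) := by
    have h1 : IntegrableOn (fun t : ℝ => ((t : ℂ) ^ (s - 1) • (f t : ℂ)).re) (Ioi 0) :=
      Complex.reCLM.integrable_comp hc
    exact h1.congr_fun (fun t ht => hpt t ht) measurableSet_Ioi
  have hnn : ∀ t ∈ Ioi (0:ℝ), 0 ≤ t ^ (s.re - 1) * Real.cos (s.im * Real.log t) * f t := by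
    intro t ht
    by_cases hft : f t = 0
    · simp [hft]
    · exact mul_nonneg (mul_nonneg (Real.rpow_nonneg (le_of_lt ht) _) (hcos t hft).le) f.nonneg
  have hpos : 0 < ∫ t in Ioi (0:ℝ), t ^ (s.re - 1) * Real.cos (s.im * Real.log t) * f t := by
    rw [setIntegral_pos_iff_support_of_nonneg_ae
      ((ae_restrict_iff' measurableSet_Ioi).mpr (Eventually.of_forall hnn)) hintg]
    have hsub : Ioo (1 - ε) (1 + ε) ⊆ Function.support
        (fun t : ℝ => t ^ (s.re - 1) * Real.cos (s.im * Real.log t) * f t) ∩ Ioi 0 := by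
      intro t ht
      have ht0 : 0 < t := by linarith [ht.1]
      refine ⟨?_, ht0⟩
      have hft : f t ≠ 0 := by
        have : t ∈ Function.support f := by
          rw [f.support_eq, Metric.mem_ball, Real.dist_eq, abs_lt]
          constructor <;> linarith [ht.1, ht.2]
        exact this
      exact mul_ne_zero (mul_ne_zero (Real.rpow_pos_of_pos ht0 _).ne' (hcos t hft).ne') hft
    refine lt_of_lt_of_le ?_ (measure_mono hsub)
    rw [Real.volume_Ioo]
    exact ENNReal.ofReal_pos.mpr (by linarith)
  rw [← hre, h0] at hpos
  simp at hpos

end DLB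
end

section
open MeasureTheory Filter Topology Set

namespace DLB

lemma absc_le (r : ℕ → ℂ) (h : ∀ s : ℂ, 1 < s.re → LSeriesSummable r s) (s : ℂ) (hs : 1 < s.re) :
    LSeries.abscissaOfAbsConv r < s.re := by
  refine lt_of_le_of_lt (LSeries.abscissaOfAbsConv_le_of_forall_lt_LSeriesSummable (x := 1)
    fun y hy => h y (by simpa using hy)) ?_
  exact_mod_cast hs

section
variable (r lam : ℕ → ℝ) (hl0 : ∀ n, 0 ≤ lam n) (hl01 : lam 1 = 0)
  (hrs : ∀ s : ℂ, 1 < s.re → LSeriesSummable (fun n => (r n : ℂ)) s)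
  (hls : ∀ s : ℂ, 1 < s.re → LSeriesSummable (fun n => (lam n : ℂ)) s)
  (hconv : ∀ n, n ≠ 0 → r n * Real.log n = ∑ p ∈ n.divisorsAntidiagonal, r p.1 * lam p.2)

include hrs hls hconv in
lemma zeta_deriv (s : ℂ) (hs : 1 < s.re) : HasDerivAt (LSeries (fun n => (r n : ℂ)))
    (-(LSeries (fun n => (r n : ℂ)) s * LSeries (fun n => (lam n : ℂ)) s)) s := by
  have h1 := LSeries_hasDerivAt (absc_le _ hrs s hs)
  rw [← LSeries_convolution' (hrs s hs) (hls s hs)]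
  convert h1 using 2
  refine LSeries_congr (fun {n} hn => ?_) s
  rw [LSeries.convolution_def]
  simp only [LSeries.logMul]
  have := hconv n hn
  rw [← Complex.natCast_log]
  rw [mul_comm, ← Complex.ofReal_mul, this]
  push_cast
  rfl

/-- The coefficients of the logarithm. -/
noncomputable def lg (n : ℕ) : ℝ := lam n / Real.log n

include hl0 in
lemma lg_nonneg (n : ℕ) : 0 ≤ lg lam n :=
  div_nonneg (hl0 n) (Real.log_natCast_nonneg n)

include hls in
lemma lg_summable (s : ℂ) (hs : 1 < s.re) : LSeriesSummable (fun n => (lg lam n : ℂ)) s := by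
  refine Summable.of_norm_bounded (g := fun n => 2 * ‖LSeries.term (fun n => (lam n : ℂ)) s n‖)
    ((hls s hs).norm.mul_left 2) fun n => ?_
  rcases eq_or_ne n 0 with rfl | hn
  · simp
  rw [LSeries.term_of_ne_zero hn, LSeries.term_of_ne_zero hn, norm_div, norm_div, ← mul_div_assoc]
  gcongr
  rw [lg, Complex.norm_real, Complex.norm_real, norm_div, Real.norm_eq_abs (Real.log n),
    abs_of_nonneg (Real.log_natCast_nonneg n)]
  rcases eq_or_ne n 1 with rfl | hn1
  · simp
  have : (1 / 2 : ℝ) ≤ Real.log n := by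
    have h2 : (2 : ℝ) ≤ n := by exact_mod_cast (show 2 ≤ n by omega)
    have := Real.log_le_log (by norm_num) h2
    linarith [Real.log_two_gt_d9]
  rw [div_le_iff₀ (by linarith)]
  nlinarith [norm_nonneg (lam n)]

include hl01 hls in
lemma lg_deriv (s : ℂ) (hs : 1 < s.re) : HasDerivAt (LSeries (fun n => (lg lam n : ℂ)))
    (-LSeries (fun n => (lam n : ℂ)) s) s := by
  have h1 := LSeries_hasDerivAt (absc_le _ (lg_summable lam hls) s hs)
  convert h1 using 2
  refine LSeries_congr (fun {n} hn => ?_) s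
  simp only [LSeries.logMul, lg]
  rw [← Complex.natCast_log]
  rcases eq_or_ne n 1 with rfl | hn1
  · simp [hl01]
  have : Real.log n ≠ 0 := by
    have h2 : (1 : ℝ) < n := by exact_mod_cast (show 1 < n by omega)
    exact (Real.log_pos h2).ne'
  rw [← Complex.ofReal_mul]
  congr 1
  field_simp

include hl01 hrs hls hconv in
lemma zeta_exp : ∃ C : ℂ, ∀ s : ℂ, 1 < s.re →
    LSeries (fun n => (r n : ℂ)) s = C * Complex.exp (LSeries (fun n => (lg lam n : ℂ)) s) := by
  set z := LSeries (fun n => (r n : ℂ)) with hz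
  set m := LSeries (fun n => (lg lam n : ℂ)) with hm
  have hopen : IsOpen {s : ℂ | 1 < s.re} := isOpen_lt continuous_const Complex.continuous_re
  have hconvx : Convex ℝ {s : ℂ | 1 < s.re} := convex_halfSpace_re_gt 1
  have hd : ∀ s : ℂ, 1 < s.re → HasDerivAt (fun s => z s * Complex.exp (-m s)) 0 s := by
    intro s hs
    have h1 := zeta_deriv r lam hrs hls hconv s hs
    have h2 := (lg_deriv lam hl01 hls s hs).neg.cexp
    have h3 := h1.mul h2
    refine h3.congr_deriv ?_
    simp only [Pi.neg_apply, ← hz, ← hm]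
    ring
  have hconst : ∀ s : ℂ, 1 < s.re → z s * Complex.exp (-m s) = z 2 * Complex.exp (-m 2) := by
    intro s hs
    refine hconvx.is_const_of_fderivWithin_eq_zero (𝕜 := ℂ)
      (f := fun s => z s * Complex.exp (-m s)) (s := {s : ℂ | 1 < s.re})
      (fun x hx => (hd x hx).differentiableAt.differentiableWithinAt) (fun x hx => ?_)
      hs (by simp)
    rw [fderivWithin_of_isOpen hopen hx]
    ext
    simp [(hd x hx).hasFDerivAt.fderiv]
  refine ⟨z 2 * Complex.exp (-m 2), fun s hs => ?_⟩
  rw [← hconst s hs, mul_assoc, ← Complex.exp_add]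
  simp

include hl0 hls in
lemma lg_341 (x t : ℝ) (hx : 1 < x) :
    0 ≤ 3 * (LSeries (fun n => (lg lam n : ℂ)) (x : ℂ)).re +
      4 * (LSeries (fun n => (lg lam n : ℂ)) (x + t * Complex.I)).re +
      (LSeries (fun n => (lg lam n : ℂ)) (x + 2 * t * Complex.I)).re := by
  have hs0 := (lg_summable lam hls (x : ℂ) (by simpa using hx)).hasSum
  have hs1 := (lg_summable lam hls (x + t * Complex.I) (by simpa using hx)).hasSum
  have hs2 := (lg_summable lam hls (x + 2 * t * Complex.I) (by simpa using hx)).hasSum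
  have h := (((Complex.hasSum_re hs0).mul_left 3).add ((Complex.hasSum_re hs1).mul_left 4)).add
    (Complex.hasSum_re hs2)
  refine h.nonneg fun n => ?_
  rcases eq_or_ne n 0 with rfl | hn
  · simp
  have hn' : (0 : ℝ) < n := by exact_mod_cast Nat.pos_of_ne_zero hn
  have key : ∀ u : ℝ, (LSeries.term (fun n => (lg lam n : ℂ)) (x + u * Complex.I) n).re =
      lg lam n * (n : ℝ) ^ (-x) * Real.cos (u * Real.log n) := by
    intro u
    rw [LSeries.term_of_ne_zero hn, div_eq_mul_inv, ← Complex.cpow_neg, Complex.re_ofReal_mul,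
      Complex.cpow_def_of_ne_zero (by exact_mod_cast hn), ← Complex.natCast_log, Complex.exp_re,
      Real.rpow_def_of_pos hn', mul_assoc]
    generalize Real.log (n : ℝ) = y
    simp [mul_comm]
  have k0 := key 0
  have k1 := key t
  have k2 := key (2 * t)
  push_cast at k0 k2
  simp only [zero_mul, add_zero] at k0
  rw [k0, k1, k2]
  have h3 : 0 ≤ 3 * Real.cos 0 + 4 * Real.cos (t * Real.log n) + Real.cos (2 * t * Real.log n) := by
    rw [mul_assoc 2, Real.cos_two_mul, Real.cos_zero]
    nlinarith [sq_nonneg (1 + Real.cos (t * Real.log n))]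
  have h4 := mul_nonneg (mul_nonneg (lg_nonneg lam hl0 n) (Real.rpow_nonneg hn'.le (-x))) h3
  linarith

include hl0 hl01 hrs hls hconv in
lemma nonvanish (δ : ℝ) (hδ : 0 < δ) (T : ℝ) (hT : 0 < T) (Z : ℂ → ℂ)
    (hZ : ∀ s : ℂ, 1 - δ < s.re → |s.im| ≤ T → DifferentiableAt ℂ Z s)
    (hZs : ∀ s : ℂ, 1 < s.re → Z s = (s - 1) * LSeries (fun n => (r n : ℂ)) s)
    (hZ1 : Z 1 ≠ 0) (s : ℂ) (hs : 1 ≤ s.re) (hsT : 2 * |s.im| ≤ T) : Z s ≠ 0 := by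
  obtain ⟨C, hC⟩ := zeta_exp r lam hl01 hrs hls hconv
  have hpath : ∀ t : ℝ, |t| ≤ T → Tendsto (fun x : ℝ => Z (x + t * Complex.I)) (𝓝[>] 1)
      (𝓝 (Z (1 + t * Complex.I))) := by
    intro t ht
    have h1 : ContinuousAt Z (1 + t * Complex.I) :=
      (hZ _ (by simp; linarith) (by simpa using ht)).continuousAt
    have h2 : ContinuousAt (fun x : ℝ => (x : ℂ) + t * Complex.I) 1 := by fun_prop
    have h3 : ContinuousAt (fun x : ℝ => Z (x + t * Complex.I)) 1 :=
      ContinuousAt.comp (f := fun x : ℝ => (x : ℂ) + t * Complex.I) (by simpa using h1) h2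
    have := h3.tendsto.mono_left (nhdsWithin_le_nhds (s := Ioi 1))
    simpa using this
  have hC0 : C ≠ 0 := by
    intro h0
    have h1 := hpath 0 (by simpa using hT.le)
    have h2 : (fun x : ℝ => Z (x + (0:ℝ) * Complex.I)) =ᶠ[𝓝[>] 1] fun _ => 0 := by
      filter_upwards [self_mem_nhdsWithin] with x hx
      have hx' : 1 < (x : ℂ).re := by simpa using hx
      simp only [Complex.ofReal_zero, zero_mul, add_zero]
      rw [hZs _ hx', hC _ hx', h0]; simp
    have h3 := tendsto_nhds_unique (h1.congr' h2) tendsto_const_nhds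
    simp at h3
    exact hZ1 h3
  rcases hs.lt_or_eq with hs1 | hs1
  · rw [hZs s hs1, hC s hs1]
    refine mul_ne_zero (sub_ne_zero.mpr ?_) (mul_ne_zero hC0 (Complex.exp_ne_zero _))
    rintro rfl
    simp at hs1
  intro hz
  set t := s.im with ht
  have hst : s = 1 + t * Complex.I := by
    apply Complex.ext <;> simp [← hs1, ht]
  have ht0 : t ≠ 0 := by
    intro h0
    rw [h0] at hst
    simp at hst
    exact hZ1 (hst ▸ hz)
  -- lower bound
  have hlow : ∀ x : ℝ, 1 < x → ‖C‖ ^ 8 ≤ ‖LSeries (fun n => (r n : ℂ)) x‖ ^ 3 *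
      ‖LSeries (fun n => (r n : ℂ)) (x + t * Complex.I)‖ ^ 4 *
      ‖LSeries (fun n => (r n : ℂ)) (x + 2 * t * Complex.I)‖ := by
    intro x hx
    rw [hC _ (by simpa using hx), hC _ (by simpa using hx), hC _ (by simpa using hx)]
    simp only [norm_mul, Complex.norm_exp]
    have := lg_341 lam hl0 hls x t hx
    have h1 := Real.one_le_exp this
    rw [Real.exp_add, Real.exp_add] at h1
    have e3 : ∀ y : ℝ, Real.exp (3 * y) = Real.exp y ^ 3 := fun y => by
      rw [← Real.exp_nat_mul]; norm_num
    have e4 : ∀ y : ℝ, Real.exp (4 * y) = Real.exp y ^ 4 := fun y => by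
      rw [← Real.exp_nat_mul]; norm_num
    rw [e3, e4] at h1
    calc ‖C‖ ^ 8 = ‖C‖ ^ 8 * 1 := by ring
      _ ≤ ‖C‖ ^ 8 * _ := mul_le_mul_of_nonneg_left h1 (by positivity)
      _ = _ := by ring
  -- the quotient
  have hq : Tendsto (fun x : ℝ => Z (x + t * Complex.I) / ((x : ℂ) - 1)) (𝓝[>] 1)
      (𝓝 (deriv Z s)) := by
    have h1 := (hZ s (by linarith) (by rw [← ht]; linarith [abs_nonneg t])).hasDerivAt
    rw [hasDerivAt_iff_tendsto_slope] at h1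
    have h2 : Tendsto (fun x : ℝ => (x : ℂ) + t * Complex.I) (𝓝[>] 1) (𝓝[≠] s) := by
      refine tendsto_nhdsWithin_iff.mpr ⟨?_, ?_⟩
      · have : ContinuousAt (fun x : ℝ => (x : ℂ) + t * Complex.I) 1 := by fun_prop
        have h := this.tendsto.mono_left (nhdsWithin_le_nhds (s := Ioi 1))
        rw [hst]; simpa using h
      · filter_upwards [self_mem_nhdsWithin] with x hx h0
        have := congrArg Complex.re h0
        rw [hst] at this
        simp at this
        exact absurd this (ne_of_gt hx)
    refine (h1.comp h2).congr fun x => ?_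
    simp only [Function.comp, slope_def_field, hz, sub_zero]
    congr 1
    rw [hst]; ring
  have ha := hpath 0 (by simpa using hT.le)
  have hb := hpath (2 * t) (by rw [abs_mul]; simpa using hsT)
  have hb' : Tendsto (fun x : ℝ => Z (x + 2 * t * Complex.I) / (x - 1 + 2 * t * Complex.I)) (𝓝[>] 1)
      (𝓝 (Z (1 + 2 * t * Complex.I) / (1 - 1 + 2 * t * Complex.I))) := by
    push_cast at hb
    refine hb.div ?_ (by simp [ht0])
    have : ContinuousAt (fun x : ℝ => (x : ℂ) - 1 + 2 * t * Complex.I) 1 := by fun_prop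
    have h := this.tendsto.mono_left (nhdsWithin_le_nhds (s := Ioi 1))
    simpa using h
  have hx1 : Tendsto (fun x : ℝ => (x : ℂ) - 1) (𝓝[>] 1) (𝓝 0) := by
    have : ContinuousAt (fun x : ℝ => (x : ℂ) - 1) 1 := by fun_prop
    have h := this.tendsto.mono_left (nhdsWithin_le_nhds (s := Ioi 1))
    simpa using h
  have hd' : Tendsto (fun x : ℝ => 1 / (x - 1 + t * Complex.I) ^ 4) (𝓝[>] 1)
      (𝓝 (1 / (1 - 1 + t * Complex.I) ^ 4)) := by
    refine tendsto_const_nhds.div ?_ (by simp [ht0])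
    have : ContinuousAt (fun x : ℝ => ((x : ℂ) - 1 + t * Complex.I) ^ 4) 1 := by fun_prop
    have h := this.tendsto.mono_left (nhdsWithin_le_nhds (s := Ioi 1))
    simpa using h
  have hall := ((((ha.pow 3).mul (hq.pow 4)).mul hb').mul hd').mul hx1
  rw [mul_zero] at hall
  have hall2 := hall.norm
  rw [norm_zero] at hall2
  have h8 : ‖C‖ ^ 8 ≤ 0 := by
    refine ge_of_tendsto hall2 ?_
    filter_upwards [self_mem_nhdsWithin] with x hx
    have hx' : 1 < x := hx
    refine (hlow x hx').trans (le_of_eq ?_)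
    have hx0 : (x : ℂ) - 1 ≠ 0 := sub_ne_zero.mpr (by exact_mod_cast hx'.ne')
    have hx2 : (x : ℂ) - 1 + t * Complex.I ≠ 0 := by
      intro h; have := congrArg Complex.im h; simp at this; exact ht0 this
    have hx3 : (x : ℂ) - 1 + 2 * t * Complex.I ≠ 0 := by
      intro h; have := congrArg Complex.im h; simp at this; exact ht0 this
    rw [hZs _ (by simpa using hx'), hZs _ (by simpa using hx'), hZs _ (by simpa using hx')]
    rw [← norm_pow, ← norm_pow, ← norm_mul, ← norm_mul]
    congr 1
    simp only [Complex.ofReal_zero, zero_mul, add_zero]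
    have e1 : (x : ℂ) + t * Complex.I - 1 = x - 1 + t * Complex.I := by ring
    have e2 : (x : ℂ) + 2 * t * Complex.I - 1 = x - 1 + 2 * t * Complex.I := by ring
    rw [e1, e2]
    generalize (x : ℂ) - 1 + 2 * t * Complex.I = w at hx3
    field_simp
  have : 0 < ‖C‖ ^ 8 := by positivity
  linarith
end

end DLB
end

section
open MeasureTheory Filter Topology Set

namespace DLB

section
variable (lam : ℕ → ℝ) (hl0 : ∀ n, 0 ≤ lam n) (M : ℝ)
  (hM : ∀ N : ℕ, ∑ k ∈ Finset.Icc 1 N, lam k ≤ M * N)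

/-- summatory function -/
noncomputable def psiS (x : ℝ) : ℝ := ∑ k ∈ Finset.Icc 1 ⌊x⌋₊, lam k

include hl0 in
lemma psiS_mono : Monotone (psiS lam) := by
  intro x y hxy
  refine Finset.sum_le_sum_of_subset_of_nonneg ?_ fun i _ _ => hl0 i
  exact Finset.Icc_subset_Icc_right (Nat.floor_mono hxy)

include hl0 in
lemma psiS_nonneg (x : ℝ) : 0 ≤ psiS lam x := Finset.sum_nonneg fun i _ => hl0 i

include hl0 hM in
lemma M_nonneg : 0 ≤ M := by
  have := hM 1
  simp at this
  exact (hl0 1).trans this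

include hl0 hM in
lemma lam_bigO : (fun n => ∑ k ∈ Finset.Icc 1 n, lam k) =O[atTop] fun n : ℕ => (n : ℝ) ^ (1:ℝ) := by
  refine Asymptotics.IsBigO.of_bound M (Eventually.of_forall fun n => ?_)
  rw [Real.norm_of_nonneg (Finset.sum_nonneg fun i _ => hl0 i), Real.rpow_one,
    Real.norm_of_nonneg (Nat.cast_nonneg n)]
  exact hM n

include hl0 hM in
lemma lam_summable (s : ℂ) (hs : 1 < s.re) : LSeriesSummable (fun n => (lam n : ℂ)) s :=
  LSeriesSummable_of_sum_norm_bigO_and_nonneg (lam_bigO lam hl0 M hM) hl0 zero_le_one hs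

include hl0 hM in
lemma psi_laplace (z : ℂ) (hz : 0 < z.re) :
    ∫ t in Ioi (0:ℝ), ((Real.exp (-t) * psiS lam (Real.exp t) - 1 : ℝ) : ℂ) * Complex.exp (-z * t)
      = LSeries (fun n => (lam n : ℂ)) (1 + z) / (1 + z) - 1 / z := by
  have h1 := LSeries_eq_mul_integral_of_nonneg lam zero_le_one (s := 1 + z) (by simpa using hz)
    (lam_bigO lam hl0 M hM) hl0
  have hz1 : (1 + z) ≠ 0 := by
    intro h; have := congrArg Complex.re h; simp at this; linarith
  have h2 : LSeries (fun n => (lam n : ℂ)) (1 + z) / (1 + z) =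
      ∫ t in Ioi (0:ℝ), ((Real.exp (-t) * psiS lam (Real.exp t) : ℝ) : ℂ) * Complex.exp (-z * t) := by
    rw [h1, mul_div_cancel_left₀ _ hz1]
    have h3 := integral_comp_exp_Ioi
      (fun t : ℝ => (∑ k ∈ Finset.Icc 1 ⌊t⌋₊, (lam k : ℂ)) * (t : ℂ) ^ (-(1 + z + 1))) 0
    rw [Real.exp_zero] at h3
    rw [← h3]
    refine setIntegral_congr_fun measurableSet_Ioi fun t ht => ?_
    simp only [psiS, Complex.real_smul]
    rw [Complex.cpow_def_of_ne_zero (by simp), ← Complex.ofReal_log (Real.exp_pos t).le,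
      Real.log_exp]
    push_cast
    have : Complex.exp (t * -(1 + z + 1)) =
      Complex.exp (-t) * Complex.exp (-t) * Complex.exp (-z * t) := by
      rw [← Complex.exp_add, ← Complex.exp_add]; congr 1; ring
    rw [this]
    have h4 : Complex.exp t * Complex.exp (-t) = 1 := by rw [← Complex.exp_add]; simp
    linear_combination (Complex.exp (-t) * Complex.exp (-z * t) *
      ∑ k ∈ Finset.Icc 1 ⌊Real.exp t⌋₊, (lam k : ℂ)) * h4
  have hE : IntegrableOn (fun t : ℝ => Complex.exp (-z * t)) (Ioi 0) :=
    integrableOn_exp_mul_complex_Ioi (by simpa using hz) 0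
  have h5 : ∫ t in Ioi (0:ℝ), Complex.exp (-z * t) = 1 / z := by
    rw [integral_exp_mul_complex_Ioi (by simpa using hz)]
    simp
  have hI : IntegrableOn (fun t : ℝ => ((Real.exp (-t) * psiS lam (Real.exp t) : ℝ) : ℂ) *
      Complex.exp (-z * t)) (Ioi 0) := by
    refine hE.bdd_mul (c := M) ?_ ?_
    · refine Measurable.aestronglyMeasurable ?_
      refine Complex.measurable_ofReal.comp ?_
      exact (Real.measurable_exp.comp measurable_neg).mul
        ((psiS_mono lam hl0).measurable.comp Real.measurable_exp)
    · refine Eventually.of_forall fun t => ?_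
      rw [Complex.norm_real, Real.norm_of_nonneg (mul_nonneg (Real.exp_pos _).le
        (psiS_nonneg lam hl0 _)), Real.exp_neg, inv_mul_le_iff₀ (Real.exp_pos t)]
      refine (hM _).trans ?_
      rw [mul_comm]
      exact mul_le_mul_of_nonneg_right (Nat.floor_le (Real.exp_pos t).le) (M_nonneg lam hl0 M hM)
  rw [h2, ← h5, ← integral_sub hI hE]
  refine setIntegral_congr_fun measurableSet_Ioi fun t ht => ?_
  push_cast; ring

include hl0 hM in
theorem wi (hl01 : lam 1 = 0) (r : ℕ → ℝ)
    (hrs : ∀ s : ℂ, 1 < s.re → LSeriesSummable (fun n => (r n : ℂ)) s)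
    (hconv : ∀ n, n ≠ 0 → r n * Real.log n = ∑ p ∈ n.divisorsAntidiagonal, r p.1 * lam p.2)
    (δ : ℝ) (hδ : 0 < δ)
    (hZ : ∀ T : ℝ, 0 < T → ∃ Z : ℂ → ℂ,
      (∀ s : ℂ, 1 - δ < s.re → |s.im| ≤ T → DifferentiableAt ℂ Z s) ∧
      (∀ s : ℂ, 1 < s.re → Z s = (s - 1) * LSeries (fun n => (r n : ℂ)) s) ∧ Z 1 ≠ 0) :
    Tendsto (fun x => psiS lam x / x) atTop (𝓝 1) := by
  have hls := lam_summable lam hl0 M hM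
  have key : Tendsto (fun t => Real.exp (-t) * psiS lam (Real.exp t)) atTop (𝓝 1) := by
    refine tauberian _ ?_ M ?_ ?_ ?_ ?_ ?_
    · exact (Real.measurable_exp.comp measurable_neg).mul
        ((psiS_mono lam hl0).measurable.comp Real.measurable_exp)
    · exact fun t => mul_nonneg (Real.exp_pos _).le (psiS_nonneg lam hl0 _)
    · intro t
      rw [Real.exp_neg, inv_mul_le_iff₀ (Real.exp_pos t)]
      refine (hM _).trans ?_
      rw [mul_comm]
      exact mul_le_mul_of_nonneg_right (Nat.floor_le (Real.exp_pos t).le) (M_nonneg lam hl0 M hM)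
    · intro t ht
      have : ⌊Real.exp t⌋₊ = 0 := Nat.floor_eq_zero.mpr (by rwa [Real.exp_lt_one_iff])
      simp [psiS, this]
    · intro t t' htt
      have h1 := psiS_mono lam hl0 (Real.exp_le_exp.mpr htt)
      calc _ ≤ Real.exp (-t) * psiS lam (Real.exp t') := by gcongr
        _ = _ := by
          have : Real.exp (-t) = Real.exp (-t') * Real.exp (t' - t) := by
            rw [← Real.exp_add]; congr 1; ring
          rw [this]; ring
    · intro l hl
      obtain ⟨Z, hZd, hZs, hZ1⟩ := hZ (2 * l + 1) (by linarith)
      have hnv : ∀ z : ℂ, 0 ≤ z.re → |z.im| ≤ l → Z (1 + z) ≠ 0 := by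
        intro z hz hzl
        exact nonvanish r lam hl0 hl01 hrs hls hconv δ hδ (2 * l + 1) (by linarith) Z hZd hZs hZ1
          (1 + z) (by simpa using hz) (by simp; linarith)
      refine ⟨fun z => (-1 - deriv Z (1 + z) / Z (1 + z)) / (1 + z), ?_, ?_⟩
      · intro z hz
        refine ContinuousAt.continuousWithinAt ?_
        have hz1 : (1 + z) ≠ 0 := by
          intro h; have := congrArg Complex.re h; simp at this; linarith [hz.1]
        have hop : IsOpen {s : ℂ | 1 - δ < s.re ∧ |s.im| < 2 * l + 1} :=
          (isOpen_lt continuous_const Complex.continuous_re).inter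
            (isOpen_lt (Complex.continuous_im.abs) continuous_const)
        have hdo : DifferentiableOn ℂ Z {s : ℂ | 1 - δ < s.re ∧ |s.im| < 2 * l + 1} :=
          fun s hs => (hZd s hs.1 hs.2.le).differentiableWithinAt
        have hmem : (1 + z) ∈ {s : ℂ | 1 - δ < s.re ∧ |s.im| < 2 * l + 1} := by
          refine ⟨?_, ?_⟩
          · simp; linarith [hz.1]
          · simp; linarith [hz.2]
        have hc1 : ContinuousAt (deriv Z) (1 + z) :=
          ((hdo.deriv hop).differentiableAt (hop.mem_nhds hmem)).continuousAt
        have hc0 : ContinuousAt Z (1 + z) := (hdo.differentiableAt (hop.mem_nhds hmem)).continuousAt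
        have ha : ContinuousAt (fun z : ℂ => 1 + z) z := by fun_prop
        have hc1' : ContinuousAt (fun z => deriv Z (1 + z)) z :=
          ContinuousAt.comp (f := fun z : ℂ => 1 + z) hc1 ha
        have hc0' : ContinuousAt (fun z => Z (1 + z)) z :=
          ContinuousAt.comp (f := fun z : ℂ => 1 + z) hc0 ha
        exact (continuousAt_const.sub (hc1'.div hc0' (hnv z hz.1 hz.2))).div ha hz1
      · intro z hz hzl
        rw [psi_laplace lam hl0 M hM z hz]
        have hre : 1 < (1 + z).re := by simpa using hz
        have hz0 : z ≠ 0 := by rintro rfl; simp at hz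
        have hz1 : (1 + z) ≠ 0 := by
          intro h; have := congrArg Complex.re h; simp at this; linarith
        have hd := zeta_deriv r lam hrs hls hconv (1 + z) hre
        have hdZ : deriv Z (1 + z) = LSeries (fun n => (r n : ℂ)) (1 + z) + z *
            (-(LSeries (fun n => (r n : ℂ)) (1 + z) * LSeries (fun n => (lam n : ℂ)) (1 + z))) := by
          have h1 : Z =ᶠ[𝓝 (1 + z)] fun s => (s - 1) * LSeries (fun n => (r n : ℂ)) s := by
            have hopen : IsOpen {s : ℂ | 1 < s.re} :=
              isOpen_lt continuous_const Complex.continuous_re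
            filter_upwards [hopen.mem_nhds hre] with s hs using hZs s hs
          rw [h1.deriv_eq]
          have h2 := ((hasDerivAt_id (1 + z)).sub_const 1).mul hd
          refine h2.deriv.trans ?_
          simp
        have hz2 := hnv z hz.le hzl
        rw [hZs _ hre, add_sub_cancel_left] at hz2
        have hr0 := (mul_ne_zero_iff.mp hz2).2
        beta_reduce
        rw [hdZ, hZs _ hre, add_sub_cancel_left]
        field_simp
        ring
  have h2 := key.comp Real.tendsto_log_atTop
  refine h2.congr' ?_
  filter_upwards [eventually_gt_atTop 0] with x hx
  simp only [Function.comp, Real.exp_neg, Real.exp_log hx]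
  rw [inv_mul_eq_div]
end

end DLB
end

section
open MeasureTheory Filter Topology Set NumberField

namespace DLB

section
variable (K : Type*) [Field K] [NumberField K]

/-- ideals of given norm -/
noncomputable def nI (n : ℕ) : Finset (Ideal (𝓞 K)) :=
  (Ideal.finite_setOfPred_absNorm_eq (S := 𝓞 K) n).toFinset

variable {K} in
lemma mem_nI {n : ℕ} {I : Ideal (𝓞 K)} : I ∈ nI K n ↔ Ideal.absNorm I = n := by
  simp [nI]

lemma rK_eq (n : ℕ) : rK K n = (nI K n).card := by
  rw [rK, nI]
  exact Nat.card_eq_card_finite_toFinset (Ideal.finite_setOfPred_absNorm_eq (S := 𝓞 K) n)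

open Classical in
/-- von Mangoldt function on ideals -/
noncomputable def vM (I : Ideal (𝓞 K)) : ℝ :=
  if IsPrimePow I then Real.log (Ideal.absNorm I.radical) else 0

/-- summed von Mangoldt function -/
noncomputable def lamK (n : ℕ) : ℝ := ∑ I ∈ nI K n, vM K I

variable {K}

lemma vM_nonneg (I : Ideal (𝓞 K)) : 0 ≤ vM K I := by
  rw [vM]; split_ifs
  · exact Real.log_natCast_nonneg _
  · exact le_rfl

lemma vM_pow (P : Ideal (𝓞 K)) (hP : Prime P) (k : ℕ) (hk : k ≠ 0) :
    vM K (P ^ k) = Real.log (Ideal.absNorm P) := by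
  rw [vM, if_pos (hP.isPrimePow.pow hk), Ideal.radical_pow P hk,
    (Ideal.isPrime_of_prime hP).radical]

lemma divs_finite (L : Ideal (𝓞 K)) (hL : L ≠ 0) : {J : Ideal (𝓞 K) | J ∣ L}.Finite := by
  refine (Ideal.finite_setOfPred_absNorm_le (S := 𝓞 K) (Ideal.absNorm L)).subset fun J hJ => ?_
  refine Nat.le_of_dvd (Nat.pos_of_ne_zero fun h => hL (Ideal.absNorm_eq_zero_iff.mp h)) ?_
  exact map_dvd Ideal.absNorm hJ

open Classical in
/-- divisors of an ideal -/
noncomputable def divs (L : Ideal (𝓞 K)) : Finset (Ideal (𝓞 K)) :=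
  if hL : L ≠ 0 then (divs_finite L hL).toFinset else ∅

lemma mem_divs {L J : Ideal (𝓞 K)} (hL : L ≠ 0) : J ∈ divs L ↔ J ∣ L := by
  rw [divs, dif_pos hL]; simp

lemma sum_divs (L : Ideal (𝓞 K)) (hL : L ≠ 0) :
    ∑ J ∈ divs L, vM K J = Real.log (Ideal.absNorm L) := by
  classical
  revert hL
  induction L using UniqueFactorizationMonoid.induction_on_prime with
  | h₁ => intro h; exact absurd rfl h
  | h₂ x hx =>
    intro h0
    rw [Ideal.isUnit_iff.mp hx, Ideal.absNorm_top]
    simp only [Nat.cast_one, Real.log_one]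
    refine Finset.sum_eq_zero fun J hJ => ?_
    rw [vM, if_neg]
    intro hp
    rw [mem_divs (by simp)] at hJ
    exact hp.not_isUnit (isUnit_of_dvd_unit hJ (by simp))
  | h₃ L' P hL' hP ih =>
    intro hPL
    have ih := ih hL'
    have hPn : Ideal.absNorm P ≠ 0 := fun h => hP.ne_zero (Ideal.absNorm_eq_zero_iff.mp h)
    have hLn : Ideal.absNorm L' ≠ 0 := fun h => hL' (Ideal.absNorm_eq_zero_iff.mp h)
    obtain ⟨c, hc, hnd⟩ := (FiniteMultiplicity.of_prime_left hP hL').exists_eq_pow_mul_and_not_dvd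
    set v := multiplicity P L'
    have hsub : divs L' ⊆ divs (P * L') := by
      intro J hJ
      rw [mem_divs hPL]; rw [mem_divs hL'] at hJ
      exact hJ.mul_left P
    have hcanc : ∀ a b : Ideal (𝓞 K), ∀ n : ℕ, P ^ n * a ∣ P ^ n * b → a ∣ b := fun a b n h =>
      (mul_dvd_mul_iff_left (pow_ne_zero n hP.ne_zero)).mp h
    rw [← Finset.sum_sdiff hsub, ih, map_mul, Nat.cast_mul, Real.log_mul (by exact_mod_cast hPn)
      (by exact_mod_cast hLn)]
    congr 1
    rw [Finset.sum_eq_single (P ^ (v + 1)), vM_pow P hP _ (by omega)]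
    · intro J hJ hne
      rw [Finset.mem_sdiff, mem_divs hPL, mem_divs hL'] at hJ
      rw [vM, if_neg]
      rintro ⟨Q, k, hQ, hk, rfl⟩
      have hQ := hQ
      by_cases hQP : Q ∣ P
      · have : Q = P := associated_iff_eq.mp (hQ.associated_of_dvd hP hQP)
        subst this
        rcases lt_trichotomy k (v + 1) with h | h | h
        · apply hJ.2
          rw [hc]
          exact (pow_dvd_pow Q (by omega)).mul_right c
        · exact hne (by rw [h])
        · apply hnd
          have h1 : Q ^ (v + 1) * Q ∣ Q ^ (v + 1) * c := by
            rw [← pow_succ]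
            refine (pow_dvd_pow Q (show v + 1 + 1 ≤ k by omega)).trans ?_
            have := hJ.1
            rw [hc, ← mul_assoc, ← pow_succ'] at this
            exact this
          exact hcanc _ _ _ h1
      · exact hJ.2 (hQ.pow_dvd_of_dvd_mul_left k hQP hJ.1)
    · intro h
      exfalso
      apply h
      rw [Finset.mem_sdiff, mem_divs hPL, mem_divs hL']
      constructor
      · rw [hc, pow_succ', ]
        exact mul_dvd_mul_left P (dvd_mul_right _ _)
      · intro h1
        rw [hc, pow_succ] at h1
        exact hnd (hcanc _ _ _ h1)

variable (K)

lemma rK_conv (n : ℕ) (hn : n ≠ 0) :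
    (rK K n : ℝ) * Real.log n = ∑ p ∈ n.divisorsAntidiagonal, (rK K p.1 : ℝ) * lamK K p.2 := by
  classical
  have h1 : (rK K n : ℝ) * Real.log n = ∑ L ∈ nI K n, ∑ J ∈ divs L, vM K J := by
    rw [rK_eq, ← nsmul_eq_mul, ← Finset.sum_const]
    refine Finset.sum_congr rfl fun L hL => ?_
    rw [mem_nI] at hL
    rw [sum_divs L, hL]
    rintro rfl
    simp at hL
    exact hn hL.symm
  have h2 : ∀ p : ℕ × ℕ, (rK K p.1 : ℝ) * lamK K p.2 =
      ∑ x ∈ nI K p.1 ×ˢ nI K p.2, vM K x.2 := by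
    intro p
    rw [Finset.sum_product, rK_eq, ← nsmul_eq_mul, ← Finset.sum_const]
    rfl
  rw [h1, Finset.sum_congr rfl fun p _ => h2 p, Finset.sum_sigma', Finset.sum_sigma']
  have hne : ∀ L ∈ nI K n, L ≠ 0 := by
    rintro L hL rfl
    rw [mem_nI] at hL
    simp at hL
    exact hn hL.symm
  symm
  refine Finset.sum_bij (fun x _ => ⟨x.2.1 * x.2.2, x.2.2⟩) ?_ ?_ ?_ ?_
  · rintro ⟨⟨a, b⟩, ⟨I, J⟩⟩ h
    simp only [Finset.mem_sigma, Finset.mem_product, mem_nI, Nat.mem_divisorsAntidiagonal] at h ⊢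
    have hIJ : Ideal.absNorm (I * J) = n := by rw [map_mul, h.2.1, h.2.2, h.1.1]
    refine ⟨hIJ, ?_⟩
    rw [mem_divs (hne _ (mem_nI.mpr hIJ))]
    exact dvd_mul_left _ _
  · rintro ⟨⟨a, b⟩, ⟨I, J⟩⟩ h ⟨⟨a', b'⟩, ⟨I', J'⟩⟩ h' he
    simp only [Finset.mem_sigma, Finset.mem_product, mem_nI, Nat.mem_divisorsAntidiagonal] at h h'
    simp only [Sigma.mk.injEq, heq_eq_eq] at he
    obtain ⟨he1, rfl⟩ := he
    have hJ : J ≠ 0 := by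
      rintro rfl
      apply h.1.2
      rw [← h.1.1, ← h.2.2]; simp
    have : I = I' := mul_right_cancel₀ hJ he1
    subst this
    obtain ⟨_, rfl, rfl⟩ := h
    obtain ⟨_, rfl, rfl⟩ := h'
    rfl
  · rintro ⟨L, J⟩ h
    simp only [Finset.mem_sigma] at h
    have hL := hne L h.1
    obtain ⟨I, rfl⟩ := (mem_divs hL).mp h.2
    refine ⟨⟨(Ideal.absNorm I, Ideal.absNorm J), (I, J)⟩, ?_, ?_⟩
    · simp only [Finset.mem_sigma, Finset.mem_product, mem_nI, Nat.mem_divisorsAntidiagonal]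
      have := mem_nI.mp h.1
      rw [map_mul, mul_comm] at this
      exact ⟨⟨this, hn⟩, trivial, trivial⟩
    · simp [mul_comm]
  · intros; rfl

lemma lamK_nonneg (n : ℕ) : 0 ≤ lamK K n := Finset.sum_nonneg fun I _ => vM_nonneg I

lemma lamK_one : lamK K 1 = 0 := by
  refine Finset.sum_eq_zero fun J hJ => ?_
  rw [mem_nI, Ideal.absNorm_eq_one_iff] at hJ
  rw [vM, if_neg]
  intro hp
  exact hp.not_isUnit (by rw [hJ]; simp)

lemma lamK_prime (p : ℕ) (hp : p.Prime) : lamK K p = rK K p * Real.log p := by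
  rw [rK_eq, ← nsmul_eq_mul, ← Finset.sum_const]
  refine Finset.sum_congr rfl fun P hP => ?_
  rw [mem_nI] at hP
  have hP0 : P ≠ ⊥ := by
    rintro rfl
    simp at hP
    exact hp.ne_zero hP.symm
  have h1 : P.IsPrime := Ideal.isPrime_of_irreducible_absNorm (by rw [hP]; exact hp)
  have h2 : Prime P := Ideal.prime_of_isPrime hP0 h1
  have := vM_pow P h2 1 one_ne_zero
  rw [pow_one, hP] at this
  exact this

lemma lamK_le (n : ℕ) : lamK K n ≤ Module.finrank ℚ K * ArithmeticFunction.vonMangoldt n := by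
  classical
  by_cases hex : ∃ I ∈ nI K n, IsPrimePow I
  swap
  · push Not at hex
    have : lamK K n = 0 := Finset.sum_eq_zero fun J hJ => by rw [vM, if_neg (hex J hJ)]
    rw [this]
    exact mul_nonneg (Nat.cast_nonneg _) ArithmeticFunction.vonMangoldt_nonneg
  obtain ⟨I, hI, P, k, hP, hk, rfl⟩ := hex
  have hP : Prime P := hP
  rw [mem_nI] at hI
  have hPprime := Ideal.isPrime_of_prime hP
  -- n is a prime power
  obtain ⟨p, hp, f, hf, hNP⟩ : ∃ p : ℕ, p.Prime ∧ ∃ f : ℕ, f ≠ 0 ∧ Ideal.absNorm P = p ^ f := by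
    have h := Ideal.absNorm_ne_zero_iff P
    have hne : Ideal.absNorm P ≠ 0 := fun h => hP.ne_zero (Ideal.absNorm_eq_zero_iff.mp h)
    haveI := h.mp hne
    haveI : Fintype (𝓞 K ⧸ P) := Fintype.ofFinite _
    letI : P.IsMaximal := hPprime.isMaximal hP.ne_zero
    letI : Field (𝓞 K ⧸ P) := Ideal.Quotient.field P
    obtain ⟨p, hp, f, hc⟩ := FiniteField.card' (𝓞 K ⧸ P)
    refine ⟨p, hc.1, f, f.ne_zero, ?_⟩
    rw [Ideal.absNorm_apply, Submodule.cardQuot_apply, Nat.card_eq_fintype_card]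
    exact hc.2
  have hn : n = p ^ (f * k) := by rw [← hI, map_pow, hNP, pow_mul]
  have hL : ArithmeticFunction.vonMangoldt n = Real.log p := by
    rw [hn, ArithmeticFunction.vonMangoldt_apply_pow (mul_ne_zero hf hk.ne'),
      ArithmeticFunction.vonMangoldt_apply_prime hp]
  rw [hL]
  -- the sum over primes
  set A := (nI K n).filter (fun I => IsPrimePow I) with hA
  have h1 : lamK K n = ∑ I ∈ A, Real.log (Ideal.absNorm I.radical) := by
    rw [lamK, hA, Finset.sum_filter]
    rfl
  have hAP : ∀ I ∈ A, ∃ Q : Ideal (𝓞 K), ∃ j : ℕ, Prime Q ∧ j ≠ 0 ∧ Q ^ j = I ∧ I.radical = Q := by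
    intro I hI
    obtain ⟨Q, j, hQ, hj, rfl⟩ := (Finset.mem_filter.mp hI).2
    have hQ : Prime Q := hQ
    exact ⟨Q, j, hQ, hj.ne', rfl, by
      rw [Ideal.radical_pow Q hj.ne', (Ideal.isPrime_of_prime hQ).radical]⟩
  have hinj : Set.InjOn (fun I : Ideal (𝓞 K) => I.radical) A := by
    intro I hI J hJ he
    obtain ⟨Q, j, hQ, hj, h1, h2⟩ := hAP I hI
    obtain ⟨Q', j', hQ', hj', h1', h2'⟩ := hAP J hJ
    have he' : Q = Q' := by rw [← h2, ← h2']; exact he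
    subst he'
    have hnI := mem_nI.mp (Finset.mem_filter.mp (Finset.mem_coe.mp hI)).1
    have hnJ := mem_nI.mp (Finset.mem_filter.mp (Finset.mem_coe.mp hJ)).1
    rw [← h1, map_pow] at hnI
    rw [← h1', map_pow] at hnJ
    have h2 : 1 < Ideal.absNorm Q := by
      have a0 : Ideal.absNorm Q ≠ 0 := fun h => hQ.ne_zero (Ideal.absNorm_eq_zero_iff.mp h)
      have a1 : Ideal.absNorm Q ≠ 1 := fun h => hQ.not_isUnit
        (Ideal.isUnit_iff.mpr (Ideal.absNorm_eq_one_iff.mp h))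
      omega
    have : j = j' := Nat.pow_right_injective h2 (hnI.trans hnJ.symm)
    rw [← h1, ← h1', this]
  have h2 : lamK K n = ∑ Q ∈ A.image (fun I => I.radical), Real.log (Ideal.absNorm Q) := by
    rw [h1, Finset.sum_image hinj]
  set B := A.image (fun I : Ideal (𝓞 K) => I.radical) with hB
  have hBP : ∀ Q ∈ B, Prime Q ∧ Q ∣ Ideal.span {(p : 𝓞 K)} := by
    intro Q hQ
    obtain ⟨I, hI, rfl⟩ := Finset.mem_image.mp hQ
    obtain ⟨Q, j, hQ, hj, h1, h2⟩ := hAP I hI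
    rw [h2]
    refine ⟨hQ, ?_⟩
    rw [Ideal.dvd_span_singleton]
    have h3 := Ideal.absNorm_mem Q
    have hprime := Ideal.isPrime_of_prime hQ
    have hnI := mem_nI.mp (Finset.mem_filter.mp hI).1
    rw [← h1, map_pow, hn] at hnI
    have h4 : ((Ideal.absNorm Q : ℕ) : 𝓞 K) ^ j ∈ Q := Ideal.pow_mem_of_mem _ h3 _ (Nat.pos_of_ne_zero hj)
    rw [← Nat.cast_pow, hnI, Nat.cast_pow] at h4
    exact hprime.mem_of_pow_mem _ h4
  have h3 : ∏ Q ∈ B, Q ∣ Ideal.span {(p : 𝓞 K)} := by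
    refine Finset.prod_primes_dvd _ (fun Q hQ => (hBP Q hQ).1) (fun Q hQ => (hBP Q hQ).2)
  have h4 := map_dvd Ideal.absNorm h3
  rw [map_prod] at h4
  have h5 : Ideal.absNorm (Ideal.span {(p : 𝓞 K)}) = p ^ Module.finrank ℚ K := by
    rw [Ideal.absNorm_span_singleton]
    have : (p : 𝓞 K) = algebraMap ℤ (𝓞 K) p := by simp
    rw [this, Algebra.norm_algebraMap]
    rw [NumberField.RingOfIntegers.rank]
    simp [Int.natAbs_pow]
  rw [h5] at h4
  have h6 := Nat.le_of_dvd (pow_pos hp.pos _) h4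
  have hB0 : ∀ Q ∈ B, (Ideal.absNorm Q : ℝ) ≠ 0 := by
    intro Q hQ
    have : Ideal.absNorm Q ≠ 0 := fun h => (hBP Q hQ).1.ne_zero (Ideal.absNorm_eq_zero_iff.mp h)
    exact_mod_cast this
  rw [h2, ← Real.log_prod hB0, ← Real.log_pow]
  refine Real.log_le_log ?_ (by exact_mod_cast h6)
  refine Finset.prod_pos fun Q hQ => lt_of_le_of_ne (Nat.cast_nonneg _) (hB0 Q hQ).symm

end

end DLB
end

section
open MeasureTheory Filter Topology Set NumberField

namespace DLB

section
variable (K : Type*) [Field K] [NumberField K]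

lemma rK_sum_tendsto : Tendsto (fun n : ℕ => (∑ k ∈ Finset.Icc 1 n, (rK K k : ℝ)) / (n : ℝ)) atTop
    (𝓝 (dedekindZeta_residue K)) := by
  refine ((NumberField.Ideal.tendsto_norm_le_div_atTop₀ K).comp
    tendsto_natCast_atTop_atTop).congr fun n ↦ ?_
  simp only [Function.comp_apply, Nat.cast_le, ← Nat.cast_sum]
  congr
  simp only [rK]
  rw [← add_left_inj 1, ← Ideal.card_norm_le_eq_card_norm_le_add_one,
    show Finset.Icc 1 n = Finset.Ioc 0 n from Finset.Icc_succ_left_eq_Ioc _ _,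
    show 1 = Nat.card {I : Ideal (𝓞 K) // Ideal.absNorm I = 0} by simp [Ideal.absNorm_eq_zero_iff],
    Finset.sum_Ioc_add_eq_sum_Icc (n.zero_le),
    ← Finset.card_preimage_eq_sum_card_image_eq (fun k _ ↦ Ideal.finite_setOfPred_absNorm_eq k)]
  simp [Set.coe_eq_subtype]

lemma rK_summable (s : ℂ) (hs : 1 < s.re) :
    LSeriesSummable (fun n => ((rK K n : ℝ) : ℂ)) s := by
  refine LSeriesSummable_of_sum_norm_bigO_and_nonneg (f := fun n => (rK K n : ℝ)) ?_
    (fun n => Nat.cast_nonneg _) zero_le_one hs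
  exact Asymptotics.isBigO_atTop_natCast_rpow_of_tendsto_div_rpow (a := dedekindZeta_residue K)
    (by simpa using rK_sum_tendsto K)

lemma rK_residue : Tendsto (fun s : ℝ ↦ ((s : ℂ) - 1) * LSeries (fun n => ((rK K n : ℝ) : ℂ)) s)
    (𝓝[>] 1) (𝓝 (dedekindZeta_residue K)) :=
  LSeries_tendsto_sub_mul_nhds_one_of_tendsto_sum_div_and_nonneg (fun n => (rK K n : ℝ))
    (rK_sum_tendsto K) (fun n => Nat.cast_nonneg _)

lemma rK_Z (T : ℝ) (hT : 0 < T) : ∃ Z : ℂ → ℂ,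
      (∀ s : ℂ, 1 - (1 : ℝ) / Module.finrank ℚ K < s.re → |s.im| ≤ T → DifferentiableAt ℂ Z s) ∧
      (∀ s : ℂ, 1 < s.re → |s.im| ≤ T →
        Z s = (s - 1) * LSeries (fun n => ((rK K n : ℝ) : ℂ)) s) := by
  obtain ⟨h, a, b, hh, ha, hs, hne⟩ := mellin_bump_ne T hT
  obtain ⟨c, B, hcB⟩ := smooth_count K h hh a b ha hs
  have hd : (0 : ℝ) < (1 : ℝ) / Module.finrank ℚ K :=
    one_div_pos.mpr (by exact_mod_cast Module.finrank_pos)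
  obtain ⟨Z, hZd, hZs⟩ := mellin_cont h hh.continuous a b ha hs (fun n => (rK K n : ℝ))
    (fun n => Nat.cast_nonneg _) (rK_summable K) _ hd c B hcB
  refine ⟨fun s => Z s / mellin (fun t => (h t : ℂ)) s, fun s hs1 hsT => ?_, fun s hs1 hsT => ?_⟩
  · exact (hZd s hs1).div (h_diff h hh.continuous a b ha hs s) (hne s hsT)
  · simp only
    rw [hZs s hs1, mul_div_assoc, div_self (hne s hsT), mul_one]

open Classical in
lemma rK_Z2 (T : ℝ) (hT : 0 < T) : ∃ Z : ℂ → ℂ,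
      (∀ s : ℂ, 1 - (1 : ℝ) / Module.finrank ℚ K < s.re → |s.im| ≤ T → DifferentiableAt ℂ Z s) ∧
      (∀ s : ℂ, 1 < s.re → Z s = (s - 1) * LSeries (fun n => ((rK K n : ℝ) : ℂ)) s) ∧ Z 1 ≠ 0 := by
  obtain ⟨Z, hZd, hZs⟩ := rK_Z K (T + 1) (by linarith)
  have hd : (0 : ℝ) < (1 : ℝ) / Module.finrank ℚ K :=
    one_div_pos.mpr (by exact_mod_cast Module.finrank_pos)
  refine ⟨fun s => if 1 < s.re then (s - 1) * LSeries (fun n => ((rK K n : ℝ) : ℂ)) s else Z s,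
    fun s hs1 hsT => ?_, fun s hs1 => by simp [hs1], ?_⟩
  · refine (hZd s hs1 (by linarith)).congr_of_eventuallyEq ?_
    have hop : IsOpen {s : ℂ | |s.im| < T + 1} :=
      isOpen_lt (Complex.continuous_im.abs) continuous_const
    filter_upwards [hop.mem_nhds (show |s.im| < T + 1 by linarith)] with w hw
    split_ifs with h1
    · exact (hZs w h1 (le_of_lt hw)).symm
    · rfl
  · simp only [Complex.one_re, lt_irrefl, if_false]
    intro h0
    have h1 : ContinuousAt Z 1 := (hZd 1 (by simpa using hd) (by simp; linarith)).continuousAt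
    have h2 : ContinuousAt (fun x : ℝ => (x : ℂ)) 1 := by fun_prop
    have h3 : ContinuousAt (fun x : ℝ => Z x) 1 :=
      ContinuousAt.comp (f := fun x : ℝ => (x : ℂ)) (by simpa using h1) h2
    have h4 := h3.tendsto.mono_left (nhdsWithin_le_nhds (s := Ioi 1))
    have h5 : Tendsto (fun x : ℝ => Z x) (𝓝[>] 1) (𝓝 (dedekindZeta_residue K)) := by
      refine (rK_residue K).congr' ?_
      filter_upwards [self_mem_nhdsWithin] with x hx
      exact (hZs x (by simpa using hx) (by simp; linarith)).symm
    have h6 := tendsto_nhds_unique h4 h5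
    simp only [Complex.ofReal_one, h0] at h6
    exact dedekindZeta_residue_ne_zero K (by exact_mod_cast h6.symm)

lemma lamK_bound (N : ℕ) : ∑ k ∈ Finset.Icc 1 N, lamK K k ≤
    (Module.finrank ℚ K * (Real.log 4 + 4)) * N := by
  have h1 := Chebyshev.psi_le_const_mul_self (x := N) (Nat.cast_nonneg N)
  have h2 : ∑ k ∈ Finset.Icc 1 N, lamK K k ≤ Module.finrank ℚ K * Chebyshev.psi N := by
    rw [Chebyshev.psi, Nat.floor_natCast, Finset.mul_sum,
      show Finset.Icc 1 N = Finset.Ioc 0 N from Finset.Icc_succ_left_eq_Ioc _ _]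
    exact Finset.sum_le_sum fun k _ => lamK_le K k
  refine h2.trans ?_
  rw [mul_assoc]
  gcongr

theorem psiK_tendsto : Tendsto (fun x => psiS (lamK K) x / x) atTop (𝓝 1) :=
  wi (lamK K) (lamK_nonneg K) _ (lamK_bound K) (lamK_one K) (fun n => (rK K n : ℝ))
    (rK_summable K) (rK_conv K) _
    (one_div_pos.mpr (by exact_mod_cast Module.finrank_pos)) (rK_Z2 K)

lemma rK_le (p : ℕ) (hp : p.Prime) : (rK K p : ℝ) ≤ Module.finrank ℚ K := by
  have h := lamK_le K p
  rw [lamK_prime K p hp, ArithmeticFunction.vonMangoldt_apply_prime hp] at h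
  exact le_of_mul_le_mul_right h (Real.log_pos (by exact_mod_cast hp.one_lt))

/-- Chebyshev theta for `K`. -/
noncomputable def thK (n : ℕ) : ℝ := ∑ p ∈ Nat.primesLE n, (rK K p : ℝ) * Real.log p

lemma thK_tendsto : Tendsto (fun n : ℕ => thK K n / n) atTop (𝓝 1) := by
  have h1 := (psiK_tendsto K).comp tendsto_natCast_atTop_atTop (α := ℕ)
  have hdiff : ∀ n : ℕ, 0 ≤ psiS (lamK K) n - thK K n ∧ psiS (lamK K) n - thK K n ≤
      Module.finrank ℚ K * (Chebyshev.psi n - Chebyshev.theta n) := by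
    intro n
    have e : psiS (lamK K) n - thK K n = ∑ k ∈ Finset.Ioc 0 n with ¬ k.Prime, lamK K k := by
      have e1 : thK K n = ∑ k ∈ Finset.Ioc 0 n with k.Prime, lamK K k := by
        rw [thK]
        refine Finset.sum_congr ?_ fun p hp => ?_
        · ext p; simp [Nat.mem_primesLE]; exact fun hp _ => hp.pos
        · rw [lamK_prime K p (Finset.mem_filter.mp hp).2]
      rw [e1, psiS, Nat.floor_natCast,
        show Finset.Icc 1 n = Finset.Ioc 0 n from Finset.Icc_succ_left_eq_Ioc _ _,
        ← Finset.sum_filter_add_sum_filter_not (Finset.Ioc 0 n) Nat.Prime]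
      ring
    rw [e, Chebyshev.psi_sub_theta_eq_sum_not_prime, Nat.floor_natCast, Finset.mul_sum]
    exact ⟨Finset.sum_nonneg fun k _ => lamK_nonneg K k, Finset.sum_le_sum fun k _ => lamK_le K k⟩
  obtain ⟨C, hC⟩ := Chebyshev.psi_sub_theta_le_mul_sqrt
  have hz : Tendsto (fun n : ℕ => (psiS (lamK K) n - thK K n) / n) atTop (𝓝 0) := by
    have hu : Tendsto (fun n : ℕ => Module.finrank ℚ K * C * (Real.sqrt n)⁻¹) atTop (𝓝 0) := by
      have := (tendsto_inv_atTop_zero.comp (Real.tendsto_sqrt_atTop.comp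
        (tendsto_natCast_atTop_atTop (R := ℝ)))).const_mul (Module.finrank ℚ K * C)
      rw [mul_zero] at this
      exact this
    refine squeeze_zero' (Eventually.of_forall fun n => div_nonneg (hdiff n).1 (Nat.cast_nonneg n))
      ?_ hu
    filter_upwards [eventually_gt_atTop 0] with n hn
    have hn' : (0 : ℝ) < n := by exact_mod_cast hn
    rw [div_le_iff₀ hn', mul_assoc]
    have : (Real.sqrt n)⁻¹ * n = Real.sqrt n := by
      rw [inv_mul_eq_div, Real.div_sqrt]
    rw [this, mul_assoc]
    refine (hdiff n).2.trans ?_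
    gcongr
    exact hC n
  have := h1.sub hz
  rw [sub_zero] at this
  refine this.congr fun n => ?_
  simp only [Function.comp]
  ring

lemma card_primesLE (n : ℕ) : (Nat.primesLE n).card = Nat.primeCounting n := by
  rw [Nat.primesLE_card_eq_primeCounting]

lemma pi_theta : Tendsto (fun n : ℕ => (Nat.primeCounting n * Real.log n - Chebyshev.theta n) / n)
    atTop (𝓝 0) := by
  have h1 := Chebyshev.primeCounting_sub_theta_div_log_isBigO.comp_tendsto
    (tendsto_natCast_atTop_atTop (R := ℝ))
  obtain ⟨C, hC⟩ := h1.bound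
  have hu : Tendsto (fun n : ℕ => C * (Real.log n)⁻¹) atTop (𝓝 0) := by
    have := (tendsto_inv_atTop_zero.comp (Real.tendsto_log_atTop.comp
      (tendsto_natCast_atTop_atTop (R := ℝ)))).const_mul C
    rw [mul_zero] at this
    exact this
  refine squeeze_zero_norm' ?_ hu
  filter_upwards [hC, eventually_gt_atTop 1] with n hn hn1
  have hn' : (1 : ℝ) < n := by exact_mod_cast hn1
  have hl := Real.log_pos hn'
  simp only [Function.comp, Nat.floor_natCast, norm_div, norm_pow, Real.norm_natCast,
    Real.norm_of_nonneg hl.le] at hn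
  rw [norm_div, Real.norm_natCast, div_le_iff₀ (by linarith)]
  have e : (Nat.primeCounting n * Real.log n - Chebyshev.theta n) =
    (Nat.primeCounting n - Chebyshev.theta n / Real.log n) * Real.log n := by field_simp
  rw [e, norm_mul, Real.norm_of_nonneg hl.le]
  calc _ ≤ C * (n / Real.log n ^ 2) * Real.log n := by gcongr
    _ = _ := by field_simp

lemma aK_log : Tendsto (fun n : ℕ => (∑ p ∈ Nat.primesLE n, (rK K p : ℝ)) * Real.log n / n) atTop
    (𝓝 1) := by
  have hz : Tendsto (fun n : ℕ =>
      ((∑ p ∈ Nat.primesLE n, (rK K p : ℝ)) * Real.log n - thK K n) / n) atTop (𝓝 0) := by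
    have hu := pi_theta.const_mul (Module.finrank ℚ K : ℝ)
    rw [mul_zero] at hu
    have e : ∀ n : ℕ, (∑ p ∈ Nat.primesLE n, (rK K p : ℝ)) * Real.log n - thK K n =
        ∑ p ∈ Nat.primesLE n, (rK K p : ℝ) * (Real.log n - Real.log p) := by
      intro n
      rw [thK, Finset.sum_mul, ← Finset.sum_sub_distrib]
      exact Finset.sum_congr rfl fun p _ => by ring
    have hlog : ∀ n : ℕ, ∀ p ∈ Nat.primesLE n, 0 ≤ Real.log n - Real.log p := by
      intro n p hp
      rw [Nat.mem_primesLE] at hp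
      exact sub_nonneg.mpr (Real.log_le_log (by exact_mod_cast hp.2.pos) (by exact_mod_cast hp.1))
    refine squeeze_zero (fun n => ?_) (fun n => ?_) hu
    · rw [e]
      exact div_nonneg (Finset.sum_nonneg fun p hp =>
        mul_nonneg (Nat.cast_nonneg _) (hlog n p hp)) (Nat.cast_nonneg n)
    · rw [e, ← mul_div_assoc]
      gcongr
      have e2 : (Nat.primeCounting n : ℝ) * Real.log n = ∑ p ∈ Nat.primesLE n, Real.log n := by
        rw [Finset.sum_const, nsmul_eq_mul, card_primesLE]
      rw [e2, Chebyshev.theta_eq_sum_primesLE, Nat.floor_natCast, ← Finset.sum_sub_distrib, Finset.mul_sum]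
      refine Finset.sum_le_sum fun p hp => ?_
      exact mul_le_mul_of_nonneg_right (rK_le K p (Nat.mem_primesLE.mp hp).2) (hlog n p hp)
  have := (thK_tendsto K).add hz
  rw [add_zero] at this
  refine this.congr fun n => ?_
  ring

lemma rQ (p : ℕ) (hp : p.Prime) : rK ℚ p = 1 := by
  have h1 := rK_le ℚ p hp
  rw [Module.finrank_self, Nat.cast_one] at h1
  have h1 : rK ℚ p ≤ 1 := by exact_mod_cast h1
  have h5 : Ideal.absNorm (Ideal.span {(p : 𝓞 ℚ)}) = p := by
    rw [Ideal.absNorm_span_singleton]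
    have : (p : 𝓞 ℚ) = algebraMap ℤ (𝓞 ℚ) p := by simp
    rw [this, Algebra.norm_algebraMap]
    rw [NumberField.RingOfIntegers.rank]
    simp
  have h2 : 0 < rK ℚ p := by
    rw [rK_eq]
    exact Finset.card_pos.mpr ⟨_, mem_nI.mpr h5⟩
  omega

theorem aK_density : Tendsto (fun n : ℕ => (∑ p ∈ Nat.primesLE n, (rK K p : ℝ)) /
    Nat.primeCounting n) atTop (𝓝 1) := by
  have h1 := aK_log K
  have h2 := aK_log ℚ
  have h3 := h1.div h2 one_ne_zero
  rw [div_one] at h3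
  refine h3.congr' ?_
  filter_upwards [eventually_gt_atTop 1] with n hn1
  have hn' : (1 : ℝ) < n := by exact_mod_cast hn1
  have hl := Real.log_pos hn'
  have e : ∑ p ∈ Nat.primesLE n, (rK ℚ p : ℝ) = Nat.primeCounting n := by
    rw [← card_primesLE, Finset.card_eq_sum_ones, Nat.cast_sum]
    exact Finset.sum_congr rfl fun p hp => by rw [rQ p (Nat.mem_primesLE.mp hp).2]
  simp only [Pi.div_apply]
  rw [e]
  field_simp

end

end DLB
end

section
open MeasureTheory Filter Topology Set

namespace DLB

/-- `f` has mean value `a` along the primes. -/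
def MeanTo (f : ℕ → ℝ) (a : ℝ) : Prop :=
  Tendsto (fun n : ℕ => (∑ p ∈ Nat.primesLE n, f p) / Nat.primeCounting n) atTop (𝓝 a)

lemma MeanTo.add {f g : ℕ → ℝ} {a b : ℝ} (hf : MeanTo f a) (hg : MeanTo g b) :
    MeanTo (fun p => f p + g p) (a + b) := by
  refine (Tendsto.add hf hg).congr fun n => ?_
  rw [Finset.sum_add_distrib, add_div]

lemma MeanTo.smul {f : ℕ → ℝ} {a : ℝ} (c : ℝ) (hf : MeanTo f a) :
    MeanTo (fun p => c * f p) (c * a) := by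
  refine (Tendsto.const_mul c hf).congr fun n => ?_
  rw [← Finset.mul_sum, mul_div_assoc]

lemma MeanTo.sub {f g : ℕ → ℝ} {a b : ℝ} (hf : MeanTo f a) (hg : MeanTo g b) :
    MeanTo (fun p => f p - g p) (a - b) := by
  refine (Tendsto.sub hf hg).congr fun n => ?_
  rw [Finset.sum_sub_distrib, sub_div]

lemma MeanTo.zero : MeanTo (fun _ => 0) 0 := by
  simp [MeanTo]

lemma MeanTo.sum {ι : Type*} (s : Finset ι) {f : ι → ℕ → ℝ} {a : ι → ℝ}
    (h : ∀ i ∈ s, MeanTo (f i) (a i)) : MeanTo (fun p => ∑ i ∈ s, f i p) (∑ i ∈ s, a i) := by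
  classical
  induction s using Finset.induction_on with
  | empty => simpa using MeanTo.zero
  | insert i s hi ih =>
    simp only [Finset.sum_insert hi]
    exact (h i (Finset.mem_insert_self i s)).add
      (ih fun j hj => h j (Finset.mem_insert_of_mem hj))

/-- Changing `f` at primes dividing `N ≠ 0` does not matter. -/
lemma MeanTo.congr' {f g : ℕ → ℝ} {a : ℝ} (hf : MeanTo f a) (N : ℕ) (hN : N ≠ 0)
    (h : ∀ p : ℕ, p.Prime → ¬ p ∣ N → f p = g p) : MeanTo g a := by
  have hpi : Tendsto (fun n : ℕ => (Nat.primeCounting n : ℝ)) atTop atTop :=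
    tendsto_natCast_atTop_atTop.comp Nat.tendsto_primeCounting
  have key : Tendsto (fun n : ℕ => (∑ p ∈ Nat.primesLE n, (g p - f p)) / Nat.primeCounting n)
      atTop (𝓝 0) := by
    have : Tendsto (fun n : ℕ => (∑ p ∈ N.primeFactors, (g p - f p)) / Nat.primeCounting n)
      atTop (𝓝 0) := Tendsto.const_div_atTop hpi _
    refine this.congr' ?_
    filter_upwards [eventually_ge_atTop N] with n hn
    congr 1
    refine Finset.sum_subset (fun p hp => ?_) (fun p hp hp' => ?_)
    · rw [Nat.mem_primesLE]
      exact ⟨(Nat.le_of_mem_primeFactors hp).trans hn, Nat.prime_of_mem_primeFactors hp⟩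
    · rw [Nat.mem_primesLE] at hp
      rw [h p hp.2 (fun hd => hp' (Nat.mem_primeFactors.mpr ⟨hp.2, hd, hN⟩)), sub_self]
  have := Tendsto.add hf key
  rw [add_zero] at this
  refine this.congr fun n => ?_
  rw [← add_div, ← Finset.sum_add_distrib]
  congr 1
  exact Finset.sum_congr rfl fun p _ => by ring

section grp
variable {G : Type*} [Group G] [Fintype G]
open Classical

/-- Number of conjugates of `σ` generating `D`. -/
noncomputable def ED (D : Subgroup G) (σ : G) : ℕ :=
  (Finset.univ.filter fun g : G => Subgroup.zpowers (g⁻¹ * σ * g) = D).card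

noncomputable def eD (D : Subgroup G) : ℕ :=
  (Finset.univ.filter fun g : G => Subgroup.zpowers g = D).card

lemma card_by_zpowers (f : G → G) (A : Set G)
    (hA : ∀ x y : G, Subgroup.zpowers x = Subgroup.zpowers y → x ∈ A → y ∈ A) :
    (Finset.univ.filter fun g : G => f g ∈ A).card =
      ∑ D ∈ Finset.univ.filter (fun D : Subgroup G => ∃ x ∈ A, Subgroup.zpowers x = D),
        (Finset.univ.filter fun g : G => Subgroup.zpowers (f g) = D).card := by
  rw [Finset.card_eq_sum_card_fiberwise (f := fun g => Subgroup.zpowers (f g))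
    (t := Finset.univ.filter (fun D : Subgroup G => ∃ x ∈ A, Subgroup.zpowers x = D))]
  · refine Finset.sum_congr rfl fun D hD => ?_
    congr 1
    ext g
    simp only [Finset.mem_filter, Finset.mem_univ, true_and] at hD ⊢
    obtain ⟨x, hx, rfl⟩ := hD
    exact ⟨fun h => h.2, fun h => ⟨hA _ _ h.symm hx, h⟩⟩
  · intro g hg
    simp only [Finset.coe_filter, Finset.mem_univ, true_and, Set.mem_ofPred_eq] at hg ⊢
    exact ⟨f g, hg, rfl⟩

lemma sub_closed (H : Subgroup G) (x y : G) (h : Subgroup.zpowers x = Subgroup.zpowers y)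
    (hx : x ∈ (H : Set G)) : y ∈ (H : Set G) := by
  have : Subgroup.zpowers x ≤ H := by rwa [Subgroup.zpowers_le]
  rw [h, Subgroup.zpowers_le] at this
  exact this

lemma ED_mean (φ : ℕ → G)
    (h : ∀ H : Subgroup G, MeanTo (fun p =>
      ((Finset.univ.filter fun g : G => g⁻¹ * φ p * g ∈ (H : Set G)).card : ℝ)) (Nat.card H))
    (D : Subgroup G) : MeanTo (fun p => (ED D (φ p) : ℝ)) (eD D) := by
  induction D using WellFoundedLT.induction with
  | ind H ih =>
  set s := (Finset.univ.filter
    (fun D : Subgroup G => ∃ x ∈ (H : Set G), Subgroup.zpowers x = D)) with hs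
  by_cases hc : H ∈ s
  · have h1 := (h H).sub (MeanTo.sum (s.erase H) (f := fun D p => (ED D (φ p) : ℝ))
      (a := fun D => (eD D : ℝ)) (fun D hD => by
        obtain ⟨hne, hm⟩ := Finset.mem_erase.mp hD
        obtain ⟨x, hx, rfl⟩ := (Finset.mem_filter.mp hm).2
        exact ih _ (lt_of_le_of_ne (by rwa [Subgroup.zpowers_le]) hne)))
    have e1 : ∀ p, ((Finset.univ.filter fun g : G => g⁻¹ * φ p * g ∈ (H : Set G)).card : ℝ) -
        ∑ D ∈ s.erase H, (ED D (φ p) : ℝ) = ED H (φ p) := by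
      intro p
      rw [card_by_zpowers (fun g => g⁻¹ * φ p * g) H (sub_closed H), ← hs,
        ← Finset.add_sum_erase s _ hc]
      push_cast
      simp only [ED]
      ring
    have e2 : (Nat.card H : ℝ) - ∑ D ∈ s.erase H, (eD D : ℝ) = eD H := by
      have : Nat.card H = (Finset.univ.filter fun g : G => (fun x : G => x) g ∈ (H : Set G)).card := by
        rw [Nat.card_eq_fintype_card, Fintype.card_subtype]
        rfl
      rw [this, card_by_zpowers (fun x : G => x) (H : Set G) (sub_closed H), ← hs, ← Finset.add_sum_erase s _ hc]
      push_cast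
      simp only [eD]
      ring
    rw [e2] at h1
    simp only [e1] at h1
    exact h1
  · have hn : ∀ x, Subgroup.zpowers x ≠ H := fun x hx =>
      hc (Finset.mem_filter.mpr ⟨Finset.mem_univ _, x, by rw [← hx]; exact Subgroup.mem_zpowers x, hx⟩)
    have e1 : ∀ σ, ED H σ = 0 := fun σ => by simp [ED, hn]
    have e2 : eD H = 0 := by simp [eD, hn]
    simp only [e1, e2, Nat.cast_zero]
    exact MeanTo.zero

theorem grp_density (φ : ℕ → G)
    (h : ∀ H : Subgroup G, MeanTo (fun p =>
      ((Finset.univ.filter fun g : G => g⁻¹ * φ p * g ∈ (H : Set G)).card : ℝ)) (Nat.card H))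
    (A : Set G) (hA : ∀ x y : G, Subgroup.zpowers x = Subgroup.zpowers y → x ∈ A → y ∈ A)
    (hc : ∀ g x : G, x ∈ A → g * x * g⁻¹ ∈ A) :
    MeanTo (fun p => if φ p ∈ A then 1 else 0) ((Finset.univ.filter fun g => g ∈ A).card / Fintype.card G) := by
  have h1 := MeanTo.smul (Fintype.card G : ℝ)⁻¹ (MeanTo.sum
    (Finset.univ.filter (fun D : Subgroup G => ∃ x ∈ A, Subgroup.zpowers x = D))
    (fun D _ => ED_mean φ h D))
  have e2 := card_by_zpowers (fun x : G => x) A hA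
  have e1 := fun σ : G => card_by_zpowers (fun g => g⁻¹ * σ * g) A hA
  have hG : (Fintype.card G : ℝ) ≠ 0 := by exact_mod_cast Fintype.card_ne_zero
  have e3 : ∀ σ : G, ((Finset.univ.filter fun g : G => g⁻¹ * σ * g ∈ A).card : ℝ) =
      if σ ∈ A then (Fintype.card G : ℝ) else 0 := by
    intro σ
    split_ifs with hs
    · rw [Finset.filter_true_of_mem, Finset.card_univ]
      intro g _
      simpa using hc g⁻¹ σ hs
    · rw [Finset.filter_false_of_mem, Finset.card_empty, Nat.cast_zero]
      intro g _ hg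
      apply hs
      have := hc g _ hg
      simpa [mul_assoc] using this
  have e4 : ((Finset.univ.filter fun g => g ∈ A).card : ℝ) / Fintype.card G =
     (Fintype.card G : ℝ)⁻¹ * ∑ D ∈ Finset.univ.filter (fun D : Subgroup G => ∃ x ∈ A, Subgroup.zpowers x = D), (eD D : ℝ) := by
    rw [e2, div_eq_inv_mul]
    push_cast
    rfl
  rw [e4]
  convert h1 using 1
  funext p
  have e5 : ∑ D ∈ Finset.univ.filter (fun D : Subgroup G => ∃ x ∈ A, Subgroup.zpowers x = D), (ED D (φ p) : ℝ)
    = ((Finset.univ.filter fun g : G => g⁻¹ * φ p * g ∈ A).card : ℝ) := by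
    rw [e1]
    push_cast
    rfl
  rw [e5, e3]
  split_ifs
  · field_simp
  · simp

end grp

end DLB
end

section
open MeasureTheory Filter Topology Set NumberField

namespace DLB

lemma zmod_cast_int {k : Type*} [CommRing k] (p : ℕ) [CharP k p] [NeZero p] (a : ZMod p) :
    ∃ b : ℤ, ZMod.castHom dvd_rfl k a = b := by
  refine ⟨(a.val : ℤ), ?_⟩
  conv_lhs => rw [← ZMod.natCast_zmod_val a]
  simp

open Polynomial in
lemma frob_fixed {k : Type*} [CommRing k] [IsDomain k] (p : ℕ) (hp : p.Prime)
    (h0 : (p : k) = 0) (x : k) (hx : x ^ p = x) : ∃ a : ℤ, x = a := by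
  have : Fact p.Prime := ⟨hp⟩
  have : CharP k p := (CharP.charP_iff_prime_eq_zero hp).mpr h0
  have h1 := ((GaloisField.splits_zmod_X_pow_sub_X p).roots_map_of_injective
    (ZMod.castHom dvd_rfl k : ZMod p →+* k).injective)
  have h2 : x ∈ ((X ^ p - X : (ZMod p)[X]).map (ZMod.castHom dvd_rfl k : ZMod p →+* k)).roots := by
    rw [mem_roots]
    · simp [hx]
    · rw [Polynomial.map_ne_zero_iff (RingHom.injective _)]
      exact FiniteField.X_pow_card_sub_X_ne_zero _ hp.one_lt
  rw [h1, Multiset.mem_map] at h2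
  obtain ⟨a, _, rfl⟩ := h2
  exact zmod_cast_int p a

variable (K : Type*) [Field K] [NumberField K]

lemma norm_iff (I : Ideal (𝓞 K)) (p : ℕ) (hp : p.Prime) :
    Ideal.absNorm I = p ↔ (p : 𝓞 K) ∈ I ∧ I ≠ ⊤ ∧ ∀ y : 𝓞 K, ∃ a : ℤ, y - a ∈ I := by
  have : Fact p.Prime := ⟨hp⟩
  have hq : ∀ (h0 : (p : 𝓞 K) ∈ I) (h1 : I ≠ ⊤), CharP (𝓞 K ⧸ I) p := by
    intro h0 h1
    have : Nontrivial (𝓞 K ⧸ I) := Ideal.Quotient.nontrivial_iff.mpr h1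
    refine (CharP.charP_iff_prime_eq_zero hp).mpr ?_
    have := Ideal.Quotient.eq_zero_iff_mem.mpr h0
    simpa using this
  constructor
  · intro h
    have h0 : (p : 𝓞 K) ∈ I := by rw [← h]; exact Ideal.absNorm_mem I
    have h1 : I ≠ ⊤ := by
      rintro rfl
      rw [Ideal.absNorm_top] at h
      exact hp.one_lt.ne h
    refine ⟨h0, h1, fun y => ?_⟩
    have := hq h0 h1
    have hc : Nat.card (𝓞 K ⧸ I) = p := by rw [← h, Ideal.absNorm_apply]; rfl
    have : Finite (𝓞 K ⧸ I) := Nat.finite_of_card_ne_zero (by rw [hc]; exact hp.ne_zero)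
    letI := Fintype.ofFinite (𝓞 K ⧸ I)
    have hb := ZMod.castHom_bijective (n := p) (𝓞 K ⧸ I) (by rw [← Nat.card_eq_fintype_card, hc])
    obtain ⟨a, ha⟩ := hb.2 (Ideal.Quotient.mk I y)
    obtain ⟨b, hb⟩ := zmod_cast_int (k := 𝓞 K ⧸ I) p a
    refine ⟨b, ?_⟩
    rw [← Ideal.Quotient.eq, ← ha, hb]
    simp
  · rintro ⟨h0, h1, h2⟩
    have := hq h0 h1
    have : Nontrivial (𝓞 K ⧸ I) := Ideal.Quotient.nontrivial_iff.mpr h1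
    have hb : Function.Bijective (ZMod.castHom dvd_rfl (𝓞 K ⧸ I) : ZMod p →+* _) := by
      refine ⟨RingHom.injective _, fun y => ?_⟩
      obtain ⟨y, rfl⟩ := Ideal.Quotient.mk_surjective y
      obtain ⟨a, ha⟩ := h2 y
      refine ⟨a, ?_⟩
      rw [← Ideal.Quotient.eq] at ha
      rw [ha]
      simp
    have := Nat.card_congr (Equiv.ofBijective _ hb)
    rw [Nat.card_zmod] at this
    rw [Ideal.absNorm_apply, this]
    rfl

section
variable (L : Type*) [Field L] [NumberField L]

lemma int_mem (Q : Ideal (𝓞 L)) (hQ : Q.IsPrime) (p : ℕ) (hp : p.Prime) (hpQ : (p : 𝓞 L) ∈ Q)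
    (n : ℤ) : (n : 𝓞 L) ∈ Q ↔ (p : ℤ) ∣ n := by
  constructor
  · intro hn
    by_contra hd
    have hc : IsCoprime (p : ℤ) n :=
      ((Nat.prime_iff_prime_int.mp hp).irreducible.coprime_iff_not_dvd).mpr hd
    obtain ⟨a, b, hab⟩ := hc
    apply hQ.ne_top
    rw [Ideal.eq_top_iff_one]
    have : (1 : 𝓞 L) = a * p + b * n := by exact_mod_cast hab.symm
    rw [this]
    exact Q.add_mem (Q.mul_mem_left _ hpQ) (Q.mul_mem_left _ hn)
  · rintro ⟨c, rfl⟩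
    push_cast
    exact Q.mul_mem_right _ hpQ

lemma bad_fin {ι : Type*} [Finite ι] (z : ι → 𝓞 L) (hz : ∀ i, z i ≠ 0) :
    ∃ N : ℕ, N ≠ 0 ∧ ∀ p : ℕ, p.Prime → ¬ p ∣ N → ∀ Q : Ideal (𝓞 L), Q.IsPrime →
      (p : 𝓞 L) ∈ Q → ∀ i, z i ∉ Q := by
  letI := Fintype.ofFinite ι
  refine ⟨∏ i, Ideal.absNorm (Ideal.span {z i}), ?_, ?_⟩
  · rw [Finset.prod_ne_zero_iff]
    intro i _
    rw [Ne, Ideal.absNorm_eq_zero_iff]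
    simpa using hz i
  · intro p hp hN Q hQ hpQ i hi
    apply hN
    have h1 : ((Ideal.absNorm (Ideal.span {z i}) : ℤ) : 𝓞 L) ∈ Q := by
      have := Ideal.absNorm_mem (Ideal.span {z i})
      have h2 : Ideal.span {z i} ≤ Q := by rwa [Ideal.span_singleton_le_iff_mem]
      simpa using h2 this
    rw [int_mem L Q hQ p hp hpQ] at h1
    exact (Int.natCast_dvd_natCast.mp h1).trans (Finset.dvd_prod_of_mem _ (Finset.mem_univ i))

lemma ne_bot_of (Q : Ideal (𝓞 L)) (p : ℕ) (hp : p.Prime) (hpQ : (p : 𝓞 L) ∈ Q) : Q ≠ ⊥ := by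
  rintro rfl
  rw [Ideal.mem_bot] at hpQ
  exact hp.ne_zero (by exact_mod_cast hpQ)

lemma under_eq (Q : Ideal (𝓞 L)) (hQ : Q.IsPrime) (p : ℕ) (hp : p.Prime) (hpQ : (p : 𝓞 L) ∈ Q) :
    Q.under ℤ = Ideal.span {(p : ℤ)} := by
  ext n
  rw [Ideal.under_def, Ideal.mem_comap, Ideal.mem_span_singleton, ← int_mem L Q hQ p hp hpQ]
  simp

lemma exists_Q (p : ℕ) (hp : p.Prime) : ∃ Q : Ideal (𝓞 L), Q.IsPrime ∧ (p : 𝓞 L) ∈ Q := by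
  have h : Ideal.span {(p : 𝓞 L)} ≠ ⊤ := by
    intro h
    have h1 := Ideal.absNorm_eq_one_iff.mpr h
    have h5 : (p : 𝓞 L) = algebraMap ℤ (𝓞 L) p := by simp
    rw [Ideal.absNorm_span_singleton, h5, Algebra.norm_algebraMap, Int.natAbs_pow, Int.natAbs_natCast,
      Nat.pow_eq_one] at h1
    rcases h1 with h1 | h1
    · exact hp.one_lt.ne' h1
    · rw [NumberField.RingOfIntegers.rank] at h1
      exact Module.finrank_pos.ne' h1
  obtain ⟨Q, hQ, hle⟩ := Ideal.exists_le_maximal _ h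
  exact ⟨Q, hQ.isPrime, hle (Ideal.mem_span_singleton_self _)⟩

variable [IsGalois ℚ L]

lemma exists_frob (Q : Ideal (𝓞 L)) (hQ : Q.IsPrime) (p : ℕ) (hp : p.Prime)
    (hpQ : (p : 𝓞 L) ∈ Q) : ∃ σ : L ≃ₐ[ℚ] L, ∀ x : 𝓞 L, σ • x - x ^ p ∈ Q := by
  have : Finite (𝓞 L ⧸ Q) := Ideal.finiteQuotientOfFreeOfNeBot Q (ne_bot_of L Q p hp hpQ)
  obtain ⟨σ, hσ⟩ := IsArithFrobAt.exists_of_isInvariant ℤ (L ≃ₐ[ℚ] L) Q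
  refine ⟨σ, fun x => ?_⟩
  have := hσ x
  rw [under_eq L Q hQ p hp hpQ] at this
  have hc : Nat.card (ℤ ⧸ Ideal.span {(p : ℤ)}) = p := by
    rw [Nat.card_congr (Int.quotientSpanNatEquivZMod p).toEquiv, Nat.card_zmod]
  rw [hc] at this
  exact this

/-- Elements fixed by the Frobenius mod `Q` are congruent to integers. -/
lemma fixed_int (Q : Ideal (𝓞 L)) (hQ : Q.IsPrime) (p : ℕ) (hp : p.Prime)
    (hpQ : (p : 𝓞 L) ∈ Q) (σ : L ≃ₐ[ℚ] L) (hσ : ∀ x : 𝓞 L, σ • x - x ^ p ∈ Q) (z : 𝓞 L) :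
    σ • z - z ∈ Q ↔ ∃ a : ℤ, z - a ∈ Q := by
  have hpq : ((p : ℕ) : 𝓞 L ⧸ Q) = 0 := by
    simpa using Ideal.Quotient.eq_zero_iff_mem.mpr hpQ
  have h1 := Ideal.Quotient.eq.mpr (hσ z)
  rw [map_pow] at h1
  constructor
  · intro h
    have h := Ideal.Quotient.eq.mpr h
    obtain ⟨a, ha⟩ := frob_fixed p hp hpq (Ideal.Quotient.mk Q z) (by rw [← h1, h])
    refine ⟨a, Ideal.Quotient.eq.mp ?_⟩
    rw [ha]; simp
  · rintro ⟨a, ha⟩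
    have h2 := Ideal.Quotient.eq.mpr ha
    refine Ideal.Quotient.eq.mp ?_
    rw [h1, h2, ← map_pow, Ideal.Quotient.eq]
    have h3 : (((a ^ p - a : ℤ)) : 𝓞 L) ∈ Q := by
      rw [int_mem L Q hQ p hp hpQ]
      have : Fact p.Prime := ⟨hp⟩
      rw [← ZMod.intCast_zmod_eq_zero_iff_dvd] 
      push_cast
      rw [ZMod.pow_card, sub_self]
    push_cast at h3
    exact h3

end

end DLB
end

section
open MeasureTheory Filter Topology Set NumberField IntermediateField

namespace DLB
variable (L : Type*) [Field L] [NumberField L] [IsGalois ℚ L]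

lemma exists_y (H : Subgroup (L ≃ₐ[ℚ] L)) (τ : L ≃ₐ[ℚ] L) (hτ : τ ∉ H) :
    ∃ y : 𝓞 (fixedField H), τ • (algebraMap (𝓞 (fixedField H)) (𝓞 L) y) ≠
      algebraMap (𝓞 (fixedField H)) (𝓞 L) y := by
  by_contra! hc
  apply hτ
  rw [← fixingSubgroup_fixedField H, IntermediateField.mem_fixingSubgroup_iff]
  intro x hx
  obtain ⟨a, b, hb, hab⟩ := IsFractionRing.div_surjective (A := 𝓞 (fixedField H))
    (⟨x, hx⟩ : fixedField H)
  have key : ∀ a : 𝓞 (fixedField H), τ ((a : fixedField H) : L) = ((a : fixedField H) : L) := by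
    intro a
    exact congrArg (fun z : 𝓞 L => (z : L)) (hc a)
  have hx : x = ((a : fixedField H) : L) / ((b : fixedField H) : L) := by
    exact congrArg (fun z : fixedField H => (z : L)) hab.symm
  rw [hx, map_div₀, key, key]

lemma smul_alg (H : Subgroup (L ≃ₐ[ℚ] L)) (h : L ≃ₐ[ℚ] L) (hh : h ∈ H) (y : 𝓞 (fixedField H)) :
    h • (algebraMap (𝓞 (fixedField H)) (𝓞 L) y) = algebraMap (𝓞 (fixedField H)) (𝓞 L) y := by
  apply RingOfIntegers.ext
  exact (y : fixedField H).2 ⟨h, hh⟩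

/-- `N` avoids all bad primes for subgroup detection. -/
lemma good_sub : ∃ N : ℕ, N ≠ 0 ∧ ∀ p : ℕ, p.Prime → ¬ p ∣ N → ∀ Q : Ideal (𝓞 L), Q.IsPrime →
      (p : 𝓞 L) ∈ Q → ∀ (H : Subgroup (L ≃ₐ[ℚ] L)) (g τ : L ≃ₐ[ℚ] L), τ ∉ H →
      ∃ y : 𝓞 (fixedField H), g • (τ • (algebraMap (𝓞 (fixedField H)) (𝓞 L) y) -
        algebraMap (𝓞 (fixedField H)) (𝓞 L) y) ∉ Q := by
  obtain ⟨N, hN, h⟩ := bad_fin L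
    (fun i : {i : Subgroup (L ≃ₐ[ℚ] L) × (L ≃ₐ[ℚ] L) × (L ≃ₐ[ℚ] L) // i.2.2 ∉ i.1} =>
      i.1.2.1 • (i.1.2.2 • (algebraMap (𝓞 (fixedField i.1.1)) (𝓞 L) (exists_y L i.1.1 i.1.2.2 i.2).choose) -
        algebraMap (𝓞 (fixedField i.1.1)) (𝓞 L) (exists_y L i.1.1 i.1.2.2 i.2).choose)) (by
      rintro ⟨⟨H, g, τ⟩, hτ⟩
      rw [Ne, smul_eq_zero_iff_eq, sub_eq_zero]
      exact (exists_y L H τ hτ).choose_spec)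
  exact ⟨N, hN, fun p hp hd Q hQ hpQ H g τ hτ => ⟨_, h p hp hd Q hQ hpQ ⟨⟨H, g, τ⟩, hτ⟩⟩⟩

/-- the ideal `{y : g y ∈ Q}` -/
noncomputable def Ig (Q : Ideal (𝓞 L)) (H : Subgroup (L ≃ₐ[ℚ] L)) (g : L ≃ₐ[ℚ] L) :
    Ideal (𝓞 (fixedField H)) :=
  Q.comap ((MulSemiringAction.toRingHom (L ≃ₐ[ℚ] L) (𝓞 L) g).comp
    (algebraMap (𝓞 (fixedField H)) (𝓞 L)))

lemma mem_Ig {Q : Ideal (𝓞 L)} {H : Subgroup (L ≃ₐ[ℚ] L)} {g : L ≃ₐ[ℚ] L}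
    {y : 𝓞 (fixedField H)} :
    y ∈ Ig L Q H g ↔ g • (algebraMap (𝓞 (fixedField H)) (𝓞 L) y) ∈ Q := Iff.rfl

section
variable (p : ℕ) (hp : p.Prime) (Q : Ideal (𝓞 L)) (hQ : Q.IsPrime) (hpQ : (p : 𝓞 L) ∈ Q)
  (H : Subgroup (L ≃ₐ[ℚ] L))
  (hgood : ∀ (g τ : L ≃ₐ[ℚ] L), τ ∉ H →
      ∃ y : 𝓞 (fixedField H), g • (τ • (algebraMap (𝓞 (fixedField H)) (𝓞 L) y) -
        algebraMap (𝓞 (fixedField H)) (𝓞 L) y) ∉ Q)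
  (σ : L ≃ₐ[ℚ] L) (hσ : ∀ x : 𝓞 L, σ • x - x ^ p ∈ Q)

lemma smul_int (g : L ≃ₐ[ℚ] L) (a : ℤ) : g • (a : 𝓞 L) = a :=
  map_intCast (MulSemiringAction.toRingHom (L ≃ₐ[ℚ] L) (𝓞 L) g) a

lemma mem_Ig_sub {Q : Ideal (𝓞 L)} {H : Subgroup (L ≃ₐ[ℚ] L)} {g : L ≃ₐ[ℚ] L}
    {y : 𝓞 (fixedField H)} {a : ℤ} :
    y - a ∈ Ig L Q H g ↔ g • (algebraMap (𝓞 (fixedField H)) (𝓞 L) y) - a ∈ Q := by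
  rw [mem_Ig, map_sub, smul_sub, map_intCast, smul_int]

include hp hQ hpQ hσ hgood in
lemma norm_Ig (g : L ≃ₐ[ℚ] L) : Ideal.absNorm (Ig L Q H g) = p ↔ g⁻¹ * σ * g ∈ H := by
  have e : ∀ y : 𝓞 (fixedField H), σ • g • (algebraMap (𝓞 (fixedField H)) (𝓞 L) y) -
      g • (algebraMap (𝓞 (fixedField H)) (𝓞 L) y) =
      g • ((g⁻¹ * σ * g) • (algebraMap (𝓞 (fixedField H)) (𝓞 L) y) -
        algebraMap (𝓞 (fixedField H)) (𝓞 L) y) := by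
    intro y
    rw [smul_sub, mul_smul, mul_smul, smul_inv_smul]
  rw [norm_iff _ _ p hp]
  constructor
  · rintro ⟨-, -, h⟩
    by_contra hn
    obtain ⟨y, hy⟩ := hgood g _ hn
    apply hy
    rw [← e, fixed_int L Q hQ p hp hpQ σ hσ]
    obtain ⟨a, ha⟩ := h y
    exact ⟨a, (mem_Ig_sub L).mp ha⟩
  · intro h
    refine ⟨?_, ?_, ?_⟩
    · have := smul_int L g p
      rw [mem_Ig, map_natCast]
      rw [Int.cast_natCast] at this
      rwa [this]
    · have : (Ig L Q H g).IsPrime := Ideal.IsPrime.comap _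
      exact this.ne_top
    · intro y
      have := e y
      rw [smul_alg L H _ h, sub_self, smul_zero] at this
      have h2 : σ • g • (algebraMap (𝓞 (fixedField H)) (𝓞 L) y) -
        g • (algebraMap (𝓞 (fixedField H)) (𝓞 L) y) ∈ Q := by rw [this]; exact Q.zero_mem
      rw [fixed_int L Q hQ p hp hpQ σ hσ] at h2
      obtain ⟨a, ha⟩ := h2
      exact ⟨a, (mem_Ig_sub L).mpr ha⟩

open Pointwise in
include hp hQ hpQ in
lemma surj_Ig (I : Ideal (𝓞 (fixedField H))) (hI : Ideal.absNorm I = p) :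
    ∃ g, Ig L Q H g = I := by
  have hpr : I.IsPrime := Ideal.isPrime_of_irreducible_absNorm (by rw [hI]; exact hp)
  obtain ⟨Q', -, hQ', hc⟩ := Ideal.exists_ideal_over_prime_of_isIntegral (S := 𝓞 L) I ⊥ (by
    rw [Ideal.comap_bot_of_injective]
    · exact bot_le
    · exact FaithfulSMul.algebraMap_injective _ _)
  have hpQ' : (p : 𝓞 L) ∈ Q' := by
    have h0 : (p : 𝓞 (fixedField H)) ∈ I := by rw [← hI]; exact Ideal.absNorm_mem I
    rw [← hc, Ideal.mem_comap, map_natCast] at h0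
    exact h0
  obtain ⟨g, hg⟩ := Algebra.IsInvariant.exists_smul_of_under_eq ℤ (𝓞 L) (L ≃ₐ[ℚ] L) Q' Q (by
    rw [under_eq L Q hQ p hp hpQ, under_eq L Q' hQ' p hp hpQ'])
  refine ⟨g, ?_⟩
  ext y
  rw [mem_Ig, ← hc, Ideal.mem_comap, hg, Ideal.smul_mem_pointwise_smul_iff]

include hp hQ hpQ hσ hgood in
lemma inj_Ig (g g' : L ≃ₐ[ℚ] L) (hg : g⁻¹ * σ * g ∈ H) (h : Ig L Q H g = Ig L Q H g') :
    g⁻¹ * g' ∈ H := by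
  by_contra hn
  obtain ⟨y, hy⟩ := hgood g _ hn
  apply hy
  have h1 := ((norm_iff _ _ p hp).mp ((norm_Ig L p hp Q hQ hpQ H hgood σ hσ g).mpr hg)).2.2 y
  obtain ⟨a, ha⟩ := h1
  have ha' := ha
  rw [h] at ha'
  rw [mem_Ig_sub] at ha ha'
  rw [smul_sub, mul_smul, smul_inv_smul]
  simpa using Q.sub_mem ha' ha

open Classical in
include hp hQ hpQ hσ hgood in
lemma card_frob : (Finset.univ.filter fun g : L ≃ₐ[ℚ] L => g⁻¹ * σ * g ∈ (H : Set (L ≃ₐ[ℚ] L))).card =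
    Nat.card H * rK (fixedField H) p := by
  rw [rK_eq, Finset.card_eq_sum_card_fiberwise (f := fun g => Ig L Q H g) (t := nI (fixedField H) p)]
  · rw [Finset.sum_const_nat (m := Nat.card H), mul_comm]
    intro I hI
    obtain ⟨g₀, rfl⟩ := surj_Ig L p hp Q hQ hpQ H I (mem_nI.mp hI)
    have hg₀ := (norm_Ig L p hp Q hQ hpQ H hgood σ hσ g₀).mp (mem_nI.mp hI)
    have : (Finset.univ.filter fun g : L ≃ₐ[ℚ] L => g ∈ H).card = Nat.card H := by
      rw [Nat.card_eq_fintype_card, Fintype.card_subtype]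
    rw [← this, ← Finset.card_image_of_injective (Finset.univ.filter fun g : L ≃ₐ[ℚ] L => g ∈ H) (mul_right_injective g₀)]
    congr 1
    ext g
    simp only [Finset.mem_filter, Finset.mem_univ, true_and, Finset.mem_image, SetLike.mem_coe]
    constructor
    · rintro ⟨hg, hI⟩
      exact ⟨g₀⁻¹ * g, inj_Ig L p hp Q hQ hpQ H hgood σ hσ g₀ g hg₀ hI.symm, by group⟩
    · rintro ⟨h, hh, rfl⟩
      refine ⟨?_, ?_⟩
      · have := H.mul_mem (H.mul_mem (H.inv_mem hh) hg₀) hh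
        convert this using 1
        group
      · ext y
        rw [mem_Ig, mem_Ig, mul_smul, smul_alg L H h hh]
  · intro g hg
    simp only [Finset.coe_filter, Finset.mem_univ, true_and, Set.mem_ofPred_eq, SetLike.mem_coe] at hg
    exact mem_nI.mpr ((norm_Ig L p hp Q hQ hpQ H hgood σ hσ g).mpr hg)

end

open Classical in
lemma frob_mean : ∃ N : ℕ, N ≠ 0 ∧ ∀ (Q : ℕ → Ideal (𝓞 L)) (φ : ℕ → (L ≃ₐ[ℚ] L)),
    (∀ p : ℕ, p.Prime → (Q p).IsPrime ∧ (p : 𝓞 L) ∈ Q p ∧ ∀ x : 𝓞 L, φ p • x - x ^ p ∈ Q p) →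
    ∀ H : Subgroup (L ≃ₐ[ℚ] L), MeanTo (fun p =>
      ((Finset.univ.filter fun g : (L ≃ₐ[ℚ] L) => g⁻¹ * φ p * g ∈ (H : Set (L ≃ₐ[ℚ] L))).card : ℝ)) (Nat.card H) := by
  obtain ⟨N, hN, h⟩ := good_sub L
  refine ⟨N, hN, fun Q φ hφ H => ?_⟩
  have h1 : MeanTo (fun p => (rK (fixedField H) p : ℝ)) 1 := aK_density (fixedField H)
  have h2 := h1.smul (Nat.card H : ℝ)
  rw [mul_one] at h2
  refine h2.congr' N hN fun p hp hd => ?_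
  obtain ⟨hQ, hpQ, hs⟩ := hφ p hp
  rw [card_frob L p hp (Q p) hQ hpQ H (h p hp hd (Q p) hQ hpQ H) (φ p) hs]
  push_cast
  rfl

end DLB
end

section
open MeasureTheory Filter Topology Set NumberField IntermediateField Polynomial

namespace DLB
section
variable (L : Type*) [Field L] [NumberField L] [IsGalois ℚ L]

lemma root_lift (f : ℤ[X]) (hf : f.Monic) (β : L) (hβ : aeval β f = 0) :
    ∃ b : 𝓞 L, (b : L) = β ∧ aeval b f = 0 := by
  have hi : IsIntegral ℤ β := ⟨f, hf, by rwa [← aeval_def]⟩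
  obtain ⟨b, rfl⟩ : ∃ b : 𝓞 L, (b : L) = β := ⟨⟨β, hi⟩, rfl⟩
  refine ⟨b, rfl, ?_⟩
  apply RingOfIntegers.coe_injective
  rw [← aeval_algebraMap_apply, map_zero]
  exact hβ

lemma eval_int (f : ℤ[X]) (a : ℤ) (Q : Ideal (𝓞 L)) (hQ : Q.IsPrime) (hf : f.Monic)
    (hs : (f.map (algebraMap ℤ L)).Splits) (h : ((f.eval a : ℤ) : 𝓞 L) ∈ Q) :
    ∃ b : 𝓞 L, aeval b f = 0 ∧ (a : 𝓞 L) - b ∈ Q := by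
  classical
  have h1 := hs.eval_eq_prod_roots_of_monic (hf.map _) (a : L)
  have hr : ∀ x ∈ (f.map (algebraMap ℤ L)).roots, ∃ b : 𝓞 L, (b : L) = x ∧ aeval b f = 0 := by
    intro x hx
    apply root_lift L f hf
    rw [mem_roots (hf.map _).ne_zero, IsRoot.def, eval_map_algebraMap] at hx
    exact hx
  have e1 : (f.map (algebraMap ℤ L)).eval (a : L) = ((f.eval a : ℤ) : L) := by
    rw [eval_map_algebraMap]
    have := aeval_algebraMap_apply L a f
    simpa using this
  choose! r hr1 hr2 using hr
  have e2 : ((f.eval a : ℤ) : 𝓞 L) =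
      ((f.map (algebraMap ℤ L)).roots.map fun x => (a : 𝓞 L) - r x).prod := by
    apply RingOfIntegers.coe_injective
    rw [map_multiset_prod, Multiset.map_map]
    have e3 : algebraMap (𝓞 L) L ((f.eval a : ℤ) : 𝓞 L) = ((f.eval a : ℤ) : L) := by simp
    rw [e3, ← e1, h1]
    congr 1
    refine Multiset.map_congr rfl fun x hx => ?_
    rw [Function.comp, map_sub, map_intCast]
    congr 1
    exact (hr1 x hx).symm
  rw [e2, hQ.multiset_prod_mem_iff_exists_mem] at h
  obtain ⟨y, hy, hyQ⟩ := h
  rw [Multiset.mem_map] at hy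
  obtain ⟨x, hx, rfl⟩ := hy
  exact ⟨r x, hr2 x hx, hyQ⟩

lemma poly_good (f : ℤ[X]) (hf : f.Monic) (hs : (f.map (algebraMap ℤ L)).Splits) :
    ∃ N : ℕ, N ≠ 0 ∧ ∀ p : ℕ, p.Prime → ¬ p ∣ N → ∀ Q : Ideal (𝓞 L), Q.IsPrime →
      (p : 𝓞 L) ∈ Q → ∀ σ : L ≃ₐ[ℚ] L, (∀ x : 𝓞 L, σ • x - x ^ p ∈ Q) →
      ((∃ m : ℤ, (p : ℤ) ∣ f.eval m) ↔ ∃ β : L, aeval β f = 0 ∧ σ β = β) := by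
  obtain ⟨N, hN, h⟩ := bad_fin L
    (fun i : {i : (L ≃ₐ[ℚ] L) × (f.rootSet (𝓞 L)) // i.1 • (i.2 : 𝓞 L) ≠ i.2} =>
      i.1.1 • (i.1.2 : 𝓞 L) - i.1.2) (fun i => sub_ne_zero.mpr i.2)
  refine ⟨N, hN, fun p hp hd Q hQ hpQ σ hσ => ⟨?_, ?_⟩⟩
  · rintro ⟨m, hm⟩
    obtain ⟨b, hb, hbQ⟩ := eval_int L f m Q hQ hf hs ((int_mem L Q hQ p hp hpQ _).mpr hm)
    refine ⟨b, ?_, ?_⟩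
    · rw [aeval_algebraMap_apply, hb, map_zero]
    · have h2 : σ • b - b ∈ Q := by
        rw [fixed_int L Q hQ p hp hpQ σ hσ]
        exact ⟨m, by rw [← neg_sub]; exact Q.neg_mem hbQ⟩
      by_contra hne
      refine h p hp hd Q hQ hpQ ⟨⟨σ, ⟨b, mem_rootSet.mpr ⟨hf.ne_zero, hb⟩⟩⟩, fun he => hne ?_⟩ h2
      exact congrArg (fun z : 𝓞 L => (z : L)) he
  · rintro ⟨β, hβ, hfix⟩
    obtain ⟨b, rfl, hb⟩ := root_lift L f hf β hβ
    have h2 : σ • b = b := RingOfIntegers.ext hfix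
    have h3 : σ • b - b ∈ Q := by rw [h2, sub_self]; exact Q.zero_mem
    rw [fixed_int L Q hQ p hp hpQ σ hσ] at h3
    obtain ⟨a, ha⟩ := h3
    refine ⟨a, (int_mem L Q hQ p hp hpQ _).mp ?_⟩
    have h4 := sub_dvd_eval_sub b (a : 𝓞 L) (f.map (algebraMap ℤ (𝓞 L)))
    have e1 : (f.map (algebraMap ℤ (𝓞 L))).eval (a : 𝓞 L) = ((f.eval a : ℤ) : 𝓞 L) := by
      rw [eval_map_algebraMap]
      have := aeval_algebraMap_apply (𝓞 L) a f
      simpa using this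
    rw [e1, eval_map_algebraMap, hb, zero_sub, dvd_neg] at h4
    exact Q.mem_of_dvd h4 ha

open Classical in
theorem monic_case (n : ℕ) (f : Fin n → ℤ[X]) (hf : ∀ i, (f i).Monic)
    (hs : ∀ i, ((f i).map (algebraMap ℤ L)).Splits) (hd : ∀ i, 0 < (f i).natDegree) :
    ∃ d : ℝ, MeanTo (fun p => if ∀ i, ∃ m : ℤ, (p : ℤ) ∣ (f i).eval m then 1 else 0) d ∧
      1 / (∏ i, ((f i).natDegree : ℝ)) ≤ d := by
  choose N hN0 hN using fun i => poly_good L (f i) (hf i) (hs i)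
  have hφ : ∀ p : ℕ, ∃ (Q : Ideal (𝓞 L)) (σ : L ≃ₐ[ℚ] L), p.Prime → Q.IsPrime ∧ (p : 𝓞 L) ∈ Q ∧
      ∀ x : 𝓞 L, σ • x - x ^ p ∈ Q := by
    intro p
    by_cases hp : p.Prime
    · obtain ⟨Q, hQ, hpQ⟩ := exists_Q L p hp
      obtain ⟨σ, hσ⟩ := exists_frob L Q hQ p hp hpQ
      exact ⟨Q, σ, fun _ => ⟨hQ, hpQ, hσ⟩⟩
    · exact ⟨⊥, 1, fun h => absurd h hp⟩
  choose Q φ hφ using hφ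
  obtain ⟨-, -, hmean⟩ := frob_mean L
  have hmean := hmean Q φ hφ
  set A : Set (L ≃ₐ[ℚ] L) := {g | ∀ i, ∃ β : L, aeval β (f i) = 0 ∧ g β = β} with hA
  have hG := grp_density φ hmean A (by
    intro x y hxy hx i
    obtain ⟨β, hβ, hfix⟩ := hx i
    refine ⟨β, hβ, ?_⟩
    have h1 : Subgroup.zpowers x ≤ MulAction.stabilizer (L ≃ₐ[ℚ] L) β := by
      rw [Subgroup.zpowers_le]
      exact hfix
    rw [hxy, Subgroup.zpowers_le] at h1
    exact h1) (by
    intro g x hx i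
    obtain ⟨β, hβ, hfix⟩ := hx i
    refine ⟨g β, ?_, ?_⟩
    · have := aeval_algHom_apply (g.toAlgHom.restrictScalars ℤ) β (f i)
      rw [hβ, map_zero] at this
      exact this
    · have : (g * x * g⁻¹) (g β) = g (x (g⁻¹ (g β))) := rfl
      rw [this, show g⁻¹ (g β) = β from g.symm_apply_apply β, hfix])
  refine ⟨_, hG.congr' (∏ i, N i) (Finset.prod_ne_zero_iff.mpr fun i _ => hN0 i) ?_, ?_⟩
  · intro p hp hpN
    obtain ⟨hQ, hpQ, hσ⟩ := hφ p hp
    have : φ p ∈ A ↔ ∀ i, ∃ m : ℤ, (p : ℤ) ∣ (f i).eval m := by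
      refine forall_congr' fun i => ?_
      exact (hN i p hp (fun h => hpN (h.trans (Finset.dvd_prod_of_mem _ (Finset.mem_univ i))))
        (Q p) hQ hpQ (φ p) hσ).symm
    simp only [this]
  · have hroot : ∀ i, ∃ β : L, aeval β (f i) = 0 := by
      intro i
      obtain ⟨β, hβ⟩ := (hs i).exists_eval_eq_zero (by
        rw [(hf i).degree_map]
        exact (natDegree_pos_iff_degree_pos.mp (hd i)).ne')
      exact ⟨β, by rwa [eval_map_algebraMap] at hβ⟩
    choose β hβ using hroot
    have : Finite (MulAction.orbit (L ≃ₐ[ℚ] L) β) := (Set.finite_range _).to_subtype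
    have := Fintype.ofFinite (MulAction.orbit (L ≃ₐ[ℚ] L) β)
    have horb := MulAction.card_orbit_mul_card_stabilizer_eq_card_group (L ≃ₐ[ℚ] L) β
    have h1 : Fintype.card (MulAction.orbit (L ≃ₐ[ℚ] L) β) ≤ ∏ i, (f i).natDegree := by
      have h2 : (MulAction.orbit (L ≃ₐ[ℚ] L) β).toFinset ⊆
          Fintype.piFinset fun i => ((f i).map (algebraMap ℤ L)).roots.toFinset := by
        intro γ hγ
        rw [Set.mem_toFinset] at hγ
        obtain ⟨g, rfl⟩ := hγ
        rw [Fintype.mem_piFinset]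
        intro i
        rw [Multiset.mem_toFinset, mem_roots ((hf i).map _).ne_zero, IsRoot.def,
          eval_map_algebraMap]
        have := aeval_algHom_apply (g.toAlgHom.restrictScalars ℤ) (β i) (f i)
        rw [hβ, map_zero] at this
        exact this
      rw [← Set.toFinset_card]
      refine (Finset.card_le_card h2).trans ?_
      rw [Fintype.card_piFinset]
      refine Finset.prod_le_prod' fun i _ => ?_
      exact (Multiset.toFinset_card_le _).trans ((card_roots' _).trans natDegree_map_le)
    have h3 : Fintype.card (MulAction.stabilizer (L ≃ₐ[ℚ] L) β) ≤
        (Finset.univ.filter fun g => g ∈ A).card := by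
      rw [Fintype.card_subtype]
      refine Finset.card_le_card fun g hg => ?_
      simp only [Finset.mem_filter, Finset.mem_univ, true_and] at hg ⊢
      exact fun i => ⟨β i, hβ i, congrFun (MulAction.mem_stabilizer_iff.mp hg) i⟩
    have hpos : (0 : ℝ) < ∏ i, ((f i).natDegree : ℝ) :=
      Finset.prod_pos fun i _ => by exact_mod_cast hd i
    have hc : (0 : ℝ) < Fintype.card (L ≃ₐ[ℚ] L) := by exact_mod_cast Fintype.card_pos
    rw [div_le_div_iff₀ hpos hc, one_mul, ← horb]
    have h4 := Nat.mul_le_mul h1 h3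
    rw [mul_comm (∏ i, (f i).natDegree)] at h4
    rw [← Nat.cast_prod, ← Nat.cast_mul, Nat.cast_le]
    convert h4

end

lemma normalize_iff (P : ℤ[X]) (hP : 0 < P.natDegree) (p : ℕ) (hp : p.Prime)
    (hc : ¬ (p : ℤ) ∣ P.leadingCoeff) :
    (∃ m : ℤ, (p : ℤ) ∣ P.integralNormalization.eval m) ↔ ∃ m : ℤ, (p : ℤ) ∣ P.eval m := by
  have hpp := Nat.prime_iff_prime_int.mp hp
  have e : ∀ m : ℤ, P.integralNormalization.eval (P.leadingCoeff * m) =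
      P.leadingCoeff ^ (P.natDegree - 1) * P.eval m := by
    intro m
    simpa [eval₂_id] using integralNormalization_eval₂_leadingCoeff_mul hP (RingHom.id ℤ) m
  constructor
  · rintro ⟨a, ha⟩
    obtain ⟨u, v, huv⟩ := (hpp.irreducible.coprime_iff_not_dvd).mpr hc
    refine ⟨v * a, ?_⟩
    have h1 : (p : ℤ) ∣ P.leadingCoeff * (v * a) - a :=
      ⟨-(u * a), by linear_combination a * huv⟩
    have h2 := h1.trans (sub_dvd_eval_sub _ _ P.integralNormalization)
    have h3 := (dvd_sub_left ha).mp h2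
    rw [e] at h3
    exact (hpp.dvd_or_dvd h3).resolve_left fun h => hc (hpp.dvd_of_dvd_pow h)
  · rintro ⟨m, hm⟩
    exact ⟨P.leadingCoeff * m, by rw [e]; exact hm.mul_left _⟩

lemma exists_split_aux (F : ℚ[X]) (L : Type) [Field L] [inst : Algebra ℚ L]
    [h : IsSplittingField ℚ L F] :
    ∃ (L : Type) (_ : Field L) (_ : NumberField L) (_ : IsGalois ℚ L),
      (F.map (algebraMap ℚ L)).Splits := by
  have hc : CharZero L := algebraRat.charZero L
  have e : inst = DivisionRing.toRatAlgebra := Subsingleton.elim _ _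
  subst e
  have : FiniteDimensional ℚ L := IsSplittingField.finiteDimensional L F
  have : NumberField L := {}
  have : Normal ℚ L := Normal.of_isSplittingField F
  have : IsGalois ℚ L := {}
  exact ⟨L, inferInstance, inferInstance, inferInstance, IsSplittingField.splits L F⟩

lemma exists_split (F : ℚ[X]) :
    ∃ (L : Type) (_ : Field L) (_ : NumberField L) (_ : IsGalois ℚ L),
      (F.map (algebraMap ℚ L)).Splits :=
  @exists_split_aux F F.SplittingField _ _ (IsSplittingField.splittingField F)

open Classical in
theorem main_mean (n : ℕ) (P : Fin n → ℤ[X]) (hP : ∀ i, 0 < (P i).natDegree) :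
    ∃ d : ℝ, MeanTo (fun p => if ∀ i, ∃ m : ℤ, (p : ℤ) ∣ (P i).eval m then 1 else 0) d ∧
      1 / (∏ i, ((P i).natDegree : ℝ)) ≤ d := by
  have hP0 : ∀ i, P i ≠ 0 := fun i h => by
    have := hP i
    rw [h, natDegree_zero] at this
    exact lt_irrefl _ this
  have hm : ∀ i, (P i).integralNormalization.Monic := fun i => monic_integralNormalization (hP0 i)
  let F : ℚ[X] := ∏ i, (P i).integralNormalization.map (algebraMap ℤ ℚ)
  have hF : F ≠ 0 := Finset.prod_ne_zero_iff.mpr fun i _ => ((hm i).map _).ne_zero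
  obtain ⟨L, _, _, _, h1⟩ := exists_split F
  obtain ⟨d, hd, hle⟩ := monic_case L n (fun i => (P i).integralNormalization) hm
    (fun i => by
      have h2 := h1.of_dvd (Polynomial.map_ne_zero hF)
        (Polynomial.map_dvd _ (Finset.dvd_prod_of_mem _ (Finset.mem_univ i)))
      rw [Polynomial.map_map] at h2
      rwa [Subsingleton.elim ((algebraMap ℚ L).comp (algebraMap ℤ ℚ)) (algebraMap ℤ L)] at h2) (fun i => by rw [natDegree_integralNormalization]; exact hP i)
  refine ⟨d, hd.congr' (∏ i, (P i).leadingCoeff.natAbs)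
    (Finset.prod_ne_zero_iff.mpr fun i _ => by simpa using hP0 i) ?_, ?_⟩
  · intro p hp hpN
    have : (∀ i, ∃ m : ℤ, (p : ℤ) ∣ (P i).integralNormalization.eval m) ↔
        ∀ i, ∃ m : ℤ, (p : ℤ) ∣ (P i).eval m := by
      refine forall_congr' fun i => normalize_iff (P i) (hP i) p hp fun h => hpN ?_
      exact (Int.natCast_dvd.mp h).trans (Finset.dvd_prod_of_mem _ (Finset.mem_univ i))
    simp only [this]
  · simpa only [natDegree_integralNormalization] using hle

end DLB
end

open Polynomial Filter

theorem density_lower_bound (n : ℕ) (P : Fin n → Polynomial ℤ)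
    (hP : ∀ i, 0 < (P i).natDegree) :
    ∃ d : ℝ,
      Filter.Tendsto (fun x : ℕ =>
          (Nat.card {p : ℕ | p ≤ x ∧ p.Prime ∧
              ∀ i : Fin n, ∃ m : ℤ, (p : ℤ) ∣ (P i).eval m} : ℝ) /
            (Nat.card {p : ℕ | p ≤ x ∧ p.Prime} : ℝ))
        Filter.atTop (nhds d) ∧
      (1 : ℝ) / (∏ i, ((P i).natDegree : ℝ)) ≤ d := by
  classical
  obtain ⟨d, hd, hle⟩ := DLB.main_mean n P hP
  refine ⟨d, ?_, hle⟩
  refine Filter.Tendsto.congr (fun x => ?_) hd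
  congr 1
  · rw [← Finset.sum_filter, Finset.sum_const, nsmul_eq_mul, mul_one]
    congr 1
    rw [Nat.card_coe_set_eq, ← Set.ncard_coe_finset]
    congr 1
    ext p
    simp [Nat.mem_primesLE, and_assoc]
  · congr 1
    rw [Nat.card_coe_set_eq, ← DLB.card_primesLE, ← Set.ncard_coe_finset]
    congr 1
    ext p
    simp [Nat.mem_primesLE]
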